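/- arXiv:2303.13901 — 2 statements merged into one kernel-verified Lean document; each statement's English description precedes it below -/
import Mathlib

section
/- Let n ≥ 1, K ⊂ ℝ^n compact, (μ0^N), (μ1^N) Borel probability measures supported in K converging narrowly to μ0 and μ1 respectively, with μ0 absolutely continuous with respect to Lebesgue measure. Let π^N be couplings of (μ0^N, μ1^N) converging narrowly to π, the (unique) optimal coupling for W2²(μ0,μ1), and let v0^N(x) = ∫ (y − x) dπ^N(y|x) and v0 = T − id where π = (id,T)_# μ0. For each N let S^N be a Borel map such that (id,S^N)_# μ0 is an optimal coupling for W2²(μ0, μ0^N). Then v0^N ∘ S^N converges to v0 strongly in L²(μ0): ∫ |v0^N(S^N(x)) − v0(x)|² dμ0(x) → 0 as N → ∞. -/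
open MeasureTheory ENNReal Filter Topology RealInnerProductSpace
open scoped Classical

noncomputable section

abbrev Eucl (n : ℕ) : Type := EuclideanSpace ℝ (Fin n)

/-- Truncated cosine `Cos`. -/
def truncCos (s : ℝ) : ℝ := Real.cos (min |s| (Real.pi / 2))

/-- The Hellinger–Kantorovich cost function `c_κ`. -/
def cHK {n : ℕ} (κ : ℝ) (x y : Eucl n) : ℝ≥0∞ :=
  if dist x y < κ * Real.pi / 2 then
    ENNReal.ofReal (-2 * κ ^ 2 * Real.log (Real.cos (dist x y / κ)))
  else ⊤

/-- Kullback–Leibler divergence `KL(ρ|μ)`. -/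
def KLdiv {α : Type*} [MeasurableSpace α] (ρ μ : Measure α) : ℝ≥0∞ :=
  if ρ ≪ μ then
    ∫⁻ x, ENNReal.ofReal ((ρ.rnDeriv μ x).toReal * Real.log (ρ.rnDeriv μ x).toReal
      - (ρ.rnDeriv μ x).toReal + 1) ∂μ
  else ⊤

/-- The soft-marginal Hellinger–Kantorovich functional `E_κ(π|μ0,μ1)`. -/
def HKfun {n : ℕ} (κ : ℝ) (π : Measure (Eucl n × Eucl n)) (μ0 μ1 : Measure (Eucl n)) : ℝ≥0∞ :=
  ∫⁻ p, cHK κ p.1 p.2 ∂π + ENNReal.ofReal (κ ^ 2) * KLdiv (π.map Prod.fst) μ0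
    + ENNReal.ofReal (κ ^ 2) * KLdiv (π.map Prod.snd) μ1

/-- The squared Hellinger–Kantorovich distance `HK_κ²(μ0,μ1)`. -/
def HK2 {n : ℕ} (κ : ℝ) (μ0 μ1 : Measure (Eucl n)) : ℝ≥0∞ :=
  ⨅ (π : Measure (Eucl n × Eucl n)) (_ : IsFiniteMeasure π), HKfun κ π μ0 μ1

/-- The squared 2-Wasserstein distance `W2²(μ0,μ1)`. -/
def W2sq {n : ℕ} (μ0 μ1 : Measure (Eucl n)) : ℝ≥0∞ :=
  ⨅ (π : Measure (Eucl n × Eucl n))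
    (_ : π.map Prod.fst = μ0 ∧ π.map Prod.snd = μ1),
      ∫⁻ p, ENNReal.ofReal (dist p.1 p.2 ^ 2) ∂π

/-- Narrow convergence of a sequence of measures. -/
def NarrowTendsto {α : Type*} [MeasurableSpace α] [TopologicalSpace α]
    (ρ : ℕ → Measure α) (ρlim : Measure α) : Prop :=
  ∀ φ : BoundedContinuousFunction α ℝ,
    Tendsto (fun N => ∫ x, φ x ∂(ρ N)) atTop (𝓝 (∫ x, φ x ∂ρlim))

/-- The spherical Hellinger–Kantorovich distance `SHK_κ(μ0,μ1)`. -/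
def SHK {n : ℕ} (κ : ℝ) (μ0 μ1 : Measure (Eucl n)) : ℝ :=
  κ * Real.arccos (1 - (HK2 κ μ0 μ1).toReal / (2 * κ ^ 2))

/-- The square-root measure `√(ρσ)`. -/
def sqrtMeasure {α : Type*} [MeasurableSpace α] (ρ σ : Measure α) : Measure α :=
  (ρ + σ).withDensity (fun x => (ρ.rnDeriv (ρ + σ) x * σ.rnDeriv (ρ + σ) x) ^ (1/2 : ℝ))



/-- barycentric HK velocity. -/
def barV {n : ℕ} (κ : ℝ) (μ0 : Measure (Eucl n)) (π : Measure (Eucl n × Eucl n))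
    [IsFiniteMeasure π] (x : Eucl n) : Eucl n :=
  (κ * ((π.map Prod.fst).rnDeriv μ0 x).toReal) •
    ∫ y, (Real.tan (‖y - x‖ / κ) / ‖y - x‖) • (y - x) ∂(π.condKernel x)

/-- barycentric HK growth. -/
def barA {n : ℕ} (μ0 : Measure (Eucl n)) (π : Measure (Eucl n × Eucl n)) (x : Eucl n) : ℝ :=
  2 * (((π.map Prod.fst).rnDeriv μ0 x).toReal - 1)

/-- barycentric W2 velocity. -/
def barW {n : ℕ} (π : Measure (Eucl n × Eucl n)) [IsFiniteMeasure π] (x : Eucl n) : Eucl n :=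
  ∫ y, (y - x) ∂(π.condKernel x)

end

/-- The product of two measures normalized so that its marginals are again `α` and `β`,
provided these have the same finite mass. -/
noncomputable def indepCoupling {X : Type*} [MeasurableSpace X] (α β : Measure X) : Measure (X × X) :=
  (α Set.univ)⁻¹ • α.prod β

lemma indepCoupling_map_fst {X : Type*} [MeasurableSpace X] (α β : Measure X)
    [IsFiniteMeasure α] [IsFiniteMeasure β] (h : α Set.univ = β Set.univ) :
    (indepCoupling α β).map Prod.fst = α := by
  rcases eq_or_ne (α Set.univ) 0 with h0 | h0
  · have : α = 0 := Measure.measure_univ_eq_zero.1 h0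
    simp [indepCoupling, this]
  · rw [indepCoupling, Measure.map_smul, Measure.map_fst_prod, ← h, smul_smul,
      ENNReal.inv_mul_cancel h0 (measure_ne_top _ _), one_smul]

lemma indepCoupling_map_snd {X : Type*} [MeasurableSpace X] (α β : Measure X)
    [IsFiniteMeasure α] [IsFiniteMeasure β] (h : α Set.univ = β Set.univ) :
    (indepCoupling α β).map Prod.snd = β := by
  rcases eq_or_ne (α Set.univ) 0 with h0 | h0
  · have : α = 0 := Measure.measure_univ_eq_zero.1 h0
    have : β = 0 := Measure.measure_univ_eq_zero.1 (h ▸ h0)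
    simp [indepCoupling, this]
  · rw [indepCoupling, Measure.map_smul, Measure.map_snd_prod, smul_smul,
      ENNReal.inv_mul_cancel h0 (measure_ne_top _ _), one_smul]

lemma indepCoupling_apply_eq_zero {X : Type*} [MeasurableSpace X] (α β : Measure X)
    [IsFiniteMeasure α] [IsFiniteMeasure β] {A : Set X} {s : Set (X × X)}
    (hα : α Aᶜ = 0) (hβ : β Aᶜ = 0) (hs : Disjoint s (A ×ˢ A)) :
    indepCoupling α β s = 0 := by
  have hsub : s ⊆ Aᶜ ×ˢ Set.univ ∪ Set.univ ×ˢ Aᶜ := by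
    intro p hp
    have := Set.disjoint_left.1 hs hp
    simp only [Set.mem_prod, not_and_or] at this
    rcases this with h | h
    · left; exact ⟨h, trivial⟩
    · right; exact ⟨trivial, h⟩
  have : α.prod β s = 0 := by
    refine measure_mono_null hsub (measure_union_null ?_ ?_) <;> simp [hα, hβ]
  simp [indepCoupling, this]

/-- The part of `μ` with mass `c` proportional to its restriction to `A`. -/
noncomputable def rescaledRestrict {X : Type*} [MeasurableSpace X] (μ : Measure X) (A : Set X)
    (c : ℝ≥0∞) : Measure X :=
  (c / μ A) • μ.restrict A

lemma rescaledRestrict_univ {X : Type*} [MeasurableSpace X] (μ : Measure X) [IsFiniteMeasure μ]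
    (A : Set X) {c : ℝ≥0∞} (hc : c ≤ μ A) : rescaledRestrict μ A c Set.univ = c := by
  rcases eq_or_ne (μ A) 0 with h0 | h0
  · have : c = 0 := by simpa [h0] using hc
    simp [rescaledRestrict, this]
  · simp [rescaledRestrict, ENNReal.div_mul_cancel h0 (measure_ne_top _ _)]

lemma rescaledRestrict_le {X : Type*} [MeasurableSpace X] (μ : Measure X)
    (A : Set X) {c : ℝ≥0∞} (hc : c ≤ μ A) : rescaledRestrict μ A c ≤ μ.restrict A := by
  refine Measure.le_iff.2 fun s _ => ?_
  simp only [rescaledRestrict, Measure.smul_apply, smul_eq_mul]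
  exact mul_le_of_le_one_left (by positivity) (ENNReal.div_le_of_le_mul (by simpa using hc))

lemma rescaledRestrict_compl {X : Type*} [MeasurableSpace X] (μ : Measure X)
    {A : Set X} (hA : MeasurableSet A) (c : ℝ≥0∞) : rescaledRestrict μ A c Aᶜ = 0 := by
  simp [rescaledRestrict, Measure.restrict_apply hA.compl]

lemma sum_rescaledRestrict_le {X ι : Type*} [MeasurableSpace X] [Fintype ι] (μ : Measure X)
    {A : ι → Set X} (hA : ∀ i, MeasurableSet (A i)) (hd : Pairwise (Function.onFun Disjoint A))
    {c : ι → ℝ≥0∞} (hc : ∀ i, c i ≤ μ (A i)) :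
    ∑ i, rescaledRestrict μ (A i) (c i) ≤ μ := by
  calc ∑ i, rescaledRestrict μ (A i) (c i) ≤ ∑ i, μ.restrict (A i) :=
        Finset.sum_le_sum fun i _ => rescaledRestrict_le μ (A i) (hc i)
    _ = μ.restrict (⋃ i, A i) := by
        rw [Measure.restrict_iUnion hd hA, Measure.sum_fintype]
    _ ≤ μ := Measure.restrict_le_self

/-- Two probability measures have a coupling which, up to the mass not common to both on the
pieces `A i`, only moves mass inside each piece. -/
lemma exists_coupling_of_pairwise_disjoint {X ι : Type*} [MeasurableSpace X] [Fintype ι]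
    (μ ν : Measure X) [IsProbabilityMeasure μ] [IsProbabilityMeasure ν]
    {A : ι → Set X} (hA : ∀ i, MeasurableSet (A i)) (hd : Pairwise (Function.onFun Disjoint A)) :
    ∃ γ : Measure (X × X), γ.map Prod.fst = μ ∧ γ.map Prod.snd = ν ∧
      ∀ s : Set (X × X), (∀ i, Disjoint s (A i ×ˢ A i)) →
        γ s ≤ 1 - ∑ i, min (μ (A i)) (ν (A i)) := by
  set c : ι → ℝ≥0∞ := fun i => min (μ (A i)) (ν (A i)) with hc
  have hcμ : ∀ i, c i ≤ μ (A i) := fun i => min_le_left _ _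
  have hcν : ∀ i, c i ≤ ν (A i) := fun i => min_le_right _ _
  set a : ι → Measure X := fun i => rescaledRestrict μ (A i) (c i) with ha
  set b : ι → Measure X := fun i => rescaledRestrict ν (A i) (c i) with hb
  have ha_le : ∑ i, a i ≤ μ := sum_rescaledRestrict_le μ hA hd hcμ
  have hb_le : ∑ i, b i ≤ ν := sum_rescaledRestrict_le ν hA hd hcν
  have ha_fin : ∀ i, IsFiniteMeasure (a i) := fun i =>
    isFiniteMeasure_of_le _ (rescaledRestrict_le μ (A i) (hcμ i))
  have hb_fin : ∀ i, IsFiniteMeasure (b i) := fun i =>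
    isFiniteMeasure_of_le _ (rescaledRestrict_le ν (A i) (hcν i))
  have : IsFiniteMeasure (∑ i, a i) := isFiniteMeasure_of_le _ ha_le
  have : IsFiniteMeasure (∑ i, b i) := isFiniteMeasure_of_le _ hb_le
  have ha_univ : ∀ i, a i Set.univ = c i := fun i => rescaledRestrict_univ μ _ (hcμ i)
  have hb_univ : ∀ i, b i Set.univ = c i := fun i => rescaledRestrict_univ ν _ (hcν i)
  have hab : ∀ i, a i Set.univ = b i Set.univ := fun i => by rw [ha_univ, hb_univ]
  have hμr : (μ - ∑ i, a i) Set.univ = 1 - ∑ i, c i := by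
    rw [Measure.sub_apply MeasurableSet.univ ha_le]
    simp [ha_univ]
  have hνr : (ν - ∑ i, b i) Set.univ = 1 - ∑ i, c i := by
    rw [Measure.sub_apply MeasurableSet.univ hb_le]
    simp [hb_univ]
  have hfin : IsFiniteMeasure (μ - ∑ i, a i) := isFiniteMeasure_of_le _ Measure.sub_le
  have hfin' : IsFiniteMeasure (ν - ∑ i, b i) := isFiniteMeasure_of_le _ Measure.sub_le
  refine ⟨indepCoupling (μ - ∑ i, a i) (ν - ∑ i, b i) + ∑ i, indepCoupling (a i) (b i),
    ?_, ?_, ?_⟩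
  · rw [Measure.map_add _ _ measurable_fst, Measure.map_finset_sum measurable_fst.aemeasurable,
      indepCoupling_map_fst _ _ (hμr.trans hνr.symm)]
    simp_rw [fun i => indepCoupling_map_fst _ _ (hab i)]
    exact Measure.sub_add_cancel_of_le ha_le
  · rw [Measure.map_add _ _ measurable_snd, Measure.map_finset_sum measurable_snd.aemeasurable,
      indepCoupling_map_snd _ _ (hμr.trans hνr.symm)]
    simp_rw [fun i => indepCoupling_map_snd _ _ (hab i)]
    exact Measure.sub_add_cancel_of_le hb_le
  · intro s hs
    have h0 : ∀ i, indepCoupling (a i) (b i) s = 0 := fun i =>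
      indepCoupling_apply_eq_zero _ _ (rescaledRestrict_compl μ (hA i) _)
        (rescaledRestrict_compl ν (hA i) _) (hs i)
    rw [Measure.add_apply, Measure.finsetSum_apply, Finset.sum_eq_zero fun i _ => h0 i, add_zero]
    calc _ ≤ indepCoupling (μ - ∑ i, a i) (ν - ∑ i, b i) Set.univ := measure_mono s.subset_univ
      _ = ((indepCoupling (μ - ∑ i, a i) (ν - ∑ i, b i)).map Prod.fst) Set.univ := by
        rw [Measure.map_apply measurable_fst MeasurableSet.univ, Set.preimage_univ]
      _ = _ := by rw [indepCoupling_map_fst _ _ (hμr.trans hνr.symm), hμr]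

lemma measure_frontier_diff_eq_zero {X : Type*} [MeasurableSpace X] [TopologicalSpace X]
    {μ : Measure X} {s t : Set X} (hs : μ (frontier s) = 0) (ht : μ (frontier t) = 0) :
    μ (frontier (s \ t)) = 0 := by
  refine measure_mono_null ((frontier_inter_subset s tᶜ).trans ?_) (measure_union_null hs ht)
  rw [frontier_compl]
  exact Set.union_subset_union Set.inter_subset_left Set.inter_subset_right

/-- A compact set is covered by finitely many disjoint Borel sets of small diameter whose
boundaries are negligible for a given absolutely continuous measure. -/
lemma IsCompact.exists_disjoint_cover_null_frontier {E : Type*} [NormedAddCommGroup E]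
    [NormedSpace ℝ E] [MeasurableSpace E] [BorelSpace E] [FiniteDimensional ℝ E]
    {lam μ : Measure E} [lam.IsAddHaarMeasure] (hμ : μ ≪ lam)
    {K : Set E} (hK : IsCompact K) {ε : ℝ} (hε : 0 < ε) :
    ∃ (m : ℕ) (A : Fin m → Set E), (∀ i, MeasurableSet (A i)) ∧
      Pairwise (Function.onFun Disjoint A) ∧ (∀ i, μ (frontier (A i)) = 0) ∧
      K ⊆ ⋃ i, A i ∧ ∀ i, ∀ x ∈ A i, ∀ y ∈ A i, dist x y < ε := by
  obtain ⟨t, -, ht, hKt⟩ := hK.finite_cover_balls (half_pos hε)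
  obtain ⟨m, f, hf⟩ : ∃ (m : ℕ) (f : Fin m → E), Set.range f = t := by
    obtain ⟨m, f, -, hf⟩ := ht.fin_param
    exact ⟨m, f, hf⟩
  set B : Fin m → Set E := fun i => Metric.ball (f i) (ε / 2) with hB
  have hBfr : ∀ i, μ (frontier (B i)) = 0 := fun i =>
    hμ (Convex.addHaar_frontier lam (convex_ball _ _))
  refine ⟨m, disjointed B, fun i => ?_, disjoint_disjointed B, fun i => ?_, ?_, ?_⟩
  · exact disjointedRec (p := MeasurableSet) (fun _ _ h => h.diff measurableSet_ball)
      measurableSet_ball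
  · exact disjointedRec (p := fun s => μ (frontier s) = 0)
      (fun _ j h => measure_frontier_diff_eq_zero h (hBfr j)) (hBfr i)
  · rw [iUnion_disjointed]
    intro x hx
    obtain ⟨y, hy, hxy⟩ := Set.mem_iUnion₂.1 (hKt hx)
    rw [← hf] at hy
    obtain ⟨i, rfl⟩ := hy
    exact Set.mem_iUnion.2 ⟨i, hxy⟩
  · intro i x hx y hy
    have hx' : dist x (f i) < ε / 2 := disjointed_subset B i hx
    have hy' : dist y (f i) < ε / 2 := disjointed_subset B i hy
    linarith [dist_triangle_right x y (f i)]

lemma NarrowTendsto.tendsto_probabilityMeasure {X : Type*} [MeasurableSpace X]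
    [TopologicalSpace X] [OpensMeasurableSpace X] {ν : ℕ → Measure X} {μ : Measure X}
    [∀ N, IsProbabilityMeasure (ν N)] [IsProbabilityMeasure μ] (h : NarrowTendsto ν μ) :
    Tendsto (β := ProbabilityMeasure X) (fun N => ⟨ν N, inferInstance⟩) atTop
      (@nhds (ProbabilityMeasure X) _ ⟨μ, inferInstance⟩) :=
  ProbabilityMeasure.tendsto_iff_forall_integral_tendsto.2 h

lemma NarrowTendsto.measure_compl_eq_zero {X : Type*} [MeasurableSpace X]
    [PseudoEMetricSpace X] [OpensMeasurableSpace X] {ν : ℕ → Measure X} {μ : Measure X}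
    [∀ N, IsProbabilityMeasure (ν N)] [IsProbabilityMeasure μ] (h : NarrowTendsto ν μ)
    {K : Set X} (hK : IsClosed K) (hν : ∀ N, ν N Kᶜ = 0) : μ Kᶜ = 0 := by
  have := ProbabilityMeasure.le_liminf_measure_open_of_tendsto h.tendsto_probabilityMeasure
    hK.isOpen_compl
  simpa [hν] using this

lemma ae_mem_prod_of_map {X Y : Type*} [MeasurableSpace X] [MeasurableSpace Y]
    {γ : Measure (X × Y)} {μ : Measure X} {ν : Measure Y}
    (h₁ : γ.map Prod.fst = μ) (h₂ : γ.map Prod.snd = ν) {K : Set X} {L : Set Y}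
    (hK : μ Kᶜ = 0) (hL : ν Lᶜ = 0) : ∀ᵐ p ∂γ, p.1 ∈ K ∧ p.2 ∈ L := by
  refine Filter.Eventually.and ?_ ?_
  · exact ae_of_ae_map measurable_fst.aemeasurable (p := fun x => x ∈ K) (h₁ ▸ hK)
  · exact ae_of_ae_map measurable_snd.aemeasurable (p := fun x => x ∈ L) (h₂ ▸ hL)

lemma isProbabilityMeasure_of_map {X Y : Type*} [MeasurableSpace X] [MeasurableSpace Y]
    {γ : Measure X} {f : X → Y} (hf : Measurable f) {μ : Measure Y} [IsProbabilityMeasure μ]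
    (h : γ.map f = μ) : IsProbabilityMeasure γ := by
  constructor
  rw [← Set.preimage_univ (f := f), ← Measure.map_apply hf MeasurableSet.univ, h, measure_univ]

lemma W2sq_le_of_pairwise_disjoint {n m : ℕ} (μ ν : Measure (Eucl n)) [IsProbabilityMeasure μ]
    [IsProbabilityMeasure ν] {K : Set (Eucl n)} (hμK : μ Kᶜ = 0) (hνK : ν Kᶜ = 0)
    {R : ℝ} (hR : ∀ x ∈ K, ∀ y ∈ K, dist x y ≤ R) {A : Fin m → Set (Eucl n)}
    (hA : ∀ i, MeasurableSet (A i)) (hd : Pairwise (Function.onFun Disjoint A))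
    {ε : ℝ} (hAε : ∀ i, ∀ x ∈ A i, ∀ y ∈ A i, dist x y < ε) :
    W2sq μ ν ≤ ENNReal.ofReal (ε ^ 2) +
      ENNReal.ofReal (R ^ 2) * (1 - ∑ i, min (μ (A i)) (ν (A i))) := by
  obtain ⟨γ, h₁, h₂, hγ⟩ := exists_coupling_of_pairwise_disjoint μ ν hA hd
  have : IsProbabilityMeasure γ := isProbabilityMeasure_of_map measurable_fst h₁
  set s : Set (Eucl n × Eucl n) := {p | ε ≤ dist p.1 p.2} with hs
  have hsm : MeasurableSet s :=
    (isClosed_le continuous_const (continuous_fst.dist continuous_snd)).measurableSet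
  have hsA : γ s ≤ 1 - ∑ i, min (μ (A i)) (ν (A i)) := by
    refine hγ s fun i => Set.disjoint_left.2 fun p hp hp' => ?_
    exact absurd (hAε i _ hp'.1 _ hp'.2) (not_lt.2 hp)
  calc W2sq μ ν ≤ ∫⁻ p, ENNReal.ofReal (dist p.1 p.2 ^ 2) ∂γ := iInf₂_le γ ⟨h₁, h₂⟩
    _ ≤ ∫⁻ p, (ENNReal.ofReal (ε ^ 2) + s.indicator (fun _ => ENNReal.ofReal (R ^ 2)) p) ∂γ := by
        refine lintegral_mono_ae ?_
        filter_upwards [ae_mem_prod_of_map h₁ h₂ hμK hνK] with p hp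
        by_cases hps : p ∈ s
        · rw [Set.indicator_of_mem hps]
          refine le_add_left (ENNReal.ofReal_le_ofReal ?_)
          gcongr
          exact hR _ hp.1 _ hp.2
        · rw [Set.indicator_of_notMem hps, add_zero]
          refine ENNReal.ofReal_le_ofReal ?_
          gcongr
          exact (not_le.1 hps).le
    _ = ENNReal.ofReal (ε ^ 2) + ENNReal.ofReal (R ^ 2) * γ s := by
        rw [lintegral_add_left measurable_const, lintegral_indicator_const hsm]
        simp
    _ ≤ _ := by gcongr

lemma tendsto_ofReal_sq_nhdsGT_zero :
    Tendsto (fun t : ℝ => ENNReal.ofReal (t ^ 2)) (𝓝[>] 0) (𝓝 0) := by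
  have : Continuous fun t : ℝ => ENNReal.ofReal (t ^ 2) :=
    ENNReal.continuous_ofReal.comp (continuous_pow 2)
  simpa using (this.tendsto 0).mono_left nhdsWithin_le_nhds

/-- On a compact set, narrow convergence to an absolutely continuous measure implies
convergence of the Wasserstein distance. -/
lemma NarrowTendsto.tendsto_W2sq {n : ℕ} {K : Set (Eucl n)} (hK : IsCompact K)
    {ν : ℕ → Measure (Eucl n)} {μ : Measure (Eucl n)} [∀ N, IsProbabilityMeasure (ν N)]
    [IsProbabilityMeasure μ] (hν : ∀ N, ν N Kᶜ = 0)
    (hμ : μ ≪ (volume : Measure (Eucl n))) (h : NarrowTendsto ν μ) :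
    Tendsto (fun N => W2sq μ (ν N)) atTop (𝓝 0) := by
  have hμK := h.measure_compl_eq_zero hK.isClosed hν
  refine ENNReal.tendsto_nhds_zero.2 fun η hη => ?_
  obtain ⟨ε, hε, hεη⟩ : ∃ ε : ℝ, 0 < ε ∧ ENNReal.ofReal (ε ^ 2) < η := by
    obtain ⟨ε, h1, h2⟩ :=
      ((tendsto_ofReal_sq_nhdsGT_zero.eventually_lt_const hη).and self_mem_nhdsWithin).exists
    exact ⟨ε, h2, h1⟩
  obtain ⟨m, A, hA, hd, hfr, hKA, hAε⟩ := hK.exists_disjoint_cover_null_frontier hμ hε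
  obtain ⟨R, hR⟩ := Metric.isBounded_iff.1 hK.isBounded
  have hone : ∑ i, μ (A i) = 1 := by
    rw [← tsum_fintype (L := .unconditional _), ← measure_iUnion hd hA,
      ← prob_compl_eq_zero_iff (MeasurableSet.iUnion hA)]
    exact measure_mono_null (Set.compl_subset_compl.2 hKA) hμK
  have hmin : Tendsto (fun N => 1 - ∑ i, min (μ (A i)) (ν N (A i))) atTop (𝓝 0) := by
    have h1 : Tendsto (fun N => ∑ i, min (μ (A i)) (ν N (A i))) atTop (𝓝 1) := by
      rw [← hone]
      refine tendsto_finsetSum _ fun i _ => ?_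
      have := ProbabilityMeasure.tendsto_measure_of_null_frontier_of_tendsto'
        h.tendsto_probabilityMeasure (hfr i)
      simpa using (tendsto_const_nhds (x := μ (A i))).min this
    simpa using ENNReal.Tendsto.sub (tendsto_const_nhds (x := 1)) h1 (by simp)
  have hlim : Tendsto (fun N => ENNReal.ofReal (ε ^ 2) +
      ENNReal.ofReal (R ^ 2) * (1 - ∑ i, min (μ (A i)) (ν N (A i)))) atTop
      (𝓝 (ENNReal.ofReal (ε ^ 2))) := by
    simpa using tendsto_const_nhds.add
      (ENNReal.Tendsto.const_mul hmin (.inr ENNReal.ofReal_ne_top))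
  filter_upwards [hlim.eventually_lt_const hεη] with N hN
  exact (W2sq_le_of_pairwise_disjoint μ (ν N) hμK (hν N) (fun x hx y hy => hR hx hy)
    hA hd hAε).trans hN.le

lemma ofReal_norm_sq_eq_enorm_sq {E : Type*} [SeminormedAddCommGroup E] (a : E) :
    ENNReal.ofReal (‖a‖ ^ 2) = ‖a‖ₑ ^ 2 := by
  rw [ENNReal.ofReal_pow (norm_nonneg a), ofReal_norm]

lemma lintegral_enorm_sq_eq_eLpNorm_sq {X E : Type*} [MeasurableSpace X] [NormedAddCommGroup E]
    (μ : Measure X) (f : X → E) : ∫⁻ x, ‖f x‖ₑ ^ 2 ∂μ = eLpNorm f 2 μ ^ 2 := by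
  have := eLpNorm_nnreal_pow_eq_lintegral (μ := μ) (f := f) (p := 2) two_ne_zero
  simpa using this.symm

/-- Jensen's inequality for the squared norm, shifted by a constant. -/
lemma enorm_integral_sub_sq_le {X E : Type*} [MeasurableSpace X] [NormedAddCommGroup E]
    [NormedSpace ℝ E] [CompleteSpace E] (μ : Measure X) [IsProbabilityMeasure μ] {f : X → E}
    (hf : AEStronglyMeasurable f μ) (w : E) :
    ‖∫ x, f x ∂μ - w‖ₑ ^ 2 ≤ ∫⁻ x, ‖f x - w‖ₑ ^ 2 ∂μ := by
  have hg : AEStronglyMeasurable (fun x => f x - w) μ := hf.sub aestronglyMeasurable_const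
  rw [lintegral_enorm_sq_eq_eLpNorm_sq μ fun x => f x - w]
  rcases eq_or_ne (eLpNorm (fun x => f x - w) 2 μ) ⊤ with htop | htop
  · simp [htop]
  · have hint : Integrable (fun x => f x - w) μ :=
      MemLp.integrable one_le_two ⟨hg, htop.lt_top⟩
    have hfint : Integrable f μ :=
      (hint.add (integrable_const w)).congr (.of_forall fun x => sub_add_cancel (f x) w)
    have hw : ∫ x, f x ∂μ - w = ∫ x, (f x - w) ∂μ := by
      rw [integral_sub hfint (integrable_const w)]; simp
    rw [hw]
    gcongr
    calc ‖∫ x, (f x - w) ∂μ‖ₑ ≤ ∫⁻ x, ‖f x - w‖ₑ ∂μ := enorm_integral_le_lintegral_enorm _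
      _ = eLpNorm (fun x => f x - w) 1 μ := by rw [eLpNorm_one_eq_lintegral_enorm]
      _ ≤ eLpNorm (fun x => f x - w) 2 μ :=
        eLpNorm_le_eLpNorm_of_exponent_le one_le_two hg

lemma measurable_barW {n : ℕ} (γ : Measure (Eucl n × Eucl n)) [IsFiniteMeasure γ] :
    Measurable (barW γ) := by
  have : StronglyMeasurable fun p : Eucl n × Eucl n => p.2 - p.1 :=
    (measurable_snd.sub measurable_fst).stronglyMeasurable
  exact this.integral_kernel_prod_right'.measurable

lemma lintegral_barW_sub_sq_le {n : ℕ} (γ : Measure (Eucl n × Eucl n)) [IsFiniteMeasure γ]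
    {φ : Eucl n → Eucl n} (hφ : Measurable φ) :
    ∫⁻ x, ‖barW γ x - φ x‖ₑ ^ 2 ∂(γ.map Prod.fst)
      ≤ ∫⁻ p, ‖p.2 - p.1 - φ p.1‖ₑ ^ 2 ∂γ := by
  have hm : Measurable fun p : Eucl n × Eucl n => ‖p.2 - p.1 - φ p.1‖ₑ ^ 2 :=
    ((measurable_snd.sub measurable_fst).sub (hφ.comp measurable_fst)).enorm.pow_const 2
  rw [← Measure.lintegral_condKernel hm]
  exact lintegral_mono fun x => enorm_integral_sub_sq_le _
    (measurable_id.sub_const x).aestronglyMeasurable _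

/-- A compactly supported continuous function has a quadratic modulus of continuity up to an
arbitrarily small error. -/
lemma HasCompactSupport.exists_enorm_sub_sq_le {E F : Type*} [PseudoMetricSpace E]
    [NormedAddCommGroup F] {φ : E → F} (hs : HasCompactSupport φ) (hc : Continuous φ)
    {η : ℝ} (hη : 0 < η) :
    ∃ c : ℝ≥0∞, c ≠ ⊤ ∧ ∀ x y,
      ‖φ y - φ x‖ₑ ^ 2 ≤ ENNReal.ofReal (η ^ 2) + c * ENNReal.ofReal (dist x y ^ 2) := by
  obtain ⟨C, hC⟩ := hs.exists_bound_of_continuous hc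
  obtain ⟨δ, hδ, hφ⟩ := Metric.uniformContinuous_iff.1 (hs.uniformContinuous_of_continuous hc) η hη
  refine ⟨ENNReal.ofReal ((2 * C / δ) ^ 2), ENNReal.ofReal_ne_top, fun x y => ?_⟩
  rw [← ofReal_norm_sq_eq_enorm_sq, ← ENNReal.ofReal_mul (by positivity)]
  rcases lt_or_ge (dist x y) δ with h | h
  · refine le_add_right (ENNReal.ofReal_le_ofReal ?_)
    gcongr
    rw [← dist_eq_norm, dist_comm]
    exact (hφ h).le
  · refine le_add_left (ENNReal.ofReal_le_ofReal ?_)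
    have hC0 : 0 ≤ C := (norm_nonneg _).trans (hC x)
    rw [← mul_pow]
    gcongr
    calc ‖φ y - φ x‖ ≤ ‖φ y‖ + ‖φ x‖ := norm_sub_le _ _
      _ ≤ 2 * C := by linarith [hC x, hC y]
      _ = 2 * C / δ * δ := by field_simp
      _ ≤ 2 * C / δ * dist x y := by gcongr

lemma enorm_add_add_sq_le {E : Type*} [SeminormedAddCommGroup E] (a b c : E) :
    ‖a + b + c‖ₑ ^ 2 ≤ 3 * (‖a‖ₑ ^ 2 + (‖b‖ₑ ^ 2 + ‖c‖ₑ ^ 2)) := by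
  simp only [← ofReal_norm_sq_eq_enorm_sq]
  rw [← ENNReal.ofReal_add (by positivity) (by positivity),
    ← ENNReal.ofReal_add (by positivity) (by positivity), ← ENNReal.ofReal_ofNat 3,
    ← ENNReal.ofReal_mul (by positivity)]
  refine ENNReal.ofReal_le_ofReal ?_
  have h := norm_add₃_le (a := a) (b := b) (c := c)
  have h2 : ‖a + b + c‖ ^ 2 ≤ (‖a‖ + ‖b‖ + ‖c‖) ^ 2 := by gcongr
  nlinarith [sq_nonneg (‖a‖ - ‖b‖), sq_nonneg (‖b‖ - ‖c‖), sq_nonneg (‖a‖ - ‖c‖)]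

/-- Along a narrowly convergent sequence, the integrals of a nonnegative continuous function that
is uniformly bounded almost everywhere converge, to a limit that is at most its integral against
the limit measure. -/
lemma NarrowTendsto.exists_tendsto_lintegral_le {X : Type*} [MeasurableSpace X]
    [TopologicalSpace X] [OpensMeasurableSpace X] {γ : ℕ → Measure X} {γ₀ : Measure X}
    [∀ N, IsFiniteMeasure (γ N)] [IsFiniteMeasure γ₀] (h : NarrowTendsto γ γ₀) {f : X → ℝ}
    (hf : Continuous f) (hf0 : ∀ x, 0 ≤ f x) {B : ℝ} (hB : ∀ N, ∀ᵐ x ∂γ N, f x ≤ B) :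
    ∃ a ≤ ∫⁻ x, ENNReal.ofReal (f x) ∂γ₀,
      Tendsto (fun N => ∫⁻ x, ENNReal.ofReal (f x) ∂γ N) atTop (𝓝 a) := by
  set g : BoundedContinuousFunction X ℝ := BoundedContinuousFunction.ofNormedAddCommGroup
    (fun x => min (f x) |B|) (hf.min continuous_const) |B| (fun x => by
      rw [Real.norm_of_nonneg (le_min (hf0 x) (abs_nonneg B))]
      exact min_le_right _ _) with hg
  have hg0 : ∀ x, 0 ≤ g x := fun x => le_min (hf0 x) (abs_nonneg B)
  have hgi : ∀ (ρ : Measure X) [IsFiniteMeasure ρ],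
      ENNReal.ofReal (∫ x, g x ∂ρ) = ∫⁻ x, ENNReal.ofReal (g x) ∂ρ := fun ρ _ =>
    ofReal_integral_eq_lintegral_ofReal (g.integrable ρ) (.of_forall hg0)
  refine ⟨ENNReal.ofReal (∫ x, g x ∂γ₀), ?_, ?_⟩
  · rw [hgi]
    exact lintegral_mono fun x => ENNReal.ofReal_le_ofReal (min_le_left _ _)
  · refine (ENNReal.tendsto_ofReal (h g)).congr fun N => ?_
    rw [hgi]
    refine lintegral_congr_ae ?_
    filter_upwards [hB N] with x hx
    congr 1
    exact min_eq_left (hx.trans (le_abs_self B))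

/-- strong `L²(μ0)` convergence of the barycentric projections for `W2`
after composition with optimal transport maps `S^N`. -/
theorem w2_barycentric_strong_L2_convergence
    {n : ℕ} (hn : 1 ≤ n) (K : Set (Eucl n)) (hK : IsCompact K)
    (μ0N μ1N : ℕ → Measure (Eucl n))
    [∀ N, IsProbabilityMeasure (μ0N N)] [∀ N, IsProbabilityMeasure (μ1N N)]
    (hμ0NK : ∀ N, μ0N N Kᶜ = 0) (hμ1NK : ∀ N, μ1N N Kᶜ = 0)
    (μ0 μ1 : Measure (Eucl n)) [IsProbabilityMeasure μ0] [IsProbabilityMeasure μ1]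
    (hμ0conv : NarrowTendsto μ0N μ0) (hμ1conv : NarrowTendsto μ1N μ1)
    (hμ0ac : μ0 ≪ (volume : Measure (Eucl n)))
    -- `π^N` are couplings of `(μ0^N, μ1^N)` converging narrowly to `π`
    (π : ℕ → Measure (Eucl n × Eucl n)) [∀ N, IsFiniteMeasure (π N)]
    (hπNmarg : ∀ N, (π N).map Prod.fst = μ0N N ∧ (π N).map Prod.snd = μ1N N)
    -- `π = (id,T)_# μ0` is the unique optimal coupling for `W2²(μ0,μ1)`
    (T : Eucl n → Eucl n) (hT : Measurable T)
    (hTmarg : (μ0.map fun x => (x, T x)).map Prod.snd = μ1)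
    (hTopt : ∫⁻ p, ENNReal.ofReal (dist p.1 p.2 ^ 2) ∂(μ0.map fun x => (x, T x))
      = W2sq μ0 μ1)
    (hTuniq : ∀ γ : Measure (Eucl n × Eucl n), γ.map Prod.fst = μ0 → γ.map Prod.snd = μ1 →
      ∫⁻ p, ENNReal.ofReal (dist p.1 p.2 ^ 2) ∂γ = W2sq μ0 μ1 →
      γ = μ0.map fun x => (x, T x))
    (hπconv : NarrowTendsto π (μ0.map fun x => (x, T x)))
    -- `(id, S^N)_# μ0` is an optimal coupling for `W2²(μ0, μ0^N)`
    (S : ℕ → Eucl n → Eucl n) (hS : ∀ N, Measurable (S N))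
    (hSmarg : ∀ N, μ0.map (S N) = μ0N N)
    (hSopt : ∀ N, ∫⁻ p, ENNReal.ofReal (dist p.1 p.2 ^ 2) ∂(μ0.map fun x => (x, S N x))
      = W2sq μ0 (μ0N N)) :
    Tendsto (fun N => ∫⁻ x, ENNReal.ofReal (‖barW (π N) (S N x) - (T x - x)‖ ^ 2) ∂μ0)
      atTop (𝓝 0) := by
  have hμ0K : μ0 Kᶜ = 0 := hμ0conv.measure_compl_eq_zero hK.isClosed hμ0NK
  have hμ1K : μ1 Kᶜ = 0 := hμ1conv.measure_compl_eq_zero hK.isClosed hμ1NK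
  have hgraph : Measurable fun x => (x, T x) := measurable_id.prodMk hT
  obtain ⟨R, hR⟩ := Metric.isBounded_iff.1 hK.isBounded
  have hRnorm : ∀ x ∈ K, ∀ y ∈ K, ‖y - x‖ ≤ R := fun x hx y hy => by
    rw [← dist_eq_norm]; exact hR hy hx
  have hvmeas : Measurable fun x => T x - x := hT.sub measurable_id
  have hvL2 : MemLp (fun x => T x - x) 2 μ0 := by
    refine MemLp.of_bound hvmeas.aestronglyMeasurable R ?_
    have hT1 : μ0.map T = μ1 := by
      rw [← hTmarg, Measure.map_map measurable_snd hgraph]; rfl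
    have hTK : ∀ᵐ x ∂μ0, T x ∈ K :=
      ae_of_ae_map hT.aemeasurable (p := fun y => y ∈ K) (hT1 ▸ hμ1K)
    have hxK : ∀ᵐ x ∂μ0, x ∈ K := hμ0K
    filter_upwards [hTK, hxK] with x h1 h2
    exact hRnorm x h2 _ h1
  have hW : Tendsto (fun N => ∫⁻ x, ENNReal.ofReal (dist x (S N x) ^ 2) ∂μ0) atTop (𝓝 0) := by
    refine (hμ0conv.tendsto_W2sq hK hμ0NK hμ0ac).congr fun N => ?_
    rw [← hSopt N, lintegral_map (by fun_prop) (measurable_id'.prodMk (hS N))]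
  have key : ∀ η : ℝ, 0 < η → ∀ᶠ N in atTop,
      ∫⁻ x, ENNReal.ofReal (‖barW (π N) (S N x) - (T x - x)‖ ^ 2) ∂μ0
        ≤ 10 * ENNReal.ofReal (η ^ 2) := by
    intro η hη
    obtain ⟨φ, hφs, hφv, hφc, -⟩ := hvL2.exists_hasCompactSupport_eLpNorm_sub_le (by simp)
      (ENNReal.ofReal_pos.2 hη).ne'
    obtain ⟨C, hC⟩ := hφs.exists_bound_of_continuous hφc
    obtain ⟨c, hc, hφmod⟩ := hφs.exists_enorm_sub_sq_le hφc hη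
    have hvφ : ∫⁻ x, ‖T x - x - φ x‖ₑ ^ 2 ∂μ0 ≤ ENNReal.ofReal (η ^ 2) := by
      rw [lintegral_enorm_sq_eq_eLpNorm_sq μ0 fun x => T x - x - φ x,
        ENNReal.ofReal_pow hη.le]
      gcongr
      exact hφv
    obtain ⟨a, ha, hlim⟩ := hπconv.exists_tendsto_lintegral_le
      (f := fun p => ‖p.2 - p.1 - φ p.1‖ ^ 2) (B := (R + C) ^ 2) (by fun_prop)
      (fun _ => by positivity) (fun N => by
        filter_upwards [ae_mem_prod_of_map (hπNmarg N).1 (hπNmarg N).2 (hμ0NK N) (hμ1NK N)]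
          with p hp
        gcongr
        exact (norm_sub_le _ _).trans (add_le_add (hRnorm _ hp.1 _ hp.2) (hC _)))
    replace ha : a ≤ ENNReal.ofReal (η ^ 2) := by
      refine ha.trans ?_
      rw [lintegral_map (by fun_prop) hgraph]
      simpa only [ofReal_norm_sq_eq_enorm_sq] using hvφ
    have hbound : ∀ N, ∫⁻ x, ENNReal.ofReal (‖barW (π N) (S N x) - (T x - x)‖ ^ 2) ∂μ0
        ≤ 3 * (∫⁻ p, ENNReal.ofReal (‖p.2 - p.1 - φ p.1‖ ^ 2) ∂(π N)
          + ((ENNReal.ofReal (η ^ 2)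
            + c * ∫⁻ x, ENNReal.ofReal (dist x (S N x) ^ 2) ∂μ0) + ENNReal.ofReal (η ^ 2))) := by
      intro N
      have hm1 : Measurable fun x => ‖barW (π N) x - φ x‖ₑ ^ 2 :=
        ((measurable_barW (π N)).sub hφc.measurable).enorm.pow_const 2
      have hm1S : Measurable fun x => ‖barW (π N) (S N x) - φ (S N x)‖ₑ ^ 2 := hm1.comp (hS N)
      have hm2 : Measurable fun x => ‖φ (S N x) - φ x‖ₑ ^ 2 :=
        ((hφc.measurable.comp (hS N)).sub hφc.measurable).enorm.pow_const 2
      calc ∫⁻ x, ENNReal.ofReal (‖barW (π N) (S N x) - (T x - x)‖ ^ 2) ∂μ0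
          ≤ ∫⁻ x, 3 * (‖barW (π N) (S N x) - φ (S N x)‖ₑ ^ 2
            + (‖φ (S N x) - φ x‖ₑ ^ 2 + ‖T x - x - φ x‖ₑ ^ 2)) ∂μ0 := by
            refine lintegral_mono fun x => ?_
            have hx : barW (π N) (S N x) - (T x - x)
              = (barW (π N) (S N x) - φ (S N x)) + (φ (S N x) - φ x) + (φ x - (T x - x)) := by
              abel
            rw [ofReal_norm_sq_eq_enorm_sq, hx, enorm_sub_rev (T x - x)]
            exact enorm_add_add_sq_le _ _ _
        _ = 3 * (∫⁻ x, ‖barW (π N) (S N x) - φ (S N x)‖ₑ ^ 2 ∂μ0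
            + (∫⁻ x, ‖φ (S N x) - φ x‖ₑ ^ 2 ∂μ0 + ∫⁻ x, ‖T x - x - φ x‖ₑ ^ 2 ∂μ0)) := by
            rw [lintegral_const_mul' _ _ (by simp), lintegral_add_left hm1S,
              lintegral_add_left hm2]
        _ ≤ _ := by
            gcongr
            · rw [← lintegral_map hm1 (hS N), hSmarg N, ← (hπNmarg N).1]
              simpa only [ofReal_norm_sq_eq_enorm_sq] using
                lintegral_barW_sub_sq_le (π N) hφc.measurable
            · calc ∫⁻ x, ‖φ (S N x) - φ x‖ₑ ^ 2 ∂μ0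
                  ≤ ∫⁻ x, (ENNReal.ofReal (η ^ 2)
                    + c * ENNReal.ofReal (dist x (S N x) ^ 2)) ∂μ0 :=
                    lintegral_mono fun x => hφmod x (S N x)
                _ = _ := by
                    rw [lintegral_add_left measurable_const, lintegral_const_mul' _ _ hc]
                    simp
    have hη2 : (0 : ℝ≥0∞) < ENNReal.ofReal (η ^ 2) := ENNReal.ofReal_pos.2 (by positivity)
    have hfinal : Tendsto (fun N => 3 * (∫⁻ p, ENNReal.ofReal (‖p.2 - p.1 - φ p.1‖ ^ 2) ∂(π N)
          + ((ENNReal.ofReal (η ^ 2)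
            + c * ∫⁻ x, ENNReal.ofReal (dist x (S N x) ^ 2) ∂μ0) + ENNReal.ofReal (η ^ 2)))) atTop
        (𝓝 (3 * (a + ((ENNReal.ofReal (η ^ 2) + c * 0) + ENNReal.ofReal (η ^ 2))))) :=
      ENNReal.Tendsto.const_mul (hlim.add ((tendsto_const_nhds.add
        (ENNReal.Tendsto.const_mul hW (.inr hc))).add tendsto_const_nhds)) (.inr (by simp))
    have hlt : 3 * (a + ((ENNReal.ofReal (η ^ 2) + c * 0) + ENNReal.ofReal (η ^ 2)))
        < 10 * ENNReal.ofReal (η ^ 2) := by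
      calc _ ≤ 3 * (ENNReal.ofReal (η ^ 2) + ((ENNReal.ofReal (η ^ 2) + c * 0)
            + ENNReal.ofReal (η ^ 2))) := by gcongr
        _ = 9 * ENNReal.ofReal (η ^ 2) := by ring
        _ < 10 * ENNReal.ofReal (η ^ 2) :=
          ENNReal.mul_lt_mul_left hη2.ne' ENNReal.ofReal_ne_top (by norm_num)
    filter_upwards [hfinal.eventually_lt_const hlt] with N hN
    exact (hbound N).trans hN.le
  refine ENNReal.tendsto_nhds_zero.2 fun ε hε => ?_
  have hsmall : Tendsto (fun η : ℝ => 10 * ENNReal.ofReal (η ^ 2)) (𝓝[>] 0) (𝓝 0) := by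
    simpa using ENNReal.Tendsto.const_mul tendsto_ofReal_sq_nhdsGT_zero
      (.inr (by simp : (10 : ℝ≥0∞) ≠ ⊤))
  obtain ⟨η, hη1, hη2⟩ := ((hsmall.eventually_lt_const hε).and self_mem_nhdsWithin).exists
  filter_upwards [key η hη2] with N hN
  exact hN.trans hη1.le
end

section
/- Let n ≥ 1, κ > 0, K ⊂ ℝ^n compact, and let (μ0^N), (μ1^N) be sequences of finite nonnegative Borel measures supported in K converging narrowly to μ0 and μ1 respectively, where μ0 is absolutely continuous with respect to Lebesgue measure. For each N let π^N be a minimizer of E_κ(·|μ0^N,μ1^N), and let π be the (unique) minimizer of E_κ(·|μ0,μ1). Then the measures (1/cos(|x−y|/κ))·π^N and (1/cos(|x−y|/κ))·π are finite, and (1/cos(|x−y|/κ))·π^N converges narrowly to (1/cos(|x−y|/κ))·π as N → ∞. -/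
open MeasureTheory ENNReal Filter Topology RealInnerProductSpace
open scoped Classical

namespace HKNarrow

open InformationTheory

section KL

variable {α : Type*} [MeasurableSpace α]

/-- Tangent-line bound for `klFun`, in the form used for perturbations of a density. -/
lemma klFun_le_add {s s' u : ℝ} (hs : 0 ≤ s) (hs' : 0 ≤ s')
    (h1 : s < s' → s' ≤ Real.exp u) (h2 : s' < s → Real.exp u ≤ s') :
    klFun s' ≤ klFun s + (s' - s) * u := by
  rcases eq_or_lt_of_le hs' with h0 | hpos
  · rcases eq_or_lt_of_le hs with h0' | h0'
    · simp [← h0, ← h0']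
    · have := h2 (by linarith)
      linarith [Real.exp_pos u]
  have key : klFun s' ≤ klFun s + (s' - s) * Real.log s' := by
    rcases eq_or_lt_of_le hs with h0 | h0
    · simp only [klFun, ← h0]; ring_nf; linarith
    · have := Real.log_le_sub_one_of_pos (div_pos hpos h0)
      rw [Real.log_div hpos.ne' h0.ne'] at this
      have h3 := mul_le_mul_of_nonneg_left this h0.le
      have h4 : s * (s' / s - 1) = s' - s := by field_simp
      rw [h4] at h3
      simp only [klFun]; nlinarith
  refine key.trans ?_
  rcases lt_trichotomy s s' with h | h | h
  · have := (Real.log_le_iff_le_exp hpos).2 (h1 h)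
    nlinarith
  · simp [h]
  · have := (Real.le_log_iff_exp_le hpos).2 (h2 h)
    nlinarith

lemma integrable_klFun_of_klDiv_ne_top {ρ μ : Measure α} [IsFiniteMeasure ρ] [IsFiniteMeasure μ]
    (h : klDiv ρ μ ≠ ⊤) : Integrable (fun x => klFun (ρ.rnDeriv μ x).toReal) μ := by
  rw [klDiv_ne_top_iff] at h
  exact (integrable_klFun_rnDeriv_iff h.1).2 h.2

/-- Adding or removing mass changes the divergence at most to first order. -/
lemma klDiv_le_add_integral {ρ ρ' μ : Measure α} [IsFiniteMeasure ρ] [IsFiniteMeasure ρ']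
    [IsFiniteMeasure μ] (hρ' : ρ' ≪ μ) (h : klDiv ρ μ ≠ ⊤) {w : α → ℝ} (hw : Integrable w μ)
    (hle : ∀ᵐ x ∂μ, klFun (ρ'.rnDeriv μ x).toReal ≤ klFun (ρ.rnDeriv μ x).toReal + w x) :
    klDiv ρ' μ ≠ ⊤ ∧ (klDiv ρ' μ).toReal ≤ (klDiv ρ μ).toReal + ∫ x, w x ∂μ := by
  have hi := integrable_klFun_of_klDiv_ne_top h
  have hac := (klDiv_ne_top_iff.1 h).1
  have hi' : Integrable (fun x => klFun (ρ'.rnDeriv μ x).toReal) μ := by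
    refine (hi.add hw).mono' (by
      exact (measurable_klFun.comp (Measure.measurable_rnDeriv _ _).ennreal_toReal).aestronglyMeasurable) ?_
    filter_upwards [hle] with x hx
    rw [Real.norm_of_nonneg (klFun_nonneg toReal_nonneg)]
    exact hx
  refine ⟨klDiv_ne_top_iff.2 ⟨hρ', (integrable_klFun_rnDeriv_iff hρ').1 hi'⟩, ?_⟩
  rw [toReal_klDiv_eq_integral_klFun hρ', toReal_klDiv_eq_integral_klFun hac,
    ← integral_add hi hw]
  exact integral_mono_ae hi' (hi.add hw) hle

lemma ae_of_ae_rnDeriv {η μ : Measure α} [IsFiniteMeasure η] [IsFiniteMeasure μ] (hη : η ≪ μ)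
    {P : α → Prop} (h : ∀ᵐ x ∂η, P x) : ∀ᵐ x ∂μ, η.rnDeriv μ x ≠ 0 → P x := by
  rw [← Measure.withDensity_rnDeriv_eq η μ hη] at h
  exact (ae_withDensity_iff (Measure.measurable_rnDeriv _ _)).1 h

lemma toReal_rnDeriv_add {ρ η μ : Measure α} [IsFiniteMeasure ρ] [IsFiniteMeasure η]
    [IsFiniteMeasure μ] : ∀ᵐ x ∂μ, ((ρ + η).rnDeriv μ x).toReal =
      (ρ.rnDeriv μ x).toReal + (η.rnDeriv μ x).toReal := by
  filter_upwards [Measure.rnDeriv_add ρ η μ, Measure.rnDeriv_lt_top ρ μ,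
    Measure.rnDeriv_lt_top η μ] with x h1 h2 h3
  rw [h1, Pi.add_apply, ENNReal.toReal_add h2.ne h3.ne]

lemma klDiv_add_le {ρ η μ : Measure α} [IsFiniteMeasure ρ] [IsFiniteMeasure η]
    [IsFiniteMeasure μ] (hη : η ≪ μ) (h : klDiv ρ μ ≠ ⊤) {u : α → ℝ} (hu : Integrable u η)
    (hle : ∀ᵐ x ∂η, ((ρ + η).rnDeriv μ x).toReal ≤ Real.exp (u x)) :
    klDiv (ρ + η) μ ≠ ⊤ ∧ (klDiv (ρ + η) μ).toReal ≤ (klDiv ρ μ).toReal + ∫ x, u x ∂η := by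
  have hac := (klDiv_ne_top_iff.1 h).1
  rw [← integral_rnDeriv_smul hη]
  refine klDiv_le_add_integral (hac.add_left hη) h
    ((integrable_rnDeriv_smul_iff hη).2 hu) ?_
  filter_upwards [ae_of_ae_rnDeriv hη hle, toReal_rnDeriv_add (ρ := ρ) (η := η) (μ := μ)]
    with x hx hadd
  have := klFun_le_add (s := (ρ.rnDeriv μ x).toReal) (s' := ((ρ + η).rnDeriv μ x).toReal)
    (u := u x) toReal_nonneg toReal_nonneg (fun hlt => hx ?_) (fun hlt => ?_)
  · refine this.trans (le_of_eq ?_)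
    rw [hadd]; simp
  · intro h0; rw [hadd, h0] at hlt; simp at hlt
  · have : 0 ≤ (η.rnDeriv μ x).toReal := toReal_nonneg
    linarith

lemma klDiv_le_sub {ρ η μ : Measure α} [IsFiniteMeasure ρ] [IsFiniteMeasure η]
    [IsFiniteMeasure μ] (h : klDiv (ρ + η) μ ≠ ⊤) {u : α → ℝ} (hu : Integrable u η)
    (hle : ∀ᵐ x ∂η, Real.exp (u x) ≤ (ρ.rnDeriv μ x).toReal) :
    klDiv ρ μ ≠ ⊤ ∧ (klDiv ρ μ).toReal ≤ (klDiv (ρ + η) μ).toReal - ∫ x, u x ∂η := by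
  have hac := (klDiv_ne_top_iff.1 h).1
  have hη : η ≪ μ := (Measure.AbsolutelyContinuous.add_left_iff.1 hac).2
  have hρ : ρ ≪ μ := (Measure.AbsolutelyContinuous.add_left_iff.1 hac).1
  rw [← integral_rnDeriv_smul hη, sub_eq_add_neg, ← integral_neg]
  refine klDiv_le_add_integral hρ h
    ((integrable_rnDeriv_smul_iff hη).2 hu).neg ?_
  filter_upwards [ae_of_ae_rnDeriv hη hle, toReal_rnDeriv_add (ρ := ρ) (η := η) (μ := μ)]
    with x hx hadd
  have := klFun_le_add (s := ((ρ + η).rnDeriv μ x).toReal) (s' := (ρ.rnDeriv μ x).toReal)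
    (u := u x) toReal_nonneg toReal_nonneg (fun hlt => ?_) (fun hlt => hx ?_)
  · refine this.trans (le_of_eq ?_)
    rw [hadd]; simp
  · have : 0 ≤ (η.rnDeriv μ x).toReal := toReal_nonneg
    linarith
  · intro h0; rw [hadd, h0] at hlt; simp at hlt

/-- Gibbs variational inequality. -/
lemma integral_sub_le_klDiv {ρ μ : Measure α} [IsFiniteMeasure ρ] [IsFiniteMeasure μ]
    (h : klDiv ρ μ ≠ ⊤) {φ : α → ℝ} (hφ : Measurable φ) {B : ℝ} (hB : ∀ x, |φ x| ≤ B) :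
    ∫ x, φ x ∂ρ - ∫ x, (Real.exp (φ x) - 1) ∂μ ≤ (klDiv ρ μ).toReal := by
  have hac := (klDiv_ne_top_iff.1 h).1
  have hi := integrable_klFun_of_klDiv_ne_top h
  have h1 : Integrable φ ρ := Integrable.of_bound hφ.aestronglyMeasurable B
    (ae_of_all _ fun x => by simpa using hB x)
  have h2 : Integrable (fun x => Real.exp (φ x) - 1) μ :=
    (Integrable.of_bound (by fun_prop) (Real.exp B) (ae_of_all _ fun x => by
      rw [Real.norm_of_nonneg (Real.exp_pos _).le]
      exact Real.exp_le_exp.2 ((le_abs_self _).trans (hB x)))).sub (integrable_const _)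
  rw [toReal_klDiv_eq_integral_klFun hac, ← integral_rnDeriv_smul hac, ← integral_sub
    ((integrable_rnDeriv_smul_iff hac).2 h1) h2]
  refine integral_mono (((integrable_rnDeriv_smul_iff hac).2 h1).sub h2) hi fun x => ?_
  have := klFun_le_add (s := (ρ.rnDeriv μ x).toReal) (s' := Real.exp (φ x)) (u := φ x)
    toReal_nonneg (Real.exp_pos _).le (fun _ => le_rfl) (fun _ => le_rfl)
  simp only [smul_eq_mul]
  have e : klFun (Real.exp (φ x)) = Real.exp (φ x) * φ x + 1 - Real.exp (φ x) := by
    simp [klFun]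
  rw [e] at this
  linarith

end KL

section DonskerVaradhan

/-- Truncation of `φ` to `[-k, k]`. -/
noncomputable def clip (k t : ℝ) : ℝ := max (-k) (min k t)

lemma continuous_clip (k : ℝ) : Continuous (clip k) := by unfold clip; fun_prop

lemma abs_clip_le {k : ℝ} (hk : 0 ≤ k) (t : ℝ) : |clip k t| ≤ k := by
  unfold clip
  rw [abs_le]
  exact ⟨le_max_left _ _, max_le (by linarith) (min_le_left _ _)⟩

lemma clip_of_abs_le {k t : ℝ} (h : |t| ≤ k) : clip k t = t := by
  rw [abs_le] at h
  unfold clip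
  rw [min_eq_right h.2, max_eq_right h.1]

lemma abs_clip_sub_clip_le (k s t : ℝ) : |clip k s - clip k t| ≤ |s - t| := by
  unfold clip
  exact (abs_max_sub_max_le_max _ _ _ _).trans (by
    simpa using abs_min_sub_min_le_max k s k t)

lemma abs_exp_sub_exp_le {k s t : ℝ} (hs : s ≤ k) (ht : t ≤ k) :
    |Real.exp s - Real.exp t| ≤ Real.exp k * |s - t| := by
  wlog h : t ≤ s generalizing s t
  · rw [abs_sub_comm, abs_sub_comm s]
    exact this ht hs (le_of_not_ge h)
  rw [abs_of_nonneg (by linarith [Real.exp_le_exp.2 h]), abs_of_nonneg (by linarith)]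
  have h1 : Real.exp t ≥ Real.exp s * (1 + (t - s)) := by
    have := Real.add_one_le_exp (t - s)
    have e : Real.exp t = Real.exp s * Real.exp (t - s) := by rw [← Real.exp_add]; ring_nf
    rw [e]; exact mul_le_mul_of_nonneg_left (by linarith) (Real.exp_pos _).le
  have h2 := Real.exp_le_exp.2 hs
  nlinarith

variable {α : Type*} [TopologicalSpace α] [MeasurableSpace α]

/-- The variational inequality extends from continuous to measurable test functions. -/
lemma gibbs_measurable_of_continuous [T4Space α] [BorelSpace α] {ρ μ : Measure α}
    [IsFiniteMeasure ρ] [IsFiniteMeasure μ] [(ρ + μ).WeaklyRegular] {B : ℝ}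
    (h : ∀ φ : BoundedContinuousFunction α ℝ,
      ∫ x, φ x ∂ρ - ∫ x, (Real.exp (φ x) - 1) ∂μ ≤ B)
    {f : α → ℝ} (hf : Measurable f) {k : ℝ} (hk : 0 ≤ k) (hfk : ∀ x, |f x| ≤ k) :
    ∫ x, f x ∂ρ - ∫ x, (Real.exp (f x) - 1) ∂μ ≤ B := by
  have hfi : Integrable f (ρ + μ) := Integrable.of_bound hf.aestronglyMeasurable k
    (ae_of_all _ fun x => by simpa using hfk x)
  refine le_of_forall_pos_le_add fun ε hε => ?_
  set δ := ε / (1 + Real.exp k) with hδ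
  have hek := Real.exp_pos k
  have hδ0 : 0 < δ := by positivity
  obtain ⟨g, hg, hgi⟩ := hfi.exists_boundedContinuous_integral_sub_le hδ0
  set φ : BoundedContinuousFunction α ℝ := BoundedContinuousFunction.ofNormedAddCommGroup
    (fun x => clip k (g x)) ((continuous_clip k).comp g.continuous) k
    (fun x => abs_clip_le hk _) with hφ
  have hφx : ∀ x, φ x = clip k (g x) := fun x => rfl
  have hle : ∀ x, |f x - φ x| ≤ ‖f x - g x‖ := fun x => by
    rw [hφx, ← clip_of_abs_le (hfk x), Real.norm_eq_abs, clip_of_abs_le (hfk x)]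
    conv_lhs => rw [← clip_of_abs_le (hfk x)]
    exact abs_clip_sub_clip_le _ _ _
  have hd : Integrable (fun x => ‖f x - g x‖) (ρ + μ) := (hfi.sub hgi).norm
  rw [integrable_add_measure] at hd hfi
  have hs : ∫ x, ‖f x - g x‖ ∂ρ + ∫ x, ‖f x - g x‖ ∂μ ≤ δ := by
    rw [← integral_add_measure hd.1 hd.2]; exact hg
  have hρ0 : 0 ≤ ∫ x, ‖f x - g x‖ ∂ρ := integral_nonneg fun _ => norm_nonneg _
  have hμ0 : 0 ≤ ∫ x, ‖f x - g x‖ ∂μ := integral_nonneg fun _ => norm_nonneg _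
  have hφi : ∀ ν : Measure α, IsFiniteMeasure ν → Integrable (fun x => φ x) ν :=
    fun ν _ => φ.integrable ν
  have e1 : ∫ x, f x ∂ρ ≤ ∫ x, φ x ∂ρ + ∫ x, ‖f x - g x‖ ∂ρ := by
    rw [← integral_add (hφi ρ inferInstance) hd.1]
    refine integral_mono hfi.1 ((hφi ρ inferInstance).add hd.1) fun x => ?_
    have := (abs_le.1 (hle x)).2
    linarith
  have hexp : ∀ u : α → ℝ, Measurable u → (∀ x, |u x| ≤ k) →
      Integrable (fun x => Real.exp (u x) - 1) μ := fun u hu huk =>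
    (Integrable.of_bound (by fun_prop) (Real.exp k) (ae_of_all _ fun x => by
      rw [Real.norm_of_nonneg (Real.exp_pos _).le]
      exact Real.exp_le_exp.2 ((le_abs_self _).trans (huk x)))).sub (integrable_const _)
  have hφk : ∀ x, |φ x| ≤ k := fun x => abs_clip_le hk _
  have e2 : ∫ x, (Real.exp (φ x) - 1) ∂μ ≤
      ∫ x, (Real.exp (f x) - 1) ∂μ + Real.exp k * ∫ x, ‖f x - g x‖ ∂μ := by
    rw [← integral_const_mul, ← integral_add (hexp f hf hfk) (hd.2.const_mul _)]
    refine integral_mono (hexp _ φ.continuous.measurable hφk)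
      ((hexp f hf hfk).add (hd.2.const_mul _)) fun x => ?_
    have h1 := abs_exp_sub_exp_le ((le_abs_self _).trans (hφk x)) ((le_abs_self _).trans (hfk x))
    have h2 := (le_abs_self _).trans h1
    rw [abs_sub_comm] at h2
    have h3 := mul_le_mul_of_nonneg_left (hle x) hek.le
    linarith
  have h3 := h φ
  have e3 : δ * (1 + Real.exp k) = ε := by rw [hδ]; field_simp
  nlinarith

/-- The divergence is bounded by any bound on the variational functional. -/
lemma klDiv_le_of_gibbs [T4Space α] [BorelSpace α] {ρ μ : Measure α}
    [IsFiniteMeasure ρ] [IsFiniteMeasure μ] [(ρ + μ).WeaklyRegular] (hac : ρ ≪ μ) {B : ℝ}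
    (h : ∀ φ : BoundedContinuousFunction α ℝ,
      ∫ x, φ x ∂ρ - ∫ x, (Real.exp (φ x) - 1) ∂μ ≤ B) :
    klDiv ρ μ ≠ ⊤ ∧ (klDiv ρ μ).toReal ≤ B := by
  have hB : 0 ≤ B := by simpa using h 0
  suffices H : klDiv ρ μ ≤ ENNReal.ofReal B from
    ⟨ne_top_of_le_ne_top ofReal_ne_top H, ENNReal.toReal_le_of_le_ofReal hB H⟩
  set s : α → ℝ := fun x => (ρ.rnDeriv μ x).toReal with hs
  have hsm : Measurable s := (Measure.measurable_rnDeriv _ _).ennreal_toReal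
  set u : ℕ → α → ℝ := fun k x => clip k (Real.log (max (s x) (Real.exp (-k)))) with hu
  have hum : ∀ k, Measurable (u k) := fun k =>
    (continuous_clip k).measurable.comp (by fun_prop)
  have huk : ∀ k x, |u k x| ≤ k := fun k x => abs_clip_le (Nat.cast_nonneg k) _
  set w : ℕ → α → ℝ := fun k x => s x * u k x - (Real.exp (u k x) - 1) with hw
  have hw0 : ∀ k x, 0 ≤ w k x := by
    intro k x
    have hs0 : 0 ≤ s x := toReal_nonneg
    have h1 : Real.exp (u k x) - 1 ≤ Real.exp (u k x) * u k x := by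
      have := Real.add_one_le_exp (-(u k x))
      rw [Real.exp_neg] at this
      have hp := Real.exp_pos (u k x)
      have h2 := mul_le_mul_of_nonneg_left this hp.le
      rw [mul_inv_cancel₀ hp.ne'] at h2
      linarith
    have h2 : 0 ≤ (s x - Real.exp (u k x)) * u k x := by
      set L := Real.log (max (s x) (Real.exp (-k))) with hL
      have hk : (0 : ℝ) ≤ k := Nat.cast_nonneg k
      have hmp : 0 < max (s x) (Real.exp (-k)) := lt_max_of_lt_right (Real.exp_pos _)
      have hLk : -(k : ℝ) ≤ L := (Real.le_log_iff_exp_le hmp).2 (le_max_right _ _)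
      have hue : u k x = min (k : ℝ) L := by
        simp only [hu, clip]
        exact max_eq_right (le_min (by linarith) hLk)
      rcases le_or_gt 0 (u k x) with h0 | h0
      · have h3 : Real.exp (u k x) ≤ max (s x) (Real.exp (-k)) := by
          rw [hue, ← Real.exp_log hmp]; exact Real.exp_le_exp.2 (min_le_right _ _)
        rcases le_max_iff.1 h3 with h4 | h4
        · exact mul_nonneg (by linarith) h0
        · have h5 := Real.exp_le_exp.1 h4
          have h7 : u k x = 0 := by linarith
          simp [h7]
      · refine mul_nonneg_of_nonpos_of_nonpos ?_ h0.le
        have h3 : u k x = L := by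
          rw [hue] at h0 ⊢
          rcases min_choice (k : ℝ) L with h | h
          · rw [h] at h0; linarith
          · exact h
        rw [h3, Real.exp_log hmp]
        linarith [le_max_left (s x) (Real.exp (-k))]
    simp only [hw]; linarith
  have hwB : ∀ k, ∫⁻ x, ENNReal.ofReal (w k x) ∂μ ≤ ENNReal.ofReal B := by
    intro k
    have hk : (0 : ℝ) ≤ k := Nat.cast_nonneg k
    have hi1 : Integrable (u k) ρ := Integrable.of_bound (hum k).aestronglyMeasurable k
      (ae_of_all _ fun x => by simpa using huk k x)
    have hi2 : Integrable (fun x => Real.exp (u k x) - 1) μ :=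
      (Integrable.of_bound (by have := hum k; fun_prop) (Real.exp k) (ae_of_all _ fun x => by
        rw [Real.norm_of_nonneg (Real.exp_pos _).le]
        exact Real.exp_le_exp.2 ((le_abs_self _).trans (huk k x)))).sub (integrable_const _)
    have hi3 := (integrable_rnDeriv_smul_iff hac).2 hi1
    have hwi : Integrable (w k) μ := hi3.sub hi2
    rw [← ofReal_integral_eq_lintegral_ofReal hwi (ae_of_all _ (hw0 k))]
    refine ENNReal.ofReal_le_ofReal ?_
    have := gibbs_measurable_of_continuous h (hum k) hk (huk k)
    rw [← integral_rnDeriv_smul hac, ← integral_sub hi3 hi2] at this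
    exact this
  rw [klDiv_eq_lintegral_klFun_of_ac hac]
  have hlim : ∀ x, Tendsto (fun k => w k x) atTop (𝓝 (klFun (s x))) := by
    intro x
    have hs0 : 0 ≤ s x := toReal_nonneg
    rcases eq_or_lt_of_le hs0 with h0 | h0
    · have e : ∀ k : ℕ, w k x = 1 - Real.exp (-k) := by
        intro k
        have hk : (0 : ℝ) ≤ k := Nat.cast_nonneg k
        have : u k x = -k := by
          simp only [hu, ← h0]
          rw [max_eq_right (Real.exp_pos _).le, Real.log_exp, clip_of_abs_le]
          rw [abs_neg, abs_of_nonneg hk]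
        simp only [hw, this, ← h0]; ring
      simp_rw [e]
      rw [← h0, klFun_zero]
      have : Tendsto (fun k : ℕ => Real.exp (-(k : ℝ))) atTop (𝓝 0) :=
        Real.tendsto_exp_neg_atTop_nhds_zero.comp tendsto_natCast_atTop_atTop
      simpa using tendsto_const_nhds.sub this
    · refine tendsto_const_nhds.congr' ?_
      obtain ⟨k0, hk0⟩ := exists_nat_ge |Real.log (s x)|
      filter_upwards [eventually_ge_atTop k0] with k hk
      have hkk : |Real.log (s x)| ≤ k := hk0.trans (by exact_mod_cast hk)
      have : u k x = Real.log (s x) := by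
        simp only [hu]
        rw [max_eq_left, clip_of_abs_le hkk]
        conv_rhs => rw [← Real.exp_log h0]
        exact Real.exp_le_exp.2 (by linarith [(abs_le.1 hkk).1])
      simp only [hw, this, klFun, Real.exp_log h0]; ring
  calc ∫⁻ x, ENNReal.ofReal (klFun (s x)) ∂μ
      = ∫⁻ x, liminf (fun k => ENNReal.ofReal (w k x)) atTop ∂μ := by
        refine lintegral_congr fun x => ?_
        exact ((ENNReal.continuous_ofReal.tendsto _).comp (hlim x)).liminf_eq.symm
    _ ≤ liminf (fun k => ∫⁻ x, ENNReal.ofReal (w k x) ∂μ) atTop :=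
        lintegral_liminf_le fun k => by
          have := hum k
          exact ENNReal.measurable_ofReal.comp (by simp only [hw]; fun_prop)
    _ ≤ ENNReal.ofReal B := by
        refine liminf_le_of_le (by isBoundedDefault) fun b hb => ?_
        obtain ⟨k, hk⟩ := hb.exists
        exact hk.trans (hwB k)

end DonskerVaradhan

section Optimality

variable {X : Type*} [MeasurableSpace X] {C : X × X → ℝ} {π η : Measure (X × X)}
  {μ₀ μ₁ : Measure X}

/-- Plans with finite energy, for the cost `-2 log C` (infinite where `C` vanishes). -/
structure Adm (C : X × X → ℝ) (π : Measure (X × X)) (μ₀ μ₁ : Measure X) : Prop where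
  pos : ∀ᵐ p ∂π, 0 < C p
  int : Integrable (fun p => Real.log (C p)) π
  kl₀ : klDiv π.fst μ₀ ≠ ⊤
  kl₁ : klDiv π.snd μ₁ ≠ ⊤

/-- The real-valued energy of an admissible plan, normalised so that the scale is `1`. -/
noncomputable def energy (C : X × X → ℝ) (π : Measure (X × X)) (μ₀ μ₁ : Measure X) : ℝ :=
  -2 * ∫ p, Real.log (C p) ∂π + (klDiv π.fst μ₀).toReal + (klDiv π.snd μ₁).toReal

/-- Optimal plans. -/
structure IsOpt (C : X × X → ℝ) (π : Measure (X × X)) (μ₀ μ₁ : Measure X) : Prop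
    extends Adm C π μ₀ μ₁ where
  minimal : ∀ π' : Measure (X × X), IsFiniteMeasure π' → Adm C π' μ₀ μ₁ →
    energy C π μ₀ μ₁ ≤ energy C π' μ₀ μ₁

/-- The real-valued density of `ρ` with respect to `μ`. -/
noncomputable def dens (ρ μ : Measure X) (x : X) : ℝ := (ρ.rnDeriv μ x).toReal

lemma measurable_dens (ρ μ : Measure X) : Measurable (dens ρ μ) :=
  (Measure.measurable_rnDeriv _ _).ennreal_toReal

lemma dens_nonneg (ρ μ : Measure X) (x : X) : 0 ≤ dens ρ μ x := toReal_nonneg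

lemma Adm.ac₀ (h : Adm C π μ₀ μ₁) : π.fst ≪ μ₀ := (klDiv_ne_top_iff.1 h.kl₀).1

lemma Adm.ac₁ (h : Adm C π μ₀ μ₁) : π.snd ≪ μ₁ := (klDiv_ne_top_iff.1 h.kl₁).1

lemma fst_add (π η : Measure (X × X)) : (π + η).fst = π.fst + η.fst :=
  Measure.map_add _ _ measurable_fst

lemma snd_add (π η : Measure (X × X)) : (π + η).snd = π.snd + η.snd :=
  Measure.map_add _ _ measurable_snd

lemma ae_fst_iff {P : X → Prop} (hP : MeasurableSet {x | P x}) :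
    (∀ᵐ x ∂π.fst, P x) ↔ ∀ᵐ p ∂π, P p.1 :=
  ae_map_iff measurable_fst.aemeasurable hP

lemma ae_snd_iff {P : X → Prop} (hP : MeasurableSet {x | P x}) :
    (∀ᵐ x ∂π.snd, P x) ↔ ∀ᵐ p ∂π, P p.2 :=
  ae_map_iff measurable_snd.aemeasurable hP

lemma ae_of_ae_fst {P : X → Prop} (h : ∀ᵐ x ∂π.fst, P x) : ∀ᵐ p ∂π, P p.1 :=
  ae_of_ae_map measurable_fst.aemeasurable h

lemma ae_of_ae_snd {P : X → Prop} (h : ∀ᵐ x ∂π.snd, P x) : ∀ᵐ p ∂π, P p.2 :=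
  ae_of_ae_map measurable_snd.aemeasurable h

lemma integral_fst {f : X → ℝ} (hf : Measurable f) : ∫ x, f x ∂π.fst = ∫ p, f p.1 ∂π :=
  integral_map measurable_fst.aemeasurable hf.aestronglyMeasurable

lemma integral_snd {f : X → ℝ} (hf : Measurable f) : ∫ x, f x ∂π.snd = ∫ p, f p.2 ∂π :=
  integral_map measurable_snd.aemeasurable hf.aestronglyMeasurable

lemma integrable_fst {f : X → ℝ} (hf : Measurable f) :
    Integrable f π.fst ↔ Integrable (fun p => f p.1) π :=
  integrable_map_measure hf.aestronglyMeasurable measurable_fst.aemeasurable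

lemma integrable_snd {f : X → ℝ} (hf : Measurable f) :
    Integrable f π.snd ↔ Integrable (fun p => f p.2) π :=
  integrable_map_measure hf.aestronglyMeasurable measurable_snd.aemeasurable

variable [IsFiniteMeasure π] [IsFiniteMeasure η] [IsFiniteMeasure μ₀] [IsFiniteMeasure μ₁]

/-- First-order condition for adding mass to an optimal plan. -/
lemma IsOpt.variation_add (h : IsOpt C π μ₀ μ₁) (hpos : ∀ᵐ p ∂η, 0 < C p)
    (hlogC : Integrable (fun p => Real.log (C p)) η) (h0 : η.fst ≪ μ₀) (h1 : η.snd ≪ μ₁)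
    {u₀ u₁ : X → ℝ} (hm0 : Measurable u₀) (hm1 : Measurable u₁)
    (hu0 : Integrable (fun p => u₀ p.1) η) (hu1 : Integrable (fun p => u₁ p.2) η)
    (hle0 : ∀ᵐ x ∂η.fst, dens (π.fst + η.fst) μ₀ x ≤ Real.exp (u₀ x))
    (hle1 : ∀ᵐ x ∂η.snd, dens (π.snd + η.snd) μ₁ x ≤ Real.exp (u₁ x)) :
    0 ≤ ∫ p, (-2 * Real.log (C p) + u₀ p.1 + u₁ p.2) ∂η := by
  obtain ⟨a0, b0⟩ := klDiv_add_le h0 h.kl₀ ((integrable_fst hm0).2 hu0) hle0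
  obtain ⟨a1, b1⟩ := klDiv_add_le h1 h.kl₁ ((integrable_snd hm1).2 hu1) hle1
  have hadm : Adm C (π + η) μ₀ μ₁ :=
    ⟨ae_add_measure_iff.2 ⟨h.pos, hpos⟩, h.int.add_measure hlogC, by rwa [fst_add],
      by rwa [snd_add]⟩
  have := h.minimal (π + η) inferInstance hadm
  unfold energy at this
  rw [integral_add_measure h.int hlogC, fst_add, snd_add] at this
  rw [integral_fst hm0] at b0
  rw [integral_snd hm1] at b1
  have hA : Integrable (fun p => -2 * Real.log (C p) + u₀ p.1) η := (hlogC.const_mul _).add hu0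
  rw [integral_add hA hu1, integral_add (hlogC.const_mul _) hu0, integral_const_mul]
  linarith

/-- First-order condition for removing mass from an optimal plan. -/
lemma IsOpt.variation_sub (h : IsOpt C (π + η) μ₀ μ₁)
    {u₀ u₁ : X → ℝ} (hm0 : Measurable u₀) (hm1 : Measurable u₁)
    (hu0 : Integrable (fun p => u₀ p.1) η) (hu1 : Integrable (fun p => u₁ p.2) η)
    (hle0 : ∀ᵐ x ∂η.fst, Real.exp (u₀ x) ≤ dens π.fst μ₀ x)
    (hle1 : ∀ᵐ x ∂η.snd, Real.exp (u₁ x) ≤ dens π.snd μ₁ x) :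
    ∫ p, (-2 * Real.log (C p) + u₀ p.1 + u₁ p.2) ∂η ≤ 0 := by
  have hk0 := h.kl₀
  have hk1 := h.kl₁
  rw [fst_add] at hk0
  rw [snd_add] at hk1
  obtain ⟨a0, b0⟩ := klDiv_le_sub hk0 ((integrable_fst hm0).2 hu0) hle0
  obtain ⟨a1, b1⟩ := klDiv_le_sub hk1 ((integrable_snd hm1).2 hu1) hle1
  have hi := integrable_add_measure.1 h.int
  have hadm : Adm C π μ₀ μ₁ := ⟨(ae_add_measure_iff.1 h.pos).1, hi.1, a0, a1⟩
  have := h.minimal π inferInstance hadm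
  unfold energy at this
  rw [integral_add_measure hi.1 hi.2, fst_add, snd_add] at this
  rw [integral_fst hm0] at b0
  rw [integral_snd hm1] at b1
  have hA : Integrable (fun p => -2 * Real.log (C p) + u₀ p.1) η := (hi.2.const_mul _).add hu0
  rw [integral_add hA hu1, integral_add (hi.2.const_mul _) hu0, integral_const_mul]
  linarith

end Optimality

section Conditions

variable {X : Type*} [MeasurableSpace X] {C : X × X → ℝ} {π : Measure (X × X)}
  {μ₀ μ₁ : Measure X}

lemma abs_log_le {a b x : ℝ} (ha : 0 < a) (hx : a ≤ x) (hb : x ≤ b) :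
    |Real.log x| ≤ |Real.log a| + |Real.log b| := by
  have h1 := Real.log_le_log ha hx
  have h2 := Real.log_le_log (ha.trans_le hx) hb
  rw [abs_le]
  constructor
  · linarith [neg_abs_le (Real.log a), abs_nonneg (Real.log b)]
  · linarith [le_abs_self (Real.log b), abs_nonneg (Real.log a)]

lemma measure_eq_zero_of_integral_nonpos {α : Type*} [MeasurableSpace α] {η : Measure α}
    {f : α → ℝ} (hf : Integrable f η) (hpos : ∀ᵐ x ∂η, 0 < f x) (hle : ∫ x, f x ∂η ≤ 0) :
    η = 0 := by
  have h0 : 0 ≤ᵐ[η] f := hpos.mono fun x hx => hx.le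
  have h1 := (integral_eq_zero_iff_of_nonneg_ae h0 hf).1 (le_antisymm hle (integral_nonneg_of_ae h0))
  rw [← ae_eq_bot, ← Filter.eventually_false_iff_eq_bot]
  filter_upwards [hpos, h1] with x h2 h3
  exact h2.ne' h3

variable [IsFiniteMeasure π] [IsFiniteMeasure μ₀] [IsFiniteMeasure μ₁]

lemma dens_smul {ρ μ : Measure X} [IsFiniteMeasure ρ] [IsFiniteMeasure μ] {c : ℝ} (hc : 0 ≤ c) :
    ∀ᵐ x ∂μ, dens (ENNReal.ofReal c • ρ) μ x = c * dens ρ μ x := by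
  filter_upwards [Measure.rnDeriv_smul_left_of_ne_top ρ μ (r := ENNReal.ofReal c) ofReal_ne_top]
    with x hx
  rw [dens, hx, Pi.smul_apply, smul_eq_mul, toReal_mul, toReal_ofReal hc, dens]

lemma le_dens {ρ ρ' μ : Measure X} [IsFiniteMeasure ρ] [IsFiniteMeasure ρ'] [IsFiniteMeasure μ]
    {c : ℝ} (hc : 0 ≤ c) :
    ∀ᵐ x ∂μ, c * dens ρ μ x ≤ dens (ENNReal.ofReal c • ρ + ρ') μ x := by
  have : IsFiniteMeasure (ENNReal.ofReal c • ρ) := Measure.smul_finite _ ofReal_ne_top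
  filter_upwards [dens_smul (ρ := ρ) (μ := μ) hc,
    toReal_rnDeriv_add (ρ := ENNReal.ofReal c • ρ) (η := ρ') (μ := μ)] with x h1 h2
  rw [← h1, dens, dens, h2]
  linarith [toReal_nonneg (a := ρ'.rnDeriv μ x)]

lemma dens_le {η μ : Measure X} [IsFiniteMeasure η] [IsFiniteMeasure μ]
    {c : ℝ} (hc : 0 ≤ c) (h : η ≤ ENNReal.ofReal c • μ) :
    ∀ᵐ x ∂μ, dens η μ x ≤ c := by
  have h2 : η.rnDeriv μ ≤ᵐ[μ] fun _ => ENNReal.ofReal c := by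
    refine ae_le_of_forall_setLIntegral_le_of_sigmaFinite (Measure.measurable_rnDeriv _ _) ?_
    intro s hs _
    calc ∫⁻ x in s, η.rnDeriv μ x ∂μ ≤ η s := Measure.setLIntegral_rnDeriv_le s
      _ ≤ (ENNReal.ofReal c • μ) s := h s
      _ = ∫⁻ x in s, ENNReal.ofReal c ∂μ := by simp
  filter_upwards [h2] with x hx
  exact toReal_le_of_le_ofReal hc hx

lemma ae_dens_pos {ρ μ : Measure X} [IsFiniteMeasure ρ] [IsFiniteMeasure μ] (h : ρ ≪ μ) :
    ∀ᵐ x ∂ρ, 0 < dens ρ μ x := by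
  filter_upwards [Measure.rnDeriv_pos h, h.ae_le (Measure.rnDeriv_lt_top ρ μ)] with x h1 h2
  exact toReal_pos h1.ne' h2.ne

lemma IsOpt.mul_dens_le_aux (h : IsOpt C π μ₀ μ₁) (hC : Measurable C) {k : ℝ} (hk : 0 < k) :
    π {p | k⁻¹ ≤ dens π.fst μ₀ p.1 ∧ dens π.fst μ₀ p.1 ≤ k ∧ k⁻¹ ≤ dens π.snd μ₁ p.2 ∧
      dens π.snd μ₁ p.2 ≤ k ∧ 0 < C p ∧
      C p ^ 2 * (1 + k⁻¹) ≤ dens π.fst μ₀ p.1 * dens π.snd μ₁ p.2} = 0 := by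
  set s₀ := dens π.fst μ₀ with hs₀
  set s₁ := dens π.snd μ₁ with hs₁
  have ms₀ : Measurable s₀ := measurable_dens _ _
  have ms₁ : Measurable s₁ := measurable_dens _ _
  set D := {p : X × X | k⁻¹ ≤ s₀ p.1 ∧ s₀ p.1 ≤ k ∧ k⁻¹ ≤ s₁ p.2 ∧
      s₁ p.2 ≤ k ∧ 0 < C p ∧ C p ^ 2 * (1 + k⁻¹) ≤ s₀ p.1 * s₁ p.2} with hD
  have mD : MeasurableSet D := by
    have a0 : Measurable fun p : X × X => s₀ p.1 := ms₀.comp measurable_fst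
    have a1 : Measurable fun p : X × X => s₁ p.2 := ms₁.comp measurable_snd
    exact (measurableSet_le measurable_const a0).inter <| (measurableSet_le a0 measurable_const).inter
      <| (measurableSet_le measurable_const a1).inter <| (measurableSet_le a1 measurable_const).inter
      <| (measurableSet_lt measurable_const hC).inter
      (measurableSet_le ((hC.pow_const 2).mul_const _) (a0.mul a1))
  have hk' : 0 < k⁻¹ := inv_pos.2 hk
  obtain ⟨t, ht0, ht1, ht⟩ : ∃ t : ℝ, 0 < t ∧ t < 1 ∧ 1 < (1 - t) ^ 2 * (1 + k⁻¹) := by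
    refine ⟨k⁻¹ / (3 * (1 + k⁻¹)), by positivity, ?_, ?_⟩
    · rw [div_lt_one (by positivity)]; linarith
    · have h1 : k⁻¹ / (3 * (1 + k⁻¹)) * (1 + k⁻¹) = k⁻¹ / 3 := by field_simp
      nlinarith [sq_nonneg (k⁻¹ / (3 * (1 + k⁻¹)))]
  set η := ENNReal.ofReal t • π.restrict D with hη
  set π' := ENNReal.ofReal (1 - t) • π + ENNReal.ofReal t • π.restrict Dᶜ with hπ'
  have : IsFiniteMeasure η := Measure.smul_finite _ ofReal_ne_top
  have : IsFiniteMeasure (ENNReal.ofReal t • π.restrict Dᶜ) := Measure.smul_finite _ ofReal_ne_top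
  have : IsFiniteMeasure (ENNReal.ofReal (1 - t) • π) := Measure.smul_finite _ ofReal_ne_top
  have hsum : π' + η = π := by
    rw [hπ', hη, add_assoc, ← smul_add, add_comm (π.restrict Dᶜ),
      Measure.restrict_add_restrict_compl mD, ← add_smul, ← ofReal_add (by linarith) ht0.le]
    simp
  have h' : IsOpt C (π' + η) μ₀ μ₁ := by rwa [hsum]
  have hηπ : η ≪ π := (Measure.smul_absolutelyContinuous).trans Measure.absolutelyContinuous_restrict
  have hηD : ∀ᵐ p ∂η, p ∈ D := Measure.ae_smul_measure (ae_restrict_mem mD) _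
  have hη0 : η.fst ≪ μ₀ := (hηπ.map measurable_fst).trans h.ac₀
  have hη1 : η.snd ≪ μ₁ := (hηπ.map measurable_snd).trans h.ac₁
  have hbd : ∀ x, k⁻¹ ≤ x → x ≤ k → |Real.log ((1 - t) * x)| ≤
      |Real.log ((1 - t) * k⁻¹)| + |Real.log ((1 - t) * k)| := fun x h1 h2 =>
    abs_log_le (mul_pos (by linarith) hk') (mul_le_mul_of_nonneg_left h1 (by linarith))
      (mul_le_mul_of_nonneg_left h2 (by linarith))
  have mu0 : Measurable fun x => Real.log ((1 - t) * s₀ x) := (ms₀.const_mul _).log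
  have mu1 : Measurable fun x => Real.log ((1 - t) * s₁ x) := (ms₁.const_mul _).log
  have iu0 : Integrable (fun p : X × X => Real.log ((1 - t) * s₀ p.1)) η :=
    Integrable.of_bound (mu0.comp measurable_fst).aestronglyMeasurable _
      (hηD.mono fun p hp => hbd _ hp.1 hp.2.1)
  have iu1 : Integrable (fun p : X × X => Real.log ((1 - t) * s₁ p.2)) η :=
    Integrable.of_bound (mu1.comp measurable_snd).aestronglyMeasurable _
      (hηD.mono fun p hp => hbd _ hp.2.2.1 hp.2.2.2.1)
  have iC : Integrable (fun p => Real.log (C p)) η :=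
    (h.int.restrict).smul_measure ofReal_ne_top
  have e0 : ∀ᵐ x ∂η.fst, Real.exp (Real.log ((1 - t) * s₀ x)) ≤ dens π'.fst μ₀ x := by
    have : ∀ᵐ x ∂η.fst, k⁻¹ ≤ s₀ x :=
      (ae_fst_iff (measurableSet_le measurable_const ms₀)).2 (hηD.mono fun p hp => hp.1)
    filter_upwards [hη0.ae_le (le_dens (ρ := π.fst) (ρ' := (ENNReal.ofReal t • π.restrict Dᶜ).fst)
      (μ := μ₀) (c := 1 - t) (by linarith)), this] with x h1 h2
    rw [Real.exp_log (mul_pos (by linarith) (hk'.trans_le h2))]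
    rwa [hπ', fst_add, Measure.fst, Measure.map_smul]
  have e1 : ∀ᵐ x ∂η.snd, Real.exp (Real.log ((1 - t) * s₁ x)) ≤ dens π'.snd μ₁ x := by
    have : ∀ᵐ x ∂η.snd, k⁻¹ ≤ s₁ x :=
      (ae_snd_iff (measurableSet_le measurable_const ms₁)).2 (hηD.mono fun p hp => hp.2.2.1)
    filter_upwards [hη1.ae_le (le_dens (ρ := π.snd) (ρ' := (ENNReal.ofReal t • π.restrict Dᶜ).snd)
      (μ := μ₁) (c := 1 - t) (by linarith)), this] with x h1 h2
    rw [Real.exp_log (mul_pos (by linarith) (hk'.trans_le h2))]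
    rwa [hπ', snd_add, Measure.snd, Measure.map_smul]
  have key := h'.variation_sub mu0 mu1 iu0 iu1 e0 e1
  have hη_zero : η = 0 := by
    refine measure_eq_zero_of_integral_nonpos (((iC.const_mul _).add iu0).add iu1) ?_ key
    filter_upwards [hηD] with p hp
    obtain ⟨p1, -, p3, -, p5, p6⟩ := hp
    have q0 : 0 < (1 - t) * s₀ p.1 := mul_pos (by linarith) (hk'.trans_le p1)
    have q1 : 0 < (1 - t) * s₁ p.2 := mul_pos (by linarith) (hk'.trans_le p3)
    have : Real.log (C p ^ 2) < Real.log ((1 - t) * s₀ p.1 * ((1 - t) * s₁ p.2)) := by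
      apply Real.log_lt_log (by positivity)
      have : 0 < C p ^ 2 := by positivity
      nlinarith [mul_le_mul_of_nonneg_left p6 (sq_nonneg (1 - t))]
    rw [Real.log_pow, Real.log_mul q0.ne' q1.ne'] at this
    push_cast at this
    change 0 < -2 * Real.log (C p) + Real.log ((1 - t) * s₀ p.1) + Real.log ((1 - t) * s₁ p.2)
    linarith
  have := congrArg (fun m : Measure (X × X) => m Set.univ) hη_zero
  simpa [hη, ht0.not_ge] using this

/-- Optimality on the support of an optimal plan. -/
lemma IsOpt.mul_dens_le (h : IsOpt C π μ₀ μ₁) (hC : Measurable C) :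
    ∀ᵐ p ∂π, dens π.fst μ₀ p.1 * dens π.snd μ₁ p.2 ≤ C p ^ 2 := by
  have hall := ae_all_iff.2 fun k : ℕ =>
    measure_eq_zero_iff_ae_notMem.1 (h.mul_dens_le_aux hC (k := k + 1) (by positivity))
  filter_upwards [hall, h.pos, ae_of_ae_fst (ae_dens_pos h.ac₀), ae_of_ae_snd (ae_dens_pos h.ac₁)]
    with p hp hCp hp0 hp1
  by_contra hcon
  push Not at hcon
  have hlt : 0 < dens π.fst μ₀ p.1 * dens π.snd μ₁ p.2 / C p ^ 2 - 1 := by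
    rw [sub_pos, one_lt_div (by positivity)]; exact hcon
  obtain ⟨k, hk⟩ := exists_nat_gt (max (max (dens π.fst μ₀ p.1) (dens π.snd μ₁ p.2))
    (max (max (dens π.fst μ₀ p.1)⁻¹ (dens π.snd μ₁ p.2)⁻¹)
      (dens π.fst μ₀ p.1 * dens π.snd μ₁ p.2 / C p ^ 2 - 1)⁻¹))
  simp only [max_lt_iff] at hk
  obtain ⟨⟨k1, k2⟩, ⟨k3, k4⟩, k5⟩ := hk
  refine hp k ⟨?_, by linarith, ?_, by linarith, hCp, ?_⟩
  · exact (inv_lt_of_inv_lt₀ hp0 (by linarith)).le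
  · exact (inv_lt_of_inv_lt₀ hp1 (by linarith)).le
  · have := (inv_lt_of_inv_lt₀ hlt (k5.trans (lt_add_one _))).le
    rw [mul_comm, ← le_div_iff₀ (by positivity)]
    linarith

lemma IsOpt.le_mul_dens_aux (h : IsOpt C π μ₀ μ₁) (hC : Measurable C) (hC1 : ∀ p, C p ≤ 1)
    {k : ℝ} (hk : 0 < k) :
    μ₀.prod μ₁ {p | dens π.fst μ₀ p.1 ≤ k ∧ dens π.snd μ₁ p.2 ≤ k ∧ k⁻¹ ≤ C p ∧
      dens π.fst μ₀ p.1 * dens π.snd μ₁ p.2 + k⁻¹ ≤ C p ^ 2} = 0 := by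
  set s₀ := dens π.fst μ₀ with hs₀
  set s₁ := dens π.snd μ₁ with hs₁
  have ms₀ : Measurable s₀ := measurable_dens _ _
  have ms₁ : Measurable s₁ := measurable_dens _ _
  set D := {p : X × X | s₀ p.1 ≤ k ∧ s₁ p.2 ≤ k ∧ k⁻¹ ≤ C p ∧
      s₀ p.1 * s₁ p.2 + k⁻¹ ≤ C p ^ 2} with hD
  have mD : MeasurableSet D := by
    have a0 : Measurable fun p : X × X => s₀ p.1 := ms₀.comp measurable_fst
    have a1 : Measurable fun p : X × X => s₁ p.2 := ms₁.comp measurable_snd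
    exact (measurableSet_le a0 measurable_const).inter <| (measurableSet_le a1 measurable_const).inter
      <| (measurableSet_le measurable_const hC).inter
      (measurableSet_le ((a0.mul a1).add_const _) (hC.pow_const 2))
  have hk' : 0 < k⁻¹ := inv_pos.2 hk
  obtain ⟨τ, hτ0, hτ⟩ : ∃ τ : ℝ, 0 < τ ∧ 2 * k * τ + τ ^ 2 < k⁻¹ := by
    refine ⟨min 1 (k⁻¹ / (2 * (2 * k + 1))), by positivity, ?_⟩
    set τ := min 1 (k⁻¹ / (2 * (2 * k + 1)))
    have h1 : τ ≤ 1 := min_le_left _ _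
    have h2 : τ ≤ k⁻¹ / (2 * (2 * k + 1)) := min_le_right _ _
    have h3 : 0 < τ := by positivity
    rw [le_div_iff₀ (by positivity)] at h2
    nlinarith
  set M : ℝ := μ₀.real Set.univ + μ₁.real Set.univ + 1 with hM
  have hM0 : 0 < M := by positivity
  set t : ℝ := τ / M with ht
  have ht0 : 0 < t := by positivity
  set η := ENNReal.ofReal t • (μ₀.prod μ₁).restrict D with hη
  have : IsFiniteMeasure η := Measure.smul_finite _ ofReal_ne_top
  have hηπ : η ≤ ENNReal.ofReal t • μ₀.prod μ₁ := by
    rw [hη]; gcongr; exact Measure.restrict_le_self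
  have hηD : ∀ᵐ p ∂η, p ∈ D := Measure.ae_smul_measure (ae_restrict_mem mD) _
  have htm : ∀ m : Measure X, IsFiniteMeasure m → m.real Set.univ ≤ M →
      ENNReal.ofReal t * m Set.univ ≤ ENNReal.ofReal τ := fun m _ hm => by
    rw [← ofReal_toReal (measure_ne_top m Set.univ), ← ofReal_mul ht0.le]
    refine ofReal_le_ofReal ?_
    calc t * m.real Set.univ ≤ t * M := by gcongr
      _ = τ := by rw [ht]; field_simp
  have hη0' : η.fst ≤ ENNReal.ofReal τ • μ₀ := by
    refine (Measure.map_mono hηπ measurable_fst).trans ?_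
    rw [Measure.map_smul, Measure.map_fst_prod, smul_smul]
    gcongr
    exact htm μ₁ inferInstance (by rw [hM]; linarith [measureReal_nonneg (μ := μ₀) (s := Set.univ)])
  have hη1' : η.snd ≤ ENNReal.ofReal τ • μ₁ := by
    refine (Measure.map_mono hηπ measurable_snd).trans ?_
    rw [Measure.map_smul, Measure.map_snd_prod, smul_smul]
    gcongr
    exact htm μ₀ inferInstance (by rw [hM]; linarith [measureReal_nonneg (μ := μ₁) (s := Set.univ)])
  have hη0 : η.fst ≪ μ₀ := hη0'.absolutelyContinuous.trans Measure.smul_absolutelyContinuous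
  have hη1 : η.snd ≪ μ₁ := hη1'.absolutelyContinuous.trans Measure.smul_absolutelyContinuous
  have hbd : ∀ x, 0 ≤ x → x ≤ k → |Real.log (x + τ)| ≤
      |Real.log τ| + |Real.log (k + τ)| := fun x h1 h2 =>
    abs_log_le hτ0 (by linarith) (by linarith)
  have mu0 : Measurable fun x => Real.log (s₀ x + τ) := (ms₀.add_const _).log
  have mu1 : Measurable fun x => Real.log (s₁ x + τ) := (ms₁.add_const _).log
  have iu0 : Integrable (fun p : X × X => Real.log (s₀ p.1 + τ)) η :=
    Integrable.of_bound (mu0.comp measurable_fst).aestronglyMeasurable _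
      (hηD.mono fun p hp => hbd _ (dens_nonneg _ _ _) hp.1)
  have iu1 : Integrable (fun p : X × X => Real.log (s₁ p.2 + τ)) η :=
    Integrable.of_bound (mu1.comp measurable_snd).aestronglyMeasurable _
      (hηD.mono fun p hp => hbd _ (dens_nonneg _ _ _) hp.2.1)
  have iC : Integrable (fun p => Real.log (C p)) η :=
    Integrable.of_bound hC.log.aestronglyMeasurable _
      (hηD.mono fun p hp => abs_log_le hk' hp.2.2.1 (hC1 p))
  have hpos : ∀ᵐ p ∂η, 0 < C p := hηD.mono fun p hp => hk'.trans_le hp.2.2.1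
  have e0 : ∀ᵐ x ∂η.fst, dens (π.fst + η.fst) μ₀ x ≤ Real.exp (Real.log (s₀ x + τ)) := by
    filter_upwards [hη0.ae_le (dens_le hτ0.le hη0'), hη0.ae_le (toReal_rnDeriv_add (ρ := π.fst)
      (η := η.fst) (μ := μ₀))] with x h1 h2
    rw [Real.exp_log (by linarith [dens_nonneg π.fst μ₀ x]), dens, h2]
    exact add_le_add le_rfl h1
  have e1 : ∀ᵐ x ∂η.snd, dens (π.snd + η.snd) μ₁ x ≤ Real.exp (Real.log (s₁ x + τ)) := by
    filter_upwards [hη1.ae_le (dens_le hτ0.le hη1'), hη1.ae_le (toReal_rnDeriv_add (ρ := π.snd)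
      (η := η.snd) (μ := μ₁))] with x h1 h2
    rw [Real.exp_log (by linarith [dens_nonneg π.snd μ₁ x]), dens, h2]
    exact add_le_add le_rfl h1
  have key := h.variation_add hpos iC hη0 hη1 mu0 mu1 iu0 iu1 e0 e1
  have hη_zero : η = 0 := by
    refine measure_eq_zero_of_integral_nonpos (((iC.const_mul (-2)).add iu0).add iu1).neg ?_ ?_
    · filter_upwards [hηD] with p hp
      obtain ⟨p1, p2, p3, p4⟩ := hp
      have n0 : 0 ≤ s₀ p.1 := dens_nonneg _ _ _
      have n1 : 0 ≤ s₁ p.2 := dens_nonneg _ _ _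
      have : Real.log ((s₀ p.1 + τ) * (s₁ p.2 + τ)) < Real.log (C p ^ 2) := by
        apply Real.log_lt_log (by positivity)
        nlinarith
      rw [Real.log_pow, Real.log_mul (by positivity) (by positivity)] at this
      push_cast at this
      change 0 < -(-2 * Real.log (C p) + Real.log (s₀ p.1 + τ) + Real.log (s₁ p.2 + τ))
      linarith
    · simp only [Pi.neg_apply, integral_neg]
      exact neg_nonpos.2 key
  have := congrArg (fun m : Measure (X × X) => m Set.univ) hη_zero
  simpa [hη, ht0.not_ge] using this

/-- Optimality off the support of an optimal plan. -/
lemma IsOpt.le_mul_dens (h : IsOpt C π μ₀ μ₁) (hC : Measurable C) (hC0 : ∀ p, 0 ≤ C p)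
    (hC1 : ∀ p, C p ≤ 1) :
    ∀ᵐ p ∂(μ₀.prod μ₁), C p ^ 2 ≤ dens π.fst μ₀ p.1 * dens π.snd μ₁ p.2 := by
  have hall := ae_all_iff.2 fun k : ℕ =>
    measure_eq_zero_iff_ae_notMem.1 (h.le_mul_dens_aux hC hC1 (k := k + 1) (by positivity))
  filter_upwards [hall] with p hp
  by_contra hcon
  push Not at hcon
  have hn : 0 ≤ dens π.fst μ₀ p.1 * dens π.snd μ₁ p.2 :=
    mul_nonneg (dens_nonneg _ _ _) (dens_nonneg _ _ _)
  have hCp : 0 < C p := lt_of_le_of_ne (hC0 p) fun h0 => by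
    rw [← h0] at hcon; linarith
  have hlt := sub_pos.2 hcon
  obtain ⟨k, hk⟩ := exists_nat_gt (max (max (dens π.fst μ₀ p.1) (dens π.snd μ₁ p.2))
    (max (C p)⁻¹ (C p ^ 2 - dens π.fst μ₀ p.1 * dens π.snd μ₁ p.2)⁻¹))
  simp only [max_lt_iff] at hk
  obtain ⟨⟨k1, k2⟩, k3, k4⟩ := hk
  refine hp k ⟨by linarith, by linarith, ?_, ?_⟩
  · exact (inv_lt_of_inv_lt₀ hCp (by linarith)).le
  · have := (inv_lt_of_inv_lt₀ hlt (k4.trans (lt_add_one _))).le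
    linarith

end Conditions

section Duality

variable {X : Type*} [MeasurableSpace X] {C : X × X → ℝ} {π : Measure (X × X)}
  {μ₀ μ₁ : Measure X}

lemma fst_real_univ : π.fst.real Set.univ = π.real Set.univ := by
  simp [measureReal_def, Measure.fst_univ]

lemma snd_real_univ : π.snd.real Set.univ = π.real Set.univ := by
  simp [measureReal_def, Measure.snd_univ]

variable [IsFiniteMeasure π] [IsFiniteMeasure μ₀] [IsFiniteMeasure μ₁]

/-- The plan with density `1 / C`. -/
noncomputable def invPlan (C : X × X → ℝ) (π : Measure (X × X)) : Measure (X × X) :=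
  π.withDensity fun p => ENNReal.ofReal (C p)⁻¹

lemma lintegral_mul_inv_dens_le {ρ μ : Measure X} [IsFiniteMeasure ρ] [IsFiniteMeasure μ]
    (h : ρ ≪ μ) {f : X → ℝ≥0∞} (hf : Measurable f) :
    ∫⁻ x, f x * ENNReal.ofReal (dens ρ μ x)⁻¹ ∂ρ ≤ ∫⁻ x, f x ∂μ := by
  have hm : Measurable fun x => f x * ENNReal.ofReal (dens ρ μ x)⁻¹ :=
    hf.mul (measurable_dens _ _).inv.ennreal_ofReal
  rw [← lintegral_rnDeriv_mul h hm.aemeasurable]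
  refine lintegral_mono_ae ?_
  filter_upwards [Measure.rnDeriv_lt_top ρ μ] with x hx
  rcases eq_or_ne (ρ.rnDeriv μ x) 0 with h0 | h0
  · simp [h0]
  · rw [dens, ofReal_inv_of_pos (toReal_pos h0 hx.ne), ofReal_toReal hx.ne, mul_left_comm,
      ENNReal.mul_inv_cancel h0 hx.ne, mul_one]

lemma IsOpt.lintegral_invPlan_le (h : IsOpt C π μ₀ μ₁) (hC : Measurable C) {t : ℝ} (ht : 0 < t)
    {f g : X → ℝ≥0∞} (hf : Measurable f) (hg : Measurable g) (hf1 : ∀ x, f x ≤ 1)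
    (hg1 : ∀ x, g x ≤ 1) :
    ∫⁻ p, f p.1 * g p.2 ∂(invPlan C π) ≤
      ENNReal.ofReal t * ∫⁻ x, f x ∂μ₀ + ENNReal.ofReal t⁻¹ * ∫⁻ x, g x ∂μ₁ := by
  have hF : Measurable fun x => f x * ENNReal.ofReal (dens π.fst μ₀ x)⁻¹ :=
    hf.mul (measurable_dens _ _).inv.ennreal_ofReal
  have hG : Measurable fun x => g x * ENNReal.ofReal (dens π.snd μ₁ x)⁻¹ :=
    hg.mul (measurable_dens _ _).inv.ennreal_ofReal
  calc ∫⁻ p, f p.1 * g p.2 ∂(invPlan C π)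
      = ∫⁻ p, ENNReal.ofReal (C p)⁻¹ * (f p.1 * g p.2) ∂π :=
        lintegral_withDensity_eq_lintegral_mul _ hC.inv.ennreal_ofReal
          ((hf.comp measurable_fst).mul (hg.comp measurable_snd))
    _ ≤ ∫⁻ p, (ENNReal.ofReal t * (f p.1 * ENNReal.ofReal (dens π.fst μ₀ p.1)⁻¹) +
          ENNReal.ofReal t⁻¹ * (g p.2 * ENNReal.ofReal (dens π.snd μ₁ p.2)⁻¹)) ∂π := by
        refine lintegral_mono_ae ?_
        filter_upwards [h.mul_dens_le hC, h.pos, ae_of_ae_fst (ae_dens_pos h.ac₀),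
          ae_of_ae_snd (ae_dens_pos h.ac₁)] with p h1 h2 h3 h4
        set a := dens π.fst μ₀ p.1
        set b := dens π.snd μ₁ p.2
        have hr : (C p)⁻¹ ≤ t * a⁻¹ + t⁻¹ * b⁻¹ := by
          refine le_of_sq_le_sq ?_ (by positivity)
          have h5 : (C p ^ 2)⁻¹ ≤ (a * b)⁻¹ := inv_anti₀ (by positivity) h1
          have h6 : (a * b)⁻¹ = (t * a⁻¹) * (t⁻¹ * b⁻¹) := by field_simp
          have h7 : 0 < t * a⁻¹ := by positivity
          have h8 : 0 < t⁻¹ * b⁻¹ := by positivity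
          rw [inv_pow]
          nlinarith
        calc ENNReal.ofReal (C p)⁻¹ * (f p.1 * g p.2)
            ≤ ENNReal.ofReal (t * a⁻¹ + t⁻¹ * b⁻¹) * (f p.1 * g p.2) := by gcongr
          _ = ENNReal.ofReal t * (f p.1 * g p.2 * ENNReal.ofReal a⁻¹) +
              ENNReal.ofReal t⁻¹ * (f p.1 * g p.2 * ENNReal.ofReal b⁻¹) := by
              rw [ofReal_add (by positivity) (by positivity), ofReal_mul ht.le,
                ofReal_mul (by positivity)]
              ring
          _ ≤ _ := by
              gcongr
              · exact mul_le_of_le_one_right' (hg1 _)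
              · exact mul_le_of_le_one_left' (hf1 _)
    _ = ENNReal.ofReal t * ∫⁻ x, f x * ENNReal.ofReal (dens π.fst μ₀ x)⁻¹ ∂π.fst +
          ENNReal.ofReal t⁻¹ * ∫⁻ x, g x * ENNReal.ofReal (dens π.snd μ₁ x)⁻¹ ∂π.snd := by
        have hF' : Measurable fun p : X × X => f p.1 * ENNReal.ofReal (dens π.fst μ₀ p.1)⁻¹ :=
          hF.comp measurable_fst
        have hG' : Measurable fun p : X × X => g p.2 * ENNReal.ofReal (dens π.snd μ₁ p.2)⁻¹ :=
          hG.comp measurable_snd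
        rw [lintegral_add_left (hF'.const_mul _), lintegral_const_mul _ hF',
          lintegral_const_mul _ hG']
        congr 2
        · exact (lintegral_map hF measurable_fst).symm
        · exact (lintegral_map hG measurable_snd).symm
    _ ≤ _ := by
        exact add_le_add (mul_le_mul_right (lintegral_mul_inv_dens_le h.ac₀ hf) _)
          (mul_le_mul_right (lintegral_mul_inv_dens_le h.ac₁ hg) _)

lemma IsOpt.invPlan_univ_le (h : IsOpt C π μ₀ μ₁) (hC : Measurable C) :
    invPlan C π Set.univ ≤ μ₀ Set.univ + μ₁ Set.univ := by
  simpa using h.lintegral_invPlan_le hC one_pos (f := fun _ => 1) (g := fun _ => 1)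
    measurable_const measurable_const (fun _ => le_rfl) fun _ => le_rfl

lemma IsOpt.isFiniteMeasure_invPlan (h : IsOpt C π μ₀ μ₁) (hC : Measurable C) :
    IsFiniteMeasure (invPlan C π) :=
  ⟨(h.invPlan_univ_le hC).trans_lt (by finiteness)⟩

lemma toReal_klDiv_eq_log {ρ μ : Measure X} [IsFiniteMeasure ρ] [IsFiniteMeasure μ]
    (h : klDiv ρ μ ≠ ⊤) :
    (klDiv ρ μ).toReal = ∫ x, Real.log (dens ρ μ x) ∂ρ + μ.real Set.univ - ρ.real Set.univ :=
  toReal_klDiv (klDiv_ne_top_iff.1 h).1 (klDiv_ne_top_iff.1 h).2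

lemma integrable_log_dens {ρ μ : Measure X} [IsFiniteMeasure ρ] [IsFiniteMeasure μ]
    (h : klDiv ρ μ ≠ ⊤) : Integrable (fun x => Real.log (dens ρ μ x)) ρ :=
  (klDiv_ne_top_iff.1 h).2

lemma IsOpt.energy_le (h : IsOpt C π μ₀ μ₁) (hC : Measurable C) :
    energy C π μ₀ μ₁ ≤ μ₀.real Set.univ + μ₁.real Set.univ - 2 * π.real Set.univ := by
  rw [energy, toReal_klDiv_eq_log h.kl₀, toReal_klDiv_eq_log h.kl₁, fst_real_univ, snd_real_univ,
    integral_fst (measurable_dens _ _).log, integral_snd (measurable_dens _ _).log]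
  have i0 := (integrable_fst (π := π) (measurable_dens _ _).log).1 (integrable_log_dens h.kl₀)
  have i1 := (integrable_snd (π := π) (measurable_dens _ _).log).1 (integrable_log_dens h.kl₁)
  have : ∫ p, (Real.log (dens π.fst μ₀ p.1) + Real.log (dens π.snd μ₁ p.2)) ∂π ≤
      ∫ p, 2 * Real.log (C p) ∂π := by
    refine integral_mono_ae (i0.add i1) (h.int.const_mul 2) ?_
    filter_upwards [h.mul_dens_le hC, h.pos, ae_of_ae_fst (ae_dens_pos h.ac₀),
      ae_of_ae_snd (ae_dens_pos h.ac₁)] with p h1 h2 h3 h4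
    have := Real.log_le_log (mul_pos h3 h4) h1
    rw [Real.log_mul h3.ne' h4.ne', Real.log_pow] at this
    exact_mod_cast this
  rw [integral_add i0 i1, integral_const_mul] at this
  linarith

/-- Weak duality. -/
lemma Adm.le_energy (h : Adm C π μ₀ μ₁) {S₀ S₁ : X → ℝ} (m0 : Measurable S₀) (m1 : Measurable S₁)
    {δ B : ℝ} (hδ : 0 < δ) (hδ0 : ∀ x, δ ≤ S₀ x) (hδ1 : ∀ x, δ ≤ S₁ x) (hB0 : ∀ x, S₀ x ≤ B)
    (hB1 : ∀ x, S₁ x ≤ B) (hS : ∀ x y, C (x, y) ^ 2 ≤ S₀ x * S₁ y) :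
    μ₀.real Set.univ + μ₁.real Set.univ - ∫ x, S₀ x ∂μ₀ - ∫ x, S₁ x ∂μ₁ ≤ energy C π μ₀ μ₁ := by
  have b0 : ∀ x, |Real.log (S₀ x)| ≤ |Real.log δ| + |Real.log B| := fun x =>
    abs_log_le hδ (hδ0 x) (hB0 x)
  have b1 : ∀ x, |Real.log (S₁ x)| ≤ |Real.log δ| + |Real.log B| := fun x =>
    abs_log_le hδ (hδ1 x) (hB1 x)
  have g0 := integral_sub_le_klDiv h.kl₀ m0.log b0
  have g1 := integral_sub_le_klDiv h.kl₁ m1.log b1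
  have e : ∀ (S : X → ℝ) (μ : Measure X) [IsFiniteMeasure μ], Measurable S → (∀ x, δ ≤ S x) →
      (∀ x, S x ≤ B) →
      ∫ x, (Real.exp (Real.log (S x)) - 1) ∂μ = ∫ x, S x ∂μ - μ.real Set.univ := by
    intro S μ _ mS hS hSB
    have hI : Integrable S μ := Integrable.of_bound mS.aestronglyMeasurable B
      (ae_of_all _ fun x => by rw [Real.norm_eq_abs, abs_of_nonneg (hδ.le.trans (hS x))]; exact hSB x)
    simp_rw [Real.exp_log (hδ.trans_le (hS _))]
    rw [integral_sub hI (integrable_const _)]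
    simp
  rw [e S₀ μ₀ m0 hδ0 hB0, integral_fst m0.log] at g0
  rw [e S₁ μ₁ m1 hδ1 hB1, integral_snd m1.log] at g1
  have i0 : Integrable (fun p : X × X => Real.log (S₀ p.1)) π :=
    Integrable.of_bound (m0.log.comp measurable_fst).aestronglyMeasurable _
      (ae_of_all _ fun p => b0 _)
  have i1 : Integrable (fun p : X × X => Real.log (S₁ p.2)) π :=
    Integrable.of_bound (m1.log.comp measurable_snd).aestronglyMeasurable _
      (ae_of_all _ fun p => b1 _)
  have : ∫ p, 2 * Real.log (C p) ∂π ≤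
      ∫ p, (Real.log (S₀ p.1) + Real.log (S₁ p.2)) ∂π := by
    refine integral_mono_ae (h.int.const_mul 2) (i0.add i1) ?_
    filter_upwards [h.pos] with p hp
    have := Real.log_le_log (by positivity) (hS p.1 p.2)
    rw [Real.log_mul (hδ.trans_le (hδ0 _)).ne' (hδ.trans_le (hδ1 _)).ne', Real.log_pow] at this
    exact_mod_cast this
  rw [integral_add i0 i1, integral_const_mul] at this
  rw [energy]
  linarith

end Duality

section Potentials

variable {X : Type*} [MetricSpace X]

/-- Lipschitz functions with values in `[0, 1]`, used as `exp (-cost / 2)`. -/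
structure IsKernel (C : X × X → ℝ) (Λ : ℝ) : Prop where
  nonneg : ∀ p, 0 ≤ C p
  le_one : ∀ p, C p ≤ 1
  const_nonneg : 0 ≤ Λ
  lip : ∀ x y x' y', |C (x, y) - C (x', y')| ≤ Λ * (dist x x' + dist y y')

variable {C : X × X → ℝ} {Λ : ℝ}

lemma continuous_of_abs_le {Y : Type*} [PseudoMetricSpace Y] {f : Y → ℝ} {L : ℝ}
    (h : ∀ x y, |f x - f y| ≤ L * dist x y) : Continuous f := by
  have : LipschitzWith L.toNNReal f := LipschitzWith.of_dist_le_mul fun x y => by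
    rw [Real.dist_eq]
    exact (h x y).trans (mul_le_mul_of_nonneg_right (Real.le_coe_toNNReal L) dist_nonneg)
  exact this.continuous

lemma IsKernel.continuous (h : IsKernel C Λ) : Continuous C := by
  refine continuous_of_abs_le (L := 2 * Λ) fun p q => (h.lip p.1 p.2 q.1 q.2).trans ?_
  have h1 : dist p.1 q.1 ≤ dist p q := le_max_left _ _
  have h2 : dist p.2 q.2 ≤ dist p q := le_max_right _ _
  nlinarith [h.const_nonneg]

lemma IsKernel.abs_sq_sub_le (h : IsKernel C Λ) (x y x' y' : X) :
    |C (x, y) ^ 2 - C (x', y') ^ 2| ≤ 2 * Λ * (dist x x' + dist y y') := by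
  rw [sq_sub_sq, abs_mul]
  have h1 : |C (x, y) + C (x', y')| ≤ 2 := by
    rw [abs_of_nonneg (add_nonneg (h.nonneg _) (h.nonneg _))]
    linarith [h.le_one (x, y), h.le_one (x', y')]
  have h2 := h.lip x y x' y'
  calc _ ≤ 2 * (Λ * (dist x x' + dist y y')) := by gcongr
    _ = _ := by ring

lemma IsKernel.sq_le_one (h : IsKernel C Λ) (p : X × X) : C p ^ 2 ≤ 1 :=
  pow_le_one₀ (h.nonneg p) (h.le_one p)

lemma abs_iSup_sub_iSup_le {ι : Type*} {f g : ι → ℝ} {b : ℝ} (hb : 0 ≤ b)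
    (hf : BddAbove (Set.range f)) (hg : BddAbove (Set.range g)) (h : ∀ i, |f i - g i| ≤ b) :
    |(⨆ i, f i) - ⨆ i, g i| ≤ b := by
  rcases isEmpty_or_nonempty ι with hι | hι
  · simpa using hb
  rw [abs_sub_le_iff]
  constructor
  · rw [sub_le_iff_le_add]
    exact ciSup_le fun i => by linarith [(abs_sub_le_iff.1 (h i)).1, le_ciSup hg i]
  · rw [sub_le_iff_le_add]
    exact ciSup_le fun i => by linarith [(abs_sub_le_iff.1 (h i)).2, le_ciSup hf i]

/-- The supremum defining a `C²`-transform: bounds. -/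
lemma iSup_div_mem {ι : Type*} {δ : ℝ} (hδ : 0 < δ) {c a : ι → ℝ} (hc0 : ∀ i, 0 ≤ c i)
    (hc1 : ∀ i, c i ≤ 1) (ha : ∀ i, δ ≤ a i) :
    BddAbove (Set.range fun i => c i / a i) ∧ 0 ≤ ⨆ i, c i / a i ∧ ⨆ i, c i / a i ≤ δ⁻¹ := by
  have hle : ∀ i, c i / a i ≤ δ⁻¹ := fun i => by
    rw [inv_eq_one_div]; exact div_le_div₀ zero_le_one (hc1 i) hδ (ha i)
  refine ⟨⟨δ⁻¹, by rintro _ ⟨i, rfl⟩; exact hle i⟩, Real.iSup_nonneg fun i =>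
    div_nonneg (hc0 i) (hδ.le.trans (ha i)), Real.iSup_le hle (by positivity)⟩

lemma abs_div_sub_div_le {δ c c' a b : ℝ} (hδ : 0 < δ) (ha : δ ≤ a) (h : |c - c'| ≤ b) :
    |c / a - c' / a| ≤ b / δ := by
  rw [← sub_div, abs_div, abs_of_pos (hδ.trans_le ha)]
  exact div_le_div₀ ((abs_nonneg _).trans h) h hδ ha

/-- Regularised dual potentials. -/
lemma IsKernel.exists_potentials (hC : IsKernel C Λ) {X₀ X₁ : Set X} {s₀ s₁ : X → ℝ}
    (h0 : ∀ x, 0 ≤ s₀ x) (h1 : ∀ x, 0 ≤ s₁ x)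
    (h : ∀ x ∈ X₀, ∀ y ∈ X₁, C (x, y) ^ 2 ≤ s₀ x * s₁ y) {δ : ℝ} (hδ : 0 < δ) :
    ∃ S₀ S₁ : X → ℝ, (∀ x, δ ≤ S₀ x) ∧ (∀ x, δ ≤ S₁ x) ∧ (∀ x, S₀ x ≤ δ⁻¹ + δ) ∧
      (∀ x, S₁ x ≤ δ⁻¹ + δ) ∧ (∀ x y, |S₀ x - S₀ y| ≤ 2 * Λ / δ * dist x y) ∧
      (∀ x y, |S₁ x - S₁ y| ≤ 2 * Λ / δ * dist x y) ∧ (∀ x y, C (x, y) ^ 2 ≤ S₀ x * S₁ y) ∧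
      (∀ x ∈ X₀, S₀ x ≤ s₀ x + δ) ∧ ∀ x ∈ X₁, S₁ x ≤ s₁ x + 2 * δ := by
  have hΛ := hC.const_nonneg
  have hs1 : ∀ y : X₁, δ ≤ s₁ y + δ := fun y => by linarith [h1 y]
  set T₀ : X → ℝ := fun x => ⨆ y : X₁, C (x, y) ^ 2 / (s₁ y + δ) with hT0
  have b0 : ∀ x, BddAbove (Set.range fun y : X₁ => C (x, y) ^ 2 / (s₁ y + δ)) ∧ 0 ≤ T₀ x ∧
      T₀ x ≤ δ⁻¹ := fun x => iSup_div_mem hδ (fun _ => sq_nonneg _) (fun _ => hC.sq_le_one _) hs1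
  have hS0 : ∀ x, δ ≤ T₀ x + δ := fun x => by linarith [(b0 x).2.1]
  set T₁ : X → ℝ := fun y => ⨆ x : X, C (x, y) ^ 2 / (T₀ x + δ) with hT1
  have b1 : ∀ y, BddAbove (Set.range fun x : X => C (x, y) ^ 2 / (T₀ x + δ)) ∧ 0 ≤ T₁ y ∧
      T₁ y ≤ δ⁻¹ := fun y => iSup_div_mem hδ (fun _ => sq_nonneg _) (fun _ => hC.sq_le_one _) hS0
  refine ⟨fun x => T₀ x + δ, fun y => T₁ y + δ, hS0, fun y => by linarith [(b1 y).2.1],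
    fun x => by linarith [(b0 x).2.2], fun x => by linarith [(b1 x).2.2], fun x x' => ?_,
    fun y y' => ?_, fun x y => ?_, fun x hx => ?_, fun y hy => ?_⟩
  · rw [add_sub_add_right_eq_sub]
    refine abs_iSup_sub_iSup_le (by positivity) (b0 x).1 (b0 x').1 fun y => ?_
    refine (abs_div_sub_div_le hδ (hs1 y) (hC.abs_sq_sub_le _ _ _ _)).trans (le_of_eq ?_)
    rw [dist_self, add_zero, div_mul_eq_mul_div]
  · rw [add_sub_add_right_eq_sub]
    refine abs_iSup_sub_iSup_le (by positivity) (b1 y).1 (b1 y').1 fun x => ?_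
    refine (abs_div_sub_div_le hδ (hS0 x) (hC.abs_sq_sub_le _ _ _ _)).trans (le_of_eq ?_)
    rw [dist_self, zero_add, div_mul_eq_mul_div]
  · have := le_ciSup (b1 y).1 x
    have hp : 0 < T₀ x + δ := hδ.trans_le (hS0 x)
    rw [div_le_iff₀ hp] at this
    change C (x, y) ^ 2 ≤ T₁ y * (T₀ x + δ) at this
    nlinarith
  · refine (add_le_add_iff_right δ).2 (Real.iSup_le (fun y => ?_) (h0 x))
    rw [div_le_iff₀ (hδ.trans_le (hs1 y))]
    nlinarith [h x hx y y.2, h0 x]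
  · have : T₁ y ≤ s₁ y + δ := by
      refine Real.iSup_le (fun x => ?_) (by linarith [h1 y])
      rw [div_le_iff₀ (hδ.trans_le (hS0 x))]
      have := le_ciSup (b0 x).1 ⟨y, hy⟩
      have hp : 0 < s₁ y + δ := hδ.trans_le (hs1 ⟨y, hy⟩)
      rw [div_le_iff₀ hp] at this
      change C (x, y) ^ 2 ≤ T₀ x * (s₁ y + δ) at this
      nlinarith
    change T₁ y + δ ≤ _
    linarith

variable [MeasurableSpace X] [BorelSpace X] [SecondCountableTopology X]
  {π : Measure (X × X)} {μ₀ μ₁ : Measure X}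

lemma exists_full_sets [IsFiniteMeasure μ₀] [IsFiniteMeasure μ₁] (hC : Continuous C)
    {s₀ s₁ : X → ℝ} (m0 : Measurable s₀) (m1 : Measurable s₁)
    (h : ∀ᵐ p ∂(μ₀.prod μ₁), C p ^ 2 ≤ s₀ p.1 * s₁ p.2) :
    ∃ X₀ X₁ : Set X, (∀ᵐ x ∂μ₀, x ∈ X₀) ∧ (∀ᵐ x ∂μ₁, x ∈ X₁) ∧
      ∀ x ∈ X₀, ∀ y ∈ X₁, C (x, y) ^ 2 ≤ s₀ x * s₁ y := by
  have g0 : Measurable fun x => (x, s₀ x) := measurable_id.prodMk m0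
  have g1 : Measurable fun x => (x, s₁ x) := measurable_id.prodMk m1
  refine ⟨{x | (x, s₀ x) ∈ (μ₀.map fun x => (x, s₀ x)).support},
    {x | (x, s₁ x) ∈ (μ₁.map fun x => (x, s₁ x)).support},
    ae_of_ae_map g0.aemeasurable Measure.support_mem_ae,
    ae_of_ae_map g1.aemeasurable Measure.support_mem_ae, fun x hx y hy => ?_⟩
  by_contra hcon
  push Not at hcon
  have hopen : IsOpen {q : (X × ℝ) × (X × ℝ) | q.1.2 * q.2.2 < C (q.1.1, q.2.1) ^ 2} :=
    isOpen_lt (by fun_prop) (by fun_prop)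
  obtain ⟨U, V, hU, hxU, hV, hyV, hUV⟩ :
      ∃ U V, IsOpen U ∧ (x, s₀ x) ∈ U ∧ IsOpen V ∧ (y, s₁ y) ∈ V ∧
        U ×ˢ V ⊆ {q : (X × ℝ) × (X × ℝ) | q.1.2 * q.2.2 < C (q.1.1, q.2.1) ^ 2} := by
    obtain ⟨U, V, hU, hV, hxU, hyV, hs⟩ := isOpen_prod_iff.1 hopen (x, s₀ x) (y, s₁ y) hcon
    exact ⟨U, V, hU, hxU, hV, hyV, hs⟩
  have p0 := (Measure.mem_support_iff_forall _).1 hx U (hU.mem_nhds hxU)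
  have p1 := (Measure.mem_support_iff_forall _).1 hy V (hV.mem_nhds hyV)
  rw [Measure.map_apply g0 hU.measurableSet] at p0
  rw [Measure.map_apply g1 hV.measurableSet] at p1
  have : μ₀.prod μ₁ (((fun x => (x, s₀ x)) ⁻¹' U) ×ˢ ((fun x => (x, s₁ x)) ⁻¹' V)) = 0 := by
    refine measure_mono_null (fun p hp => ?_) h
    have : s₀ p.1 * s₁ p.2 < C p ^ 2 := @hUV ((p.1, s₀ p.1), (p.2, s₁ p.2)) hp
    exact not_le.2 this
  rw [Measure.prod_prod] at this
  exact (ENNReal.mul_pos p0.ne' p1.ne').ne' this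

/-- Near-optimal, uniformly regular potentials attached to an optimal plan. -/
lemma IsOpt.exists_potentials [IsFiniteMeasure π] [IsFiniteMeasure μ₀] [IsFiniteMeasure μ₁]
    (h : IsOpt C π μ₀ μ₁) (hC : IsKernel C Λ) {δ : ℝ} (hδ : 0 < δ) :
    ∃ S₀ S₁ : X → ℝ, (∀ x, δ ≤ S₀ x) ∧ (∀ x, δ ≤ S₁ x) ∧ (∀ x, S₀ x ≤ δ⁻¹ + δ) ∧
      (∀ x, S₁ x ≤ δ⁻¹ + δ) ∧ (∀ x y, |S₀ x - S₀ y| ≤ 2 * Λ / δ * dist x y) ∧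
      (∀ x y, |S₁ x - S₁ y| ≤ 2 * Λ / δ * dist x y) ∧ (∀ x y, C (x, y) ^ 2 ≤ S₀ x * S₁ y) ∧
      ∫ x, S₀ x ∂μ₀ + ∫ x, S₁ x ∂μ₁ ≤
        2 * π.real Set.univ + 2 * δ * (μ₀.real Set.univ + μ₁.real Set.univ) := by
  obtain ⟨X₀, X₁, hX0, hX1, hX⟩ := exists_full_sets hC.continuous (measurable_dens π.fst μ₀)
    (measurable_dens π.snd μ₁) (h.le_mul_dens hC.continuous.measurable hC.nonneg hC.le_one)
  obtain ⟨S₀, S₁, a0, a1, b0, b1, l0, l1, hS, c0, c1⟩ := hC.exists_potentials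
    (dens_nonneg π.fst μ₀) (dens_nonneg π.snd μ₁) hX hδ
  refine ⟨S₀, S₁, a0, a1, b0, b1, l0, l1, hS, ?_⟩
  have key : ∀ (ρ μ : Measure X) (S : X → ℝ) (e : ℝ) [IsFiniteMeasure ρ] [IsFiniteMeasure μ],
      ρ ≪ μ → Continuous S → (∀ x, δ ≤ S x) → (∀ x, S x ≤ δ⁻¹ + δ) →
      (∀ᵐ x ∂μ, S x ≤ dens ρ μ x + e) →
      ∫ x, S x ∂μ ≤ ρ.real Set.univ + e * μ.real Set.univ := by
    intro ρ μ S e _ _ hac hSc hS1 hS2 hle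
    have hI : Integrable S μ := Integrable.of_bound hSc.measurable.aestronglyMeasurable (δ⁻¹ + δ)
      (ae_of_all _ fun x => by
        rw [Real.norm_eq_abs, abs_of_nonneg (hδ.le.trans (hS1 x))]; exact hS2 x)
    have hd : Integrable (dens ρ μ) μ := Measure.integrable_toReal_rnDeriv
    calc ∫ x, S x ∂μ ≤ ∫ x, (dens ρ μ x + e) ∂μ :=
          integral_mono_ae hI (hd.add (integrable_const _)) hle
      _ = _ := by
          rw [integral_add hd (integrable_const _), integral_const, smul_eq_mul, mul_comm]
          congr 1
          exact Measure.integral_toReal_rnDeriv hac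
  have k0 := key π.fst μ₀ S₀ δ h.ac₀ (continuous_of_abs_le l0) a0 b0
    (hX0.mono fun x hx => c0 x hx)
  have k1 := key π.snd μ₁ S₁ (2 * δ) h.ac₁ (continuous_of_abs_le l1) a1 b1
    (hX1.mono fun x hx => c1 x hx)
  rw [fst_real_univ] at k0
  rw [snd_real_univ] at k1
  have : 0 ≤ δ * μ₀.real Set.univ := by positivity
  linarith

end Potentials

section Limits

variable {ι X : Type*} [MetricSpace X]

lemma exists_ultrafilter_limit (𝒰 : Ultrafilter ι) {f : ι → X → ℝ} {L B : ℝ} (hL : 0 ≤ L)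
    (hB : ∀ i x, |f i x| ≤ B) (hf : ∀ i x y, |f i x - f i y| ≤ L * dist x y) :
    ∃ g : X → ℝ, (∀ x y, |g x - g y| ≤ L * dist x y) ∧
      (∀ x, Tendsto (fun i => f i x) 𝒰 (𝓝 (g x))) ∧
      ∀ K : Set X, IsCompact K → ∀ ε > 0, ∀ᶠ i in (𝒰 : Filter ι), ∀ x ∈ K, |f i x - g x| ≤ ε := by
  have hlim : ∀ x, ∃ a, Tendsto (fun i => f i x) 𝒰 (𝓝 a) := fun x => by
    obtain ⟨a, -, ha⟩ := (isCompact_Icc (a := -B) (b := B)).ultrafilter_le_nhds'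
      (𝒰.map fun i => f i x)
      (Filter.Eventually.of_forall (f := (𝒰 : Filter ι)) fun i => abs_le.1 (hB i x))
    exact ⟨a, ha⟩
  choose g hg using hlim
  have hgL : ∀ x y, |g x - g y| ≤ L * dist x y := fun x y =>
    le_of_tendsto ((hg x).sub (hg y)).abs (Filter.Eventually.of_forall fun i => hf i x y)
  refine ⟨g, hgL, hg, fun K hK ε hε => ?_⟩
  have hr : 0 < ε / (3 * (L + 1)) := by positivity
  obtain ⟨t, -, htfin, ht⟩ := Metric.finite_approx_of_totallyBounded hK.totallyBounded _ hr
  have hev : ∀ᶠ i in (𝒰 : Filter ι), ∀ y ∈ t, |f i y - g y| < ε / 3 :=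
    (Filter.eventually_all_finite htfin).2 fun y _ => by
      have := (hg y).eventually (Metric.ball_mem_nhds (g y) (by positivity : 0 < ε / 3))
      simpa [Real.dist_eq] using this
  filter_upwards [hev] with i hi x hx
  obtain ⟨y, hy, hxy⟩ := Set.mem_iUnion₂.1 (ht hx)
  have hd : L * dist x y ≤ ε / 3 := by
    have h1 : dist x y ≤ ε / (3 * (L + 1)) := (Metric.mem_ball.1 hxy).le
    calc L * dist x y ≤ (L + 1) * (ε / (3 * (L + 1))) := by gcongr; linarith
      _ = ε / 3 := by field_simp
  have h1 := hf i x y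
  have h2 := hi y hy
  have h3 := hgL y x
  rw [dist_comm] at h3
  calc |f i x - g x| = |(f i x - f i y) + (f i y - g y) + (g y - g x)| := by ring_nf
    _ ≤ |f i x - f i y| + |f i y - g y| + |g y - g x| := abs_add_three _ _ _
    _ ≤ ε := by linarith

variable {Y : Type*} [MeasurableSpace Y]

lemma integrable_bdd (μ : Measure Y) [IsFiniteMeasure μ] {f : Y → ℝ} (hf : Measurable f) {B : ℝ}
    (hB : ∀ x, |f x| ≤ B) : Integrable f μ :=
  Integrable.of_bound hf.aestronglyMeasurable B (ae_of_all _ hB)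

variable [TopologicalSpace Y] [OpensMeasurableSpace Y]
  {l : Filter ι} {m : ι → FiniteMeasure Y} {m' : FiniteMeasure Y}

lemma tendsto_integral_bdd (h : Tendsto m l (𝓝 m')) {f : Y → ℝ} (hf : Continuous f) {B : ℝ}
    (hB : ∀ x, |f x| ≤ B) :
    Tendsto (fun i => ∫ x, f x ∂(m i : Measure Y)) l (𝓝 (∫ x, f x ∂(m' : Measure Y))) :=
  FiniteMeasure.tendsto_iff_forall_integral_tendsto.1 h
    (BoundedContinuousFunction.ofNormedAddCommGroup f hf B hB)

lemma tendsto_real_univ (h : Tendsto m l (𝓝 m')) :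
    Tendsto (fun i => (m i : Measure Y).real Set.univ) l (𝓝 ((m' : Measure Y).real Set.univ)) := by
  simpa using tendsto_integral_bdd h (f := fun _ => 1) continuous_const (B := 1) (by simp)

/-- Integrals converge when both the measures and, locally uniformly, the integrands do. -/
lemma tendsto_integral_of_unif (h : Tendsto m l (𝓝 m')) {K : Set Y}
    (hK : ∀ i, ∀ᵐ x ∂(m i : Measure Y), x ∈ K) {f : ι → Y → ℝ} {g : Y → ℝ}
    (hf : ∀ i, Continuous (f i)) (hg : Continuous g) {B : ℝ} (hfB : ∀ i x, |f i x| ≤ B)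
    (hgB : ∀ x, |g x| ≤ B)
    (hfg : ∀ ε > 0, ∀ᶠ i in l, ∀ x ∈ K, |f i x - g x| ≤ ε) :
    Tendsto (fun i => ∫ x, f i x ∂(m i : Measure Y)) l (𝓝 (∫ x, g x ∂(m' : Measure Y))) := by
  have h1 := tendsto_integral_bdd h hg hgB
  suffices Tendsto (fun i => ∫ x, f i x ∂(m i : Measure Y) - ∫ x, g x ∂(m i : Measure Y)) l (𝓝 0) by
    simpa using this.add h1
  rw [Metric.tendsto_nhds]
  intro ε hε
  set M := (m' : Measure Y).real Set.univ + 1 with hM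
  have hM0 : 0 < M := by positivity
  have hmass : ∀ᶠ i in l, (m i : Measure Y).real Set.univ < M :=
    (tendsto_real_univ h).eventually_lt_const (by simp [hM])
  filter_upwards [hmass, hfg (ε / (2 * M)) (by positivity)] with i hi1 hi2
  rw [dist_zero_right, ← integral_sub (integrable_bdd _ (hf i).measurable (hfB i))
    (integrable_bdd _ hg.measurable hgB)]
  calc ‖∫ x, (f i x - g x) ∂(m i : Measure Y)‖
      ≤ ε / (2 * M) * (m i : Measure Y).real Set.univ :=
        norm_integral_le_of_norm_le_const ((hK i).mono fun x hx => hi2 x hx)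
    _ ≤ ε / (2 * M) * M := by gcongr
    _ = ε / 2 := by field_simp
    _ < ε := by linarith

/-- Closed constraints pass to the limit. -/
lemma ae_nonneg_of_tendsto [l.NeBot] (h : Tendsto m l (𝓝 m')) {K : Set Y}
    (hK : ∀ i, ∀ᵐ x ∂(m i : Measure Y), x ∈ K) {G : ι → Y → ℝ} {g : Y → ℝ} (hg : Continuous g)
    (hGg : ∀ ε > 0, ∀ᶠ i in l, ∀ x ∈ K, |G i x - g x| ≤ ε)
    (hG : ∀ i, ∀ᵐ x ∂(m i : Measure Y), 0 ≤ G i x) :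
    ∀ᵐ x ∂(m' : Measure Y), 0 ≤ g x := by
  set φ : Y → ℝ := fun x => min 1 (max 0 (-g x)) with hφ
  have hφc : Continuous φ := by fun_prop
  have hφ0 : ∀ x, 0 ≤ φ x := fun x => by simp [hφ]
  have hφ1 : ∀ x, |φ x| ≤ 1 := fun x => by rw [abs_of_nonneg (hφ0 x)]; simp [hφ]
  have hlim := tendsto_integral_bdd h hφc hφ1
  have hle : ∫ x, φ x ∂(m' : Measure Y) ≤ 0 := by
    refine le_of_forall_pos_le_add fun ε hε => ?_
    rw [zero_add]
    set M := (m' : Measure Y).real Set.univ + 1 with hM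
    have hM0 : 0 < M := by positivity
    have hmass : ∀ᶠ i in l, (m i : Measure Y).real Set.univ < M :=
      (tendsto_real_univ h).eventually_lt_const (by simp [hM])
    refine le_of_tendsto hlim ?_
    filter_upwards [hmass, hGg (ε / M) (by positivity)] with i hi1 hi2
    calc ∫ x, φ x ∂(m i : Measure Y) ≤ ∫ _, ε / M ∂(m i : Measure Y) := by
          refine integral_mono_ae (integrable_bdd _ hφc.measurable hφ1) (integrable_const _) ?_
          filter_upwards [hK i, hG i] with x hx1 hx2
          have := (abs_le.1 (hi2 x hx1)).2
          exact (min_le_right _ _).trans (max_le (by positivity) (by linarith))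
      _ = (m i : Measure Y).real Set.univ * (ε / M) := by simp
      _ ≤ M * (ε / M) := by gcongr
      _ = ε := by field_simp
  have hz := (integral_eq_zero_iff_of_nonneg hφ0 (integrable_bdd _ hφc.measurable hφ1)).1
    (le_antisymm hle (integral_nonneg hφ0))
  filter_upwards [hz] with x hx
  by_contra hcon
  push Not at hcon
  have : 0 < φ x := lt_min one_pos (lt_max_of_lt_right (by linarith))
  exact this.ne' hx

end Limits

section AbsCont

variable {X : Type*} [TopologicalSpace X] [HasOuterApproxClosed X] [MeasurableSpace X]
  [BorelSpace X] {ρ μ : Measure X} [IsFiniteMeasure ρ] [IsFiniteMeasure μ] [ρ.WeaklyRegular]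

lemma absolutelyContinuous_of_lintegral_le {M : ℝ≥0∞} (hM : M ≠ ⊤)
    (h : ∀ f : BoundedContinuousFunction X NNReal, (∀ x, f x ≤ 1) → ∀ t : ℝ, 0 < t →
      ∫⁻ x, f x ∂ρ ≤ ENNReal.ofReal t * ∫⁻ x, f x ∂μ + ENNReal.ofReal t⁻¹ * M) : ρ ≪ μ := by
  have hcl : ∀ F : Set X, IsClosed F → ∀ t : ℝ, 0 < t →
      ρ F ≤ ENNReal.ofReal t * μ F + ENNReal.ofReal t⁻¹ * M := fun F hF t ht =>
    le_of_tendsto_of_tendsto' (HasOuterApproxClosed.tendsto_lintegral_apprSeq hF ρ)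
      ((ENNReal.Tendsto.const_mul (HasOuterApproxClosed.tendsto_lintegral_apprSeq hF μ)
        (Or.inr ofReal_ne_top)).add tendsto_const_nhds)
      fun n => h (hF.apprSeq n) (HasOuterApproxClosed.apprSeq_apply_le_one hF n) t ht
  refine Measure.AbsolutelyContinuous.mk fun s hs hμs => ?_
  by_contra hne
  obtain ⟨F, hFs, hF, hpos⟩ := hs.exists_lt_isClosed_of_ne_top (measure_ne_top ρ s)
    (pos_iff_ne_zero.2 hne)
  have hμF : μ F = 0 := measure_mono_null hFs hμs
  have hlim : Tendsto (fun t : ℝ => ENNReal.ofReal t⁻¹ * M) atTop (𝓝 0) := by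
    have := ENNReal.Tendsto.mul_const (ENNReal.tendsto_ofReal tendsto_inv_atTop_zero)
      (b := M) (Or.inr hM)
    simpa using this
  have : ρ F ≤ 0 := ge_of_tendsto hlim <| (eventually_gt_atTop 0).mono fun t ht => by
    simpa [hμF] using hcl F hF t ht
  exact hpos.not_ge this

end AbsCont

section Truncation

variable {Y : Type*} {C : Y → ℝ}

/-- Truncated logarithmic cost. -/
noncomputable def truncCost (C : Y → ℝ) (k : ℕ) (p : Y) : ℝ :=
  -Real.log (max (C p) (Real.exp (-k)))

lemma continuous_truncCost [TopologicalSpace Y] (hC : Continuous C) (k : ℕ) :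
    Continuous (truncCost C k) :=
  (Continuous.log (hC.max continuous_const) fun p =>
    (lt_max_of_lt_right (Real.exp_pos _)).ne').neg

lemma truncCost_nonneg (hC : ∀ p, C p ≤ 1) (k : ℕ) (p : Y) : 0 ≤ truncCost C k p := by
  rw [truncCost, neg_nonneg]
  refine Real.log_nonpos (le_max_of_le_right (Real.exp_pos _).le) (max_le (hC p) ?_)
  rw [Real.exp_le_one_iff]; simp

lemma truncCost_le (k : ℕ) (p : Y) : truncCost C k p ≤ k := by
  have h := Real.log_le_log (Real.exp_pos (-(k : ℝ))) (le_max_right (C p) (Real.exp (-(k : ℝ))))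
  rw [Real.log_exp] at h
  exact neg_le.1 h

lemma abs_truncCost_le (hC : ∀ p, C p ≤ 1) (k : ℕ) (p : Y) : |truncCost C k p| ≤ k := by
  rw [abs_of_nonneg (truncCost_nonneg hC k p)]; exact truncCost_le k p

lemma truncCost_le_neg_log {p : Y} (hp : 0 < C p) (k : ℕ) :
    truncCost C k p ≤ -Real.log (C p) :=
  neg_le_neg (Real.log_le_log hp (le_max_left _ _))

lemma eventually_truncCost_eq {p : Y} (hp : 0 < C p) :
    ∀ᶠ k : ℕ in atTop, truncCost C k p = -Real.log (C p) := by
  obtain ⟨k₀, hk₀⟩ := exists_nat_gt (-Real.log (C p))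
  filter_upwards [eventually_ge_atTop k₀] with k hk
  have : Real.exp (-k) ≤ C p := by
    rw [← Real.le_log_iff_exp_le hp]
    have : (k₀ : ℝ) ≤ k := by exact_mod_cast hk
    linarith
  rw [truncCost, max_eq_left this]

lemma integrable_log_of_truncCost_le [MeasurableSpace Y] {π : Measure Y} [IsFiniteMeasure π]
    (hm : Measurable C) (hC : ∀ p, C p ≤ 1) (hpos : ∀ᵐ p ∂π, 0 < C p) {b : ℝ}
    (hb : ∀ k : ℕ, ∫ p, truncCost C k p ∂π ≤ b) :
    Integrable (fun p => Real.log (C p)) π ∧ -∫ p, Real.log (C p) ∂π ≤ b := by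
  have hmk : ∀ k, Measurable (truncCost C k) := fun k => (hm.max measurable_const).log.neg
  have hnn : 0 ≤ᵐ[π] fun p => -Real.log (C p) := by
    filter_upwards [hpos] with p hp
    exact neg_nonneg.2 (Real.log_nonpos hp.le (hC p))
  have hb0 : 0 ≤ b := (integral_nonneg (truncCost_nonneg hC 0)).trans (hb 0)
  have hlim : ∫⁻ p, ENNReal.ofReal (-Real.log (C p)) ∂π ≤ ENNReal.ofReal b := by
    calc ∫⁻ p, ENNReal.ofReal (-Real.log (C p)) ∂π
        = ∫⁻ p, liminf (fun k : ℕ => ENNReal.ofReal (truncCost C k p)) atTop ∂π := by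
          refine lintegral_congr_ae ?_
          filter_upwards [hpos] with p hp
          refine (Tendsto.liminf_eq ?_).symm
          exact tendsto_const_nhds.congr' ((eventually_truncCost_eq hp).mono fun k hk => by
            simp only [hk])
      _ ≤ liminf (fun k : ℕ => ∫⁻ p, ENNReal.ofReal (truncCost C k p) ∂π) atTop :=
          lintegral_liminf_le fun k => (hmk k).ennreal_ofReal
      _ ≤ ENNReal.ofReal b := by
          refine liminf_le_of_frequently_le' (Frequently.of_forall fun k => ?_)
          rw [← ofReal_integral_eq_lintegral_ofReal (integrable_bdd π (hmk k) (abs_truncCost_le hC k))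
            (ae_of_all _ (truncCost_nonneg hC k))]
          exact ofReal_le_ofReal (hb k)
  have hlogC : Integrable (fun p => -Real.log (C p)) π :=
    (lintegral_ofReal_ne_top_iff_integrable hm.log.neg.aestronglyMeasurable hnn).1
      (hlim.trans_lt ofReal_lt_top).ne
  refine ⟨by simpa using hlogC.neg, ?_⟩
  rw [← integral_neg, integral_eq_lintegral_of_nonneg_ae hnn hm.log.neg.aestronglyMeasurable]
  exact toReal_le_of_le_ofReal hb0 hlim

end Truncation

section Stability

variable {ι X : Type*} [MetricSpace X] [MeasurableSpace X] [BorelSpace X]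
  [SecondCountableTopology X] {C : X × X → ℝ} {Λ : ℝ}
  {π : ι → FiniteMeasure (X × X)} {m₀ m₁ : ι → FiniteMeasure X}
  {π' : FiniteMeasure (X × X)} {μ₀ μ₁ : FiniteMeasure X}

/-- The Gibbs functional. -/
noncomputable def gibbs (ρ μ : Measure X) (φ : X → ℝ) : ℝ :=
  ∫ x, φ x ∂ρ - ∫ x, (Real.exp (φ x) - 1) ∂μ

lemma tendsto_gibbs {l : Filter ι} {ρ m : ι → FiniteMeasure X} {ρ' μ : FiniteMeasure X}
    (hρ : Tendsto ρ l (𝓝 ρ')) (hm : Tendsto m l (𝓝 μ)) (φ : BoundedContinuousFunction X ℝ) :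
    Tendsto (fun i => gibbs (ρ i) (m i) φ) l (𝓝 (gibbs ρ' μ φ)) := by
  refine (tendsto_integral_bdd hρ φ.continuous (B := ‖φ‖) φ.norm_coe_le_norm).sub
    (tendsto_integral_bdd hm (by fun_prop) (B := Real.exp ‖φ‖ + 1) fun x => ?_)
  have h1 : Real.exp (φ x) ≤ Real.exp ‖φ‖ :=
    Real.exp_le_exp.2 ((le_abs_self _).trans (φ.norm_coe_le_norm x))
  have h2 := Real.exp_pos (φ x)
  rw [abs_le]
  constructor <;> linarith

lemma tendsto_fst {l : Filter ι} (h : Tendsto π l (𝓝 π')) :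
    Tendsto (fun i => (π i).map Prod.fst) l (𝓝 (π'.map Prod.fst)) :=
  FiniteMeasure.tendsto_map_of_tendsto_of_continuous _ _ h continuous_fst

lemma tendsto_snd {l : Filter ι} (h : Tendsto π l (𝓝 π')) :
    Tendsto (fun i => (π i).map Prod.snd) l (𝓝 (π'.map Prod.snd)) :=
  FiniteMeasure.tendsto_map_of_tendsto_of_continuous _ _ h continuous_snd

/-- Lower semicontinuity of the energy along optimal plans. -/
lemma adm_of_tendsto {l : Filter ι} [l.NeBot] (hC : IsKernel C Λ)
    (hπ : Tendsto π l (𝓝 π')) (h0 : Tendsto m₀ l (𝓝 μ₀)) (h1 : Tendsto m₁ l (𝓝 μ₁))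
    (hopt : ∀ i, IsOpt C (π i : Measure (X × X)) (m₀ i) (m₁ i))
    (hpos : ∀ᵐ p ∂(π' : Measure (X × X)), 0 < C p)
    (hac0 : (π' : Measure (X × X)).fst ≪ μ₀) (hac1 : (π' : Measure (X × X)).snd ≪ μ₁) :
    Adm C (π' : Measure (X × X)) μ₀ μ₁ ∧ energy C π' μ₀ μ₁ ≤
      (μ₀ : Measure X).real Set.univ + (μ₁ : Measure X).real Set.univ
        - 2 * (π' : Measure (X × X)).real Set.univ := by
  set E := (μ₀ : Measure X).real Set.univ + (μ₁ : Measure X).real Set.univ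
        - 2 * (π' : Measure (X × X)).real Set.univ with hE
  have hcont := hC.continuous
  have key : ∀ (k : ℕ) (φ₀ φ₁ : BoundedContinuousFunction X ℝ),
      2 * ∫ p, truncCost C k p ∂(π' : Measure (X × X)) +
        gibbs (π' : Measure (X × X)).fst μ₀ φ₀ + gibbs (π' : Measure (X × X)).snd μ₁ φ₁ ≤ E := by
    intro k φ₀ φ₁
    refine le_of_tendsto_of_tendsto' ((((tendsto_integral_bdd hπ (continuous_truncCost hcont k)
      (abs_truncCost_le hC.le_one k)).const_mul 2).add (tendsto_gibbs (tendsto_fst hπ) h0 φ₀)).add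
      (tendsto_gibbs (tendsto_snd hπ) h1 φ₁))
      (((tendsto_real_univ h0).add (tendsto_real_univ h1)).sub
        ((tendsto_real_univ hπ).const_mul 2)) fun i => ?_
    have ho := hopt i
    have e := ho.energy_le hcont.measurable
    have g0 := integral_sub_le_klDiv ho.kl₀ φ₀.continuous.measurable (B := ‖φ₀‖)
      φ₀.norm_coe_le_norm
    have g1 := integral_sub_le_klDiv ho.kl₁ φ₁.continuous.measurable (B := ‖φ₁‖)
      φ₁.norm_coe_le_norm
    have hc : ∫ p, truncCost C k p ∂(π i : Measure (X × X)) ≤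
        ∫ p, -Real.log (C p) ∂(π i : Measure (X × X)) :=
      integral_mono_ae (integrable_bdd _ (continuous_truncCost hcont k).measurable
        (abs_truncCost_le hC.le_one k)) ho.int.neg
        (ho.pos.mono fun p hp => truncCost_le_neg_log hp k)
    rw [integral_neg] at hc
    change 2 * _ + gibbs (π i : Measure (X × X)).fst (m₀ i) φ₀ +
      gibbs (π i : Measure (X × X)).snd (m₁ i) φ₁ ≤ _
    rw [energy] at e
    unfold gibbs
    linarith
  have g_zero : ∀ ρ μ : Measure X, gibbs ρ μ (0 : BoundedContinuousFunction X ℝ) = 0 := by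
    intro ρ μ; simp [gibbs]
  have hk0 : ∀ (k : ℕ) (φ₁ : BoundedContinuousFunction X ℝ),
      klDiv (π' : Measure (X × X)).fst μ₀ ≠ ⊤ ∧ (klDiv (π' : Measure (X × X)).fst μ₀).toReal ≤
        E - 2 * ∫ p, truncCost C k p ∂(π' : Measure (X × X))
          - gibbs (π' : Measure (X × X)).snd μ₁ φ₁ := fun k φ₁ =>
    klDiv_le_of_gibbs hac0 fun φ₀ => by
      have := key k φ₀ φ₁
      change gibbs _ _ φ₀ ≤ _
      linarith
  have hk1 : ∀ k : ℕ, klDiv (π' : Measure (X × X)).snd μ₁ ≠ ⊤ ∧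
      (klDiv (π' : Measure (X × X)).snd μ₁).toReal ≤
        E - 2 * ∫ p, truncCost C k p ∂(π' : Measure (X × X))
          - (klDiv (π' : Measure (X × X)).fst μ₀).toReal := fun k =>
    klDiv_le_of_gibbs hac1 fun φ₁ => by
      have := (hk0 k φ₁).2
      change gibbs _ _ φ₁ ≤ _
      linarith
  have hlogC := integrable_log_of_truncCost_le hcont.measurable hC.le_one hpos
    (b := (E - (klDiv (π' : Measure (X × X)).fst μ₀).toReal
      - (klDiv (π' : Measure (X × X)).snd μ₁).toReal) / 2) fun k => by
      have := (hk1 k).2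
      linarith
  refine ⟨⟨hpos, hlogC.1, (hk0 0 0).1, (hk1 0).1⟩, ?_⟩
  rw [energy]
  linarith [hlogC.2]

/-- Limits of optimal plans inherit the dual lower bound. -/
lemma le_energy_of_tendsto {𝒰 : Ultrafilter ι} (hC : IsKernel C Λ) {K : Set X} (hK : IsCompact K)
    (hK0 : ∀ i, ∀ᵐ x ∂(m₀ i : Measure X), x ∈ K) (hK1 : ∀ i, ∀ᵐ x ∂(m₁ i : Measure X), x ∈ K)
    (hπ : Tendsto π 𝒰 (𝓝 π')) (h0 : Tendsto m₀ 𝒰 (𝓝 μ₀)) (h1 : Tendsto m₁ 𝒰 (𝓝 μ₁))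
    (hopt : ∀ i, IsOpt C (π i : Measure (X × X)) (m₀ i) (m₁ i))
    {η : Measure (X × X)} [IsFiniteMeasure η] (hη : Adm C η μ₀ μ₁) :
    (μ₀ : Measure X).real Set.univ + (μ₁ : Measure X).real Set.univ
        - 2 * (π' : Measure (X × X)).real Set.univ ≤ energy C η μ₀ μ₁ := by
  set A := (μ₀ : Measure X).real Set.univ + (μ₁ : Measure X).real Set.univ with hA
  have hA0 : 0 ≤ A := by positivity
  suffices H : ∀ δ : ℝ, 0 < δ → A - 2 * (π' : Measure (X × X)).real Set.univ ≤
      energy C η μ₀ μ₁ + 2 * δ * A by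
    refine le_of_forall_pos_le_add fun ε hε => (H (ε / (2 * (A + 1))) (by positivity)).trans ?_
    gcongr
    rw [show 2 * (ε / (2 * (A + 1))) * A = ε * (A / (A + 1)) by field_simp]
    exact mul_le_of_le_one_right hε.le (by rw [div_le_one (by positivity)]; linarith)
  intro δ hδ
  choose S₀ S₁ a0 a1 b0 b1 l0 l1 hS hlogC using fun i => (hopt i).exists_potentials hC hδ
  have hL : 0 ≤ 2 * Λ / δ := by have := hC.const_nonneg; positivity
  have ab0 : ∀ i x, |S₀ i x| ≤ δ⁻¹ + δ := fun i x => by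
    rw [abs_of_nonneg (hδ.le.trans (a0 i x))]; exact b0 i x
  have ab1 : ∀ i x, |S₁ i x| ≤ δ⁻¹ + δ := fun i x => by
    rw [abs_of_nonneg (hδ.le.trans (a1 i x))]; exact b1 i x
  obtain ⟨T₀, tl0, tp0, tu0⟩ := exists_ultrafilter_limit 𝒰 hL ab0 l0
  obtain ⟨T₁, tl1, tp1, tu1⟩ := exists_ultrafilter_limit 𝒰 hL ab1 l1
  have ta0 : ∀ x, δ ≤ T₀ x := fun x => ge_of_tendsto' (tp0 x) fun i => a0 i x
  have ta1 : ∀ x, δ ≤ T₁ x := fun x => ge_of_tendsto' (tp1 x) fun i => a1 i x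
  have tb0 : ∀ x, T₀ x ≤ δ⁻¹ + δ := fun x => le_of_tendsto' (tp0 x) fun i => b0 i x
  have tb1 : ∀ x, T₁ x ≤ δ⁻¹ + δ := fun x => le_of_tendsto' (tp1 x) fun i => b1 i x
  have tS : ∀ x y, C (x, y) ^ 2 ≤ T₀ x * T₁ y := fun x y =>
    ge_of_tendsto' ((tp0 x).mul (tp1 y)) fun i => hS i x y
  have hdual := hη.le_energy (continuous_of_abs_le tl0).measurable
    (continuous_of_abs_le tl1).measurable hδ ta0 ta1 tb0 tb1 tS
  have c0 := tendsto_integral_of_unif h0 hK0 (fun i => continuous_of_abs_le (l0 i))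
    (continuous_of_abs_le tl0) ab0 (fun x => by
      rw [abs_of_nonneg (hδ.le.trans (ta0 x))]; exact tb0 x) (tu0 K hK)
  have c1 := tendsto_integral_of_unif h1 hK1 (fun i => continuous_of_abs_le (l1 i))
    (continuous_of_abs_le tl1) ab1 (fun x => by
      rw [abs_of_nonneg (hδ.le.trans (ta1 x))]; exact tb1 x) (tu1 K hK)
  have := le_of_tendsto_of_tendsto' (c0.add c1) (((tendsto_real_univ hπ).const_mul 2).add
    (((tendsto_real_univ h0).add (tendsto_real_univ h1)).const_mul (2 * δ))) hlogC
  linarith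

end Stability

section Density

variable {X : Type*} [MeasurableSpace X] {C : X × X → ℝ}

lemma integral_withDensity_ofReal {Y : Type*} [MeasurableSpace Y] (m : Measure Y) {C : Y → ℝ}
    (hC : Measurable C) (hC0 : ∀ p, 0 ≤ C p) (φ : Y → ℝ) :
    ∫ p, φ p ∂(m.withDensity fun p => ENNReal.ofReal (C p)) = ∫ p, C p * φ p ∂m := by
  rw [integral_withDensity_eq_integral_toReal_smul hC.ennreal_ofReal
    (ae_of_all _ fun _ => ofReal_lt_top)]
  simp only [toReal_ofReal (hC0 _), smul_eq_mul]

lemma withDensity_invPlan {π : Measure (X × X)} (hC : Measurable C) (hpos : ∀ᵐ p ∂π, 0 < C p) :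
    (invPlan C π).withDensity (fun p => ENNReal.ofReal (C p)) = π := by
  have hi : Measurable fun p => ENNReal.ofReal (C p)⁻¹ := hC.inv.ennreal_ofReal
  rw [invPlan, ← withDensity_mul _ hi hC.ennreal_ofReal]
  refine (withDensity_congr_ae (g := 1) ?_).trans withDensity_one
  filter_upwards [hpos] with p hp
  rw [Pi.mul_apply, ← ofReal_mul (inv_nonneg.2 hp.le), inv_mul_cancel₀ hp.ne', ofReal_one,
    Pi.one_apply]

lemma invPlan_withDensity {γ : Measure (X × X)} (hC : Measurable C) (hpos : ∀ᵐ p ∂γ, 0 < C p) :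
    invPlan C (γ.withDensity fun p => ENNReal.ofReal (C p)) = γ := by
  have hi : Measurable fun p => ENNReal.ofReal (C p)⁻¹ := hC.inv.ennreal_ofReal
  rw [invPlan, ← withDensity_mul _ hC.ennreal_ofReal hi]
  refine (withDensity_congr_ae (g := 1) ?_).trans withDensity_one
  filter_upwards [hpos] with p hp
  rw [Pi.mul_apply, ← ofReal_mul hp.le, mul_inv_cancel₀ hp.ne', ofReal_one, Pi.one_apply]

lemma invPlan_ac {π : Measure (X × X)} : invPlan C π ≪ π := withDensity_absolutelyContinuous _ _

lemma isFiniteMeasure_withDensity_le_one {Y : Type*} [MeasurableSpace Y] {γ : Measure Y}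
    [IsFiniteMeasure γ] {C : Y → ℝ} (hC1 : ∀ p, C p ≤ 1) :
    IsFiniteMeasure (γ.withDensity fun p => ENNReal.ofReal (C p)) := by
  refine isFiniteMeasure_withDensity ((lintegral_mono (g := fun _ => 1) fun p => ?_).trans_lt ?_).ne
  · exact ofReal_le_one.2 (hC1 p)
  · simp

end Density

section Limit

variable {ι X : Type*} [MetricSpace X] [MeasurableSpace X] [BorelSpace X]
  [SecondCountableTopology X] {C : X × X → ℝ} {Λ : ℝ}
  {π γ : ι → FiniteMeasure (X × X)} {m₀ m₁ : ι → FiniteMeasure X}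
  {π' γ' : FiniteMeasure (X × X)} {μ₀ μ₁ : FiniteMeasure X} {l : Filter ι}

lemma tendsto_of_invPlan (hC : IsKernel C Λ)
    (hpos : ∀ i, ∀ᵐ p ∂(π i : Measure (X × X)), 0 < C p)
    (hγ : ∀ i, (γ i : Measure (X × X)) = invPlan C (π i)) (hlim : Tendsto γ l (𝓝 γ'))
    (hπ' : (π' : Measure (X × X)) =
      (γ' : Measure (X × X)).withDensity fun p => ENNReal.ofReal (C p)) :
    Tendsto π l (𝓝 π') := by
  have hm := hC.continuous.measurable
  refine FiniteMeasure.tendsto_iff_forall_integral_tendsto.2 fun φ => ?_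
  have e : ∀ i, ∫ p, φ p ∂(π i : Measure (X × X)) = ∫ p, C p * φ p ∂(γ i : Measure (X × X)) :=
    fun i => by
      conv_lhs => rw [← withDensity_invPlan hm (hpos i), ← hγ]
      exact integral_withDensity_ofReal _ hm hC.nonneg _
  simp only [e]
  rw [hπ', integral_withDensity_ofReal _ hm hC.nonneg]
  refine tendsto_integral_bdd hlim (hC.continuous.mul φ.continuous) (B := ‖φ‖) fun p => ?_
  rw [abs_mul, abs_of_nonneg (hC.nonneg p)]
  exact (mul_le_of_le_one_left (abs_nonneg _) (hC.le_one p)).trans (φ.norm_coe_le_norm p)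

/-- The marginals of a limit of the plans `π / C` are absolutely continuous. -/
lemma fst_ac_of_tendsto [l.NeBot] (hC : Measurable C) {M : ℝ≥0∞} (hM : M ≠ ⊤)
    (hM1 : ∀ i, (m₁ i : Measure X) Set.univ ≤ M)
    (hopt : ∀ i, IsOpt C (π i : Measure (X × X)) (m₀ i) (m₁ i))
    (hγ : ∀ i, (γ i : Measure (X × X)) = invPlan C (π i)) (hlim : Tendsto γ l (𝓝 γ'))
    (h0 : Tendsto m₀ l (𝓝 μ₀)) : (γ' : Measure (X × X)).fst ≪ μ₀ := by
  refine absolutelyContinuous_of_lintegral_le hM fun f hf t ht => ?_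
  rw [Measure.fst, lintegral_map (by fun_prop) measurable_fst]
  refine le_of_tendsto_of_tendsto'
    (FiniteMeasure.tendsto_iff_forall_lintegral_tendsto.1 hlim
      (f.compContinuous ⟨Prod.fst, continuous_fst⟩))
    ((ENNReal.Tendsto.const_mul (FiniteMeasure.tendsto_iff_forall_lintegral_tendsto.1 h0 f)
      (Or.inr ofReal_ne_top)).add tendsto_const_nhds) fun i => ?_
  have := (hopt i).lintegral_invPlan_le hC ht (f := fun x => f x) (g := fun _ => 1)
    (by fun_prop) measurable_const (fun x => by exact_mod_cast hf x) fun _ => le_rfl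
  rw [← hγ] at this
  simp only [mul_one, lintegral_one] at this
  exact this.trans (by gcongr; exact hM1 i)

lemma snd_ac_of_tendsto [l.NeBot] (hC : Measurable C) {M : ℝ≥0∞} (hM : M ≠ ⊤)
    (hM0 : ∀ i, (m₀ i : Measure X) Set.univ ≤ M)
    (hopt : ∀ i, IsOpt C (π i : Measure (X × X)) (m₀ i) (m₁ i))
    (hγ : ∀ i, (γ i : Measure (X × X)) = invPlan C (π i)) (hlim : Tendsto γ l (𝓝 γ'))
    (h1 : Tendsto m₁ l (𝓝 μ₁)) : (γ' : Measure (X × X)).snd ≪ μ₁ := by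
  refine absolutelyContinuous_of_lintegral_le hM fun f hf t ht => ?_
  rw [Measure.snd, lintegral_map (by fun_prop) measurable_snd]
  refine le_of_tendsto_of_tendsto'
    (FiniteMeasure.tendsto_iff_forall_lintegral_tendsto.1 hlim
      (f.compContinuous ⟨Prod.snd, continuous_snd⟩))
    ((ENNReal.Tendsto.const_mul (FiniteMeasure.tendsto_iff_forall_lintegral_tendsto.1 h1 f)
      (Or.inr ofReal_ne_top)).add tendsto_const_nhds) fun i => ?_
  have := (hopt i).lintegral_invPlan_le hC (inv_pos.2 ht) (f := fun _ => 1) (g := fun x => f x)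
    measurable_const (by fun_prop) (fun _ => le_rfl) fun x => by exact_mod_cast hf x
  rw [← hγ] at this
  simp only [one_mul, lintegral_one, inv_inv] at this
  rw [add_comm]
  exact this.trans (by gcongr; exact hM0 i)

/-- A limit of optimal plans whose rescalings converge to a measure not charging `{C = 0}` is
optimal. -/
lemma isOpt_of_tendsto {𝒰 : Ultrafilter ι} (hC : IsKernel C Λ) {K : Set X} (hK : IsCompact K)
    (hK0 : ∀ i, ∀ᵐ x ∂(m₀ i : Measure X), x ∈ K) (hK1 : ∀ i, ∀ᵐ x ∂(m₁ i : Measure X), x ∈ K)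
    (h0 : Tendsto m₀ 𝒰 (𝓝 μ₀)) (h1 : Tendsto m₁ 𝒰 (𝓝 μ₁))
    (hopt : ∀ i, IsOpt C (π i : Measure (X × X)) (m₀ i) (m₁ i))
    (hπ : Tendsto π 𝒰 (𝓝 π')) (hpos : ∀ᵐ p ∂(π' : Measure (X × X)), 0 < C p)
    (hac0 : (π' : Measure (X × X)).fst ≪ μ₀) (hac1 : (π' : Measure (X × X)).snd ≪ μ₁) :
    IsOpt C (π' : Measure (X × X)) μ₀ μ₁ := by
  obtain ⟨hadm, hle⟩ := adm_of_tendsto hC hπ h0 h1 hopt hpos hac0 hac1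
  exact ⟨hadm, fun η _ hη => hle.trans (le_energy_of_tendsto hC hK hK0 hK1 hπ h0 h1 hopt hη)⟩

end Limit

section Transversality

variable {X : Type*} [MetricSpace X] [MeasurableSpace X] [BorelSpace X]
  [SecondCountableTopology X] {C : X × X → ℝ} {Λ : ℝ}

/-- Integrated form of the optimality conditions. -/
lemma IsOpt.mul_integral_le {π : Measure (X × X)} {μ₀ μ₁ : Measure X} [IsFiniteMeasure π]
    [IsFiniteMeasure μ₀] [IsFiniteMeasure μ₁] (h : IsOpt C π μ₀ μ₁) (hC : IsKernel C Λ) :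
    ∀ᵐ p ∂π, (∫ x, C (x, p.2) ^ 2 ∂μ₀) * ∫ y, C (p.1, y) ^ 2 ∂μ₁ ≤
      π.real Set.univ ^ 2 * C p ^ 2 := by
  have hm := hC.continuous.measurable
  obtain ⟨X₀, X₁, f0, f1, hX⟩ := exists_full_sets hC.continuous (measurable_dens π.fst μ₀)
    (measurable_dens π.snd μ₁) (h.le_mul_dens hm hC.nonneg hC.le_one)
  have i0 : ∫ x, dens π.fst μ₀ x ∂μ₀ = π.real Set.univ :=
    (Measure.integral_toReal_rnDeriv h.ac₀).trans fst_real_univ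
  have i1 : ∫ x, dens π.snd μ₁ x ∂μ₁ = π.real Set.univ :=
    (Measure.integral_toReal_rnDeriv h.ac₁).trans snd_real_univ
  have hb : ∀ p, |C p ^ 2| ≤ 1 := fun p => by
    rw [abs_of_nonneg (sq_nonneg _)]; exact hC.sq_le_one p
  filter_upwards [ae_of_ae_fst (h.ac₀.ae_le f0), ae_of_ae_snd (h.ac₁.ae_le f1),
    h.mul_dens_le hm] with p hp0 hp1 hle
  have hA : ∫ x, C (x, p.2) ^ 2 ∂μ₀ ≤ π.real Set.univ * dens π.snd μ₁ p.2 := by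
    rw [← i0, ← integral_mul_const]
    refine integral_mono_ae (integrable_bdd _ (by fun_prop) fun x => hb _)
      (Measure.integrable_toReal_rnDeriv.mul_const _) ?_
    filter_upwards [f0] with x hx using hX x hx _ hp1
  have hB : ∫ y, C (p.1, y) ^ 2 ∂μ₁ ≤ dens π.fst μ₀ p.1 * π.real Set.univ := by
    rw [← i1, ← integral_const_mul]
    refine integral_mono_ae (integrable_bdd _ (by fun_prop) fun x => hb _)
      (Measure.integrable_toReal_rnDeriv.const_mul _) ?_
    filter_upwards [f1] with y hy using hX _ hp0 y hy
  calc _ ≤ π.real Set.univ * dens π.snd μ₁ p.2 * (dens π.fst μ₀ p.1 * π.real Set.univ) :=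
        mul_le_mul hA hB (integral_nonneg fun _ => sq_nonneg _)
          (mul_nonneg measureReal_nonneg (dens_nonneg _ _ _))
    _ = π.real Set.univ ^ 2 * (dens π.fst μ₀ p.1 * dens π.snd μ₁ p.2) := by ring
    _ ≤ _ := by gcongr

lemma abs_integral_le {Y : Type*} [MeasurableSpace Y] {μ : Measure Y} [IsFiniteMeasure μ]
    {f : Y → ℝ} {b M : ℝ} (hb : 0 ≤ b) (hf : ∀ y, |f y| ≤ b) (hM : μ.real Set.univ ≤ M) :
    |∫ y, f y ∂μ| ≤ b * M :=
  (norm_integral_le_of_norm_le_const (f := f) (ae_of_all μ hf)).trans (mul_le_mul_of_nonneg_left hM hb)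

variable {ι : Type*} {γ : ι → FiniteMeasure (X × X)} {m₀ m₁ : ι → FiniteMeasure X}
  {γ' : FiniteMeasure (X × X)} {μ₀ μ₁ : FiniteMeasure X}

lemma ae_mul_integral_le_of_tendsto {𝒰 : Ultrafilter ι} (hC : IsKernel C Λ) {K : Set (X × X)}
    (hK : IsCompact K) (hγK : ∀ i, ∀ᵐ p ∂(γ i : Measure (X × X)), p ∈ K)
    (h0 : Tendsto m₀ 𝒰 (𝓝 μ₀)) (h1 : Tendsto m₁ 𝒰 (𝓝 μ₁)) (hγ : Tendsto γ 𝒰 (𝓝 γ')) {M : ℝ}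
    (hM0 : ∀ i, (m₀ i : Measure X).real Set.univ ≤ M)
    (hM1 : ∀ i, (m₁ i : Measure X).real Set.univ ≤ M) {r : ι → ℝ} {r' : ℝ}
    (hr0 : ∀ i, 0 ≤ r i) (hrM : ∀ i, r i ≤ M) (hr : Tendsto r 𝒰 (𝓝 r'))
    (h : ∀ i, ∀ᵐ p ∂(γ i : Measure (X × X)), (∫ x, C (x, p.2) ^ 2 ∂(m₀ i : Measure X)) *
      ∫ y, C (p.1, y) ^ 2 ∂(m₁ i : Measure X) ≤ r i ^ 2 * C p ^ 2) :
    ∀ᵐ p ∂(γ' : Measure (X × X)), (∫ x, C (x, p.2) ^ 2 ∂(μ₀ : Measure X)) *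
      ∫ y, C (p.1, y) ^ 2 ∂(μ₁ : Measure X) ≤ r' ^ 2 * C p ^ 2 := by
  rcases isEmpty_or_nonempty ι with hι | ⟨⟨i₀⟩⟩
  · exact (𝒰.neBot.nonempty.elim fun i => isEmptyElim i)
  have hM : 0 ≤ M := (hr0 i₀).trans (hrM i₀)
  have hcont := hC.continuous
  have hm := hcont.measurable
  have hΛ := hC.const_nonneg
  have hb : ∀ p, |C p ^ 2| ≤ 1 := fun p => by
    rw [abs_of_nonneg (sq_nonneg _)]; exact hC.sq_le_one p
  set A : ι → X → ℝ := fun i y => ∫ x, C (x, y) ^ 2 ∂(m₀ i : Measure X) with hA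
  set B : ι → X → ℝ := fun i x => ∫ y, C (x, y) ^ 2 ∂(m₁ i : Measure X) with hB
  have bA : ∀ i y, |A i y| ≤ M := fun i y => by
    simpa using abs_integral_le zero_le_one (fun x => hb (x, y)) (hM0 i)
  have bB : ∀ i x, |B i x| ≤ M := fun i x => by
    simpa using abs_integral_le zero_le_one (fun y => hb (x, y)) (hM1 i)
  have lA : ∀ i y y', |A i y - A i y'| ≤ 2 * Λ * dist y y' * M := fun i y y' => by
    rw [hA, ← integral_sub (integrable_bdd _ (by fun_prop) fun x => hb (x, y))
      (integrable_bdd _ (by fun_prop) fun x => hb (x, y'))]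
    exact abs_integral_le (by positivity) (fun x => by
      simpa using hC.abs_sq_sub_le x y x y') (hM0 i)
  have lB : ∀ i x x', |B i x - B i x'| ≤ 2 * Λ * dist x x' * M := fun i x x' => by
    rw [hB, ← integral_sub (integrable_bdd _ (by fun_prop) fun y => hb (x, y))
      (integrable_bdd _ (by fun_prop) fun y => hb (x', y))]
    exact abs_integral_le (by positivity) (fun y => by
      simpa using hC.abs_sq_sub_le x y x' y) (hM1 i)
  have hr2 : ∀ i, r i ^ 2 ≤ M ^ 2 := fun i => pow_le_pow_left₀ (hr0 i) (hrM i) 2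
  set G : ι → X × X → ℝ := fun i p => r i ^ 2 * C p ^ 2 - A i p.2 * B i p.1 with hG
  have bG : ∀ i p, |G i p| ≤ M ^ 2 + M * M := fun i p => by
    refine (abs_sub _ _).trans (add_le_add ?_ ?_)
    · rw [abs_mul, abs_of_nonneg (sq_nonneg (r i))]
      exact (mul_le_of_le_one_right (sq_nonneg _) (hb p)).trans (hr2 i)
    · rw [abs_mul]
      exact mul_le_mul (bA _ _) (bB _ _) (abs_nonneg _) hM
  have lG : ∀ i p q, |G i p - G i q| ≤ (8 * Λ * M ^ 2) * dist p q := fun i p q => by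
    have d1 : dist p.1 q.1 ≤ dist p q := le_max_left _ _
    have d2 : dist p.2 q.2 ≤ dist p q := le_max_right _ _
    have e : G i p - G i q = r i ^ 2 * (C p ^ 2 - C q ^ 2) - (A i p.2 - A i q.2) * B i p.1
        - A i q.2 * (B i p.1 - B i q.1) := by simp only [hG]; ring
    have t1 : |r i ^ 2 * (C p ^ 2 - C q ^ 2)| ≤ M ^ 2 * (2 * Λ * (dist p q + dist p q)) := by
      rw [abs_mul, abs_of_nonneg (sq_nonneg (r i))]
      exact mul_le_mul (hr2 i) ((hC.abs_sq_sub_le p.1 p.2 q.1 q.2).trans (by gcongr))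
        (abs_nonneg _) (sq_nonneg _)
    have t2 : |(A i p.2 - A i q.2) * B i p.1| ≤ 2 * Λ * dist p q * M * M := by
      rw [abs_mul]
      exact mul_le_mul ((lA _ _ _).trans (by gcongr)) (bB _ _) (abs_nonneg _) (by positivity)
    have t3 : |A i q.2 * (B i p.1 - B i q.1)| ≤ M * (2 * Λ * dist p q * M) := by
      rw [abs_mul]
      exact mul_le_mul (bA _ _) ((lB _ _ _).trans (by gcongr)) (abs_nonneg _) hM
    rw [e]
    calc _ ≤ M ^ 2 * (2 * Λ * (dist p q + dist p q)) + 2 * Λ * dist p q * M * M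
          + M * (2 * Λ * dist p q * M) :=
          (abs_sub _ _).trans (add_le_add ((abs_sub _ _).trans (add_le_add t1 t2)) t3)
      _ = _ := by ring
  obtain ⟨g, gl, gp, gu⟩ := exists_ultrafilter_limit 𝒰 (by positivity) bG lG
  have hg : ∀ p, g p = r' ^ 2 * C p ^ 2 - (∫ x, C (x, p.2) ^ 2 ∂(μ₀ : Measure X)) *
      ∫ y, C (p.1, y) ^ 2 ∂(μ₁ : Measure X) := fun p =>
    tendsto_nhds_unique (gp p) (((hr.pow 2).mul_const _).sub
      ((tendsto_integral_bdd h0 (by fun_prop) fun x => hb (x, p.2)).mul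
        (tendsto_integral_bdd h1 (by fun_prop) fun y => hb (p.1, y))))
  have := ae_nonneg_of_tendsto hγ hγK (continuous_of_abs_le gl) (gu K hK) fun i =>
    (h i).mono fun p hp => sub_nonneg.2 hp
  filter_upwards [this] with p hp
  rw [hg] at hp
  linarith

end Transversality

section Porous

variable {E : Type*} [NormedAddCommGroup E] [InnerProductSpace ℝ E] [FiniteDimensional ℝ E]
  [MeasurableSpace E] [BorelSpace E]

/-- A set each point of which lies on a sphere of radius `R` whose interior misses the set is
Lebesgue null. -/
lemma volume_eq_zero_of_porous {A : Set E} {R : ℝ} (hR : 0 < R)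
    (h : ∀ x ∈ A, ∃ y, dist x y = R ∧ Disjoint (Metric.ball y R) A) : volume A = 0 := by
  rw [← Measure.restrict_apply_self volume A, measure_eq_zero_iff_ae_notMem]
  refine (IsUnifLocDoublingMeasure.ae_tendsto_measure_inter_div (volume : Measure E) A 2).mono
    fun x hP hx => ?_
  obtain ⟨y, hxy, hy⟩ := h x hx
  have hw : ∀ δ : ℝ, 0 < δ → dist x (x + (2 * δ / R) • (y - x)) ≤ 2 * δ := fun δ hδ => by
    rw [dist_self_add_right, norm_smul, ← dist_eq_norm, dist_comm, hxy, Real.norm_of_nonneg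
      (by positivity), div_mul_cancel₀ _ hR.ne']
  have hlim := hP (l := 𝓝[>] 0) (fun δ => x + (2 * δ / R) • (y - x)) id tendsto_id
    (eventually_mem_nhdsWithin.mono fun δ hδ => hw δ hδ)
  refine zero_ne_one (tendsto_nhds_unique (tendsto_const_nhds.congr' ?_) hlim)
  filter_upwards [Ioo_mem_nhdsGT (half_pos hR)] with δ hδ
  have hempty : A ∩ Metric.closedBall (x + (2 * δ / R) • (y - x)) δ = ∅ := by
    refine Set.eq_empty_of_forall_notMem fun z hz => Set.disjoint_left.1 hy ?_ hz.1
    have h1 : dist (x + (2 * δ / R) • (y - x)) y = R - 2 * δ := by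
      have e : x + (2 * δ / R) • (y - x) - y = (1 - 2 * δ / R) • (x - y) := by module
      have h0 : 0 ≤ 1 - 2 * δ / R := by
        rw [sub_nonneg, div_le_one hR]; linarith [hδ.2]
      rw [dist_eq_norm, e, norm_smul, ← dist_eq_norm x y, hxy, Real.norm_of_nonneg h0]
      field_simp
    have := dist_triangle z (x + (2 * δ / R) • (y - x)) y
    have h2 : dist z (x + (2 * δ / R) • (y - x)) ≤ δ := hz.2
    rw [Metric.mem_ball]
    linarith [hδ.1]
  simp [hempty]

lemma ae_pos_of_mul_integral_le {C : E × E → ℝ} {R r : ℝ} (hR : 0 < R) (hC : Continuous C)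
    (hC0 : ∀ p, 0 ≤ C p) (hC1 : ∀ p, C p ≤ 1) (hCR : ∀ p, 0 < C p ↔ dist p.1 p.2 < R)
    {γ : Measure (E × E)} {μ₀ μ₁ : Measure E} [IsFiniteMeasure μ₀] [IsFiniteMeasure μ₁]
    (hac0 : γ.fst ≪ μ₀) (hac1 : γ.snd ≪ μ₁) (hvol : μ₀ ≪ volume)
    (hdist : ∀ᵐ p ∂γ, dist p.1 p.2 ≤ R)
    (h : ∀ᵐ p ∂γ, (∫ x, C (x, p.2) ^ 2 ∂μ₀) * ∫ y, C (p.1, y) ^ 2 ∂μ₁ ≤ r ^ 2 * C p ^ 2) :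
    ∀ᵐ p ∂γ, 0 < C p := by
  have hm := hC.measurable
  have hb : ∀ p, |C p ^ 2| ≤ 1 := fun p => by
    rw [abs_of_nonneg (sq_nonneg _)]; exact pow_le_one₀ (hC0 p) (hC1 p)
  have hnull : ∀ (μ : Measure E) [IsFiniteMeasure μ] (f : E → ℝ), Measurable f →
      (∀ z, |f z ^ 2| ≤ 1) → ∀ a : E, (∀ z ∈ Metric.ball a R, f z ≠ 0) →
      ∫ z, f z ^ 2 ∂μ ≤ 0 → Disjoint (Metric.ball a R) μ.support := by
    intro μ _ f hf hf1 a ha hle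
    have h0 := (integral_eq_zero_iff_of_nonneg (fun z => sq_nonneg (f z))
      (integrable_bdd μ (hf.pow_const 2) hf1)).1
      (le_antisymm hle (integral_nonneg fun z => sq_nonneg (f z)))
    have hball : μ (Metric.ball a R) = 0 :=
      measure_mono_null (fun z hz => by simpa using ha z hz) (ae_iff.1 h0)
    refine Set.disjoint_left.2 fun z hz hz' => ?_
    exact ((Measure.mem_support_iff_forall z).1 hz' _ (Metric.isOpen_ball.mem_nhds hz)).ne' hball
  set A₀ : Set E := {x | x ∈ μ₀.support ∧ ∃ y, dist x y = R ∧
    Disjoint (Metric.ball y R) μ₀.support} with hA0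
  set A₁ : Set E := {x | ∃ y ∈ μ₁.support, dist x y = R ∧
    Disjoint (Metric.ball x R) μ₁.support} with hA1
  have n0 : volume A₀ = 0 := volume_eq_zero_of_porous hR fun x hx => by
    obtain ⟨-, y, hxy, hy⟩ := hx
    exact ⟨y, hxy, hy.mono_right fun z hz => hz.1⟩
  have n1 : volume A₁ = 0 := volume_eq_zero_of_porous hR fun x hx => by
    obtain ⟨y, hy, hxy, -⟩ := hx
    refine ⟨y, hxy, Set.disjoint_left.2 fun z hz hz' => ?_⟩
    obtain ⟨-, -, -, hz''⟩ := hz'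
    exact Set.disjoint_left.1 hz'' (Metric.mem_ball_comm.1 hz) hy
  have s0 : ∀ᵐ x ∂γ.fst, x ∈ μ₀.support ∧ x ∉ A₀ ∧ x ∉ A₁ := by
    refine hac0.ae_le ?_
    filter_upwards [Measure.support_mem_ae (μ := μ₀), measure_eq_zero_iff_ae_notMem.1 (hvol n0),
      measure_eq_zero_iff_ae_notMem.1 (hvol n1)] with x h1 h2 h3 using ⟨h1, h2, h3⟩
  have s1 : ∀ᵐ y ∂γ.snd, y ∈ μ₁.support := hac1.ae_le Measure.support_mem_ae
  filter_upwards [ae_of_ae_fst s0, ae_of_ae_snd s1, hdist, h] with p hp0 hp1 hd hle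
  by_contra hcon
  have hCp : C p = 0 := le_antisymm (not_lt.1 hcon) (hC0 p)
  have hpR : dist p.1 p.2 = R := le_antisymm hd (not_lt.1 fun hlt => hcon ((hCR p).2 hlt))
  rw [hCp] at hle
  norm_num at hle
  rcases mul_nonpos_iff.1 hle with ⟨-, h2⟩ | ⟨h2, -⟩
  · refine hp0.2.2 ⟨p.2, hp1, hpR, hnull μ₁ (fun y => C (p.1, y)) (by fun_prop)
      (fun _ => hb _) p.1 (fun z hz => ((hCR _).2 ?_).ne') h2⟩
    exact Metric.mem_ball'.1 hz
  · refine hp0.2.1 ⟨hp0.1, p.2, hpR, hnull μ₀ (fun x => C (x, p.2)) (by fun_prop)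
      (fun _ => hb _) p.2 (fun z hz => ((hCR _).2 ?_).ne') h2⟩
    exact Metric.mem_ball.1 hz

end Porous

section Convergence

lemma real_univ_le {Y : Type*} [MeasurableSpace Y] {m : Measure Y} {M : NNReal}
    (h : m Set.univ ≤ M) : m.real Set.univ ≤ M :=
  toReal_le_coe_of_le_coe h

lemma univ_le_invPlan_univ {X : Type*} [MeasurableSpace X] {C : X × X → ℝ} {π : Measure (X × X)}
    (hC1 : ∀ p, C p ≤ 1) (hpos : ∀ᵐ p ∂π, 0 < C p) :
    π Set.univ ≤ invPlan C π Set.univ := by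
  rw [invPlan, withDensity_apply _ MeasurableSet.univ, Measure.restrict_univ, ← lintegral_one]
  refine lintegral_mono_ae (hpos.mono fun p hp => ?_)
  rw [one_le_ofReal]
  exact (one_le_inv₀ hp).2 (hC1 p)

variable {ι E : Type*} [NormedAddCommGroup E] [InnerProductSpace ℝ E] [FiniteDimensional ℝ E]
  [MeasurableSpace E] [BorelSpace E] {C : E × E → ℝ} {Λ R : ℝ}
  {π γ : ι → FiniteMeasure (E × E)} {m₀ m₁ : ι → FiniteMeasure E} {μ₀ μ₁ : FiniteMeasure E}
  {γ' : FiniteMeasure (E × E)} {π' : Measure (E × E)}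

/-- Convergence of the rescaled plans along an ultrafilter. -/
theorem tendsto_invPlan_of_unique {𝒰 : Ultrafilter ι} (hC : IsKernel C Λ) (hR : 0 < R)
    (hCR : ∀ p, 0 < C p ↔ dist p.1 p.2 < R) {K : Set E} (hK : IsCompact K)
    (hK0 : ∀ i, ∀ᵐ x ∂(m₀ i : Measure E), x ∈ K) (hK1 : ∀ i, ∀ᵐ x ∂(m₁ i : Measure E), x ∈ K)
    {M : NNReal} (hM0 : ∀ i, (m₀ i : Measure E) Set.univ ≤ M)
    (hM1 : ∀ i, (m₁ i : Measure E) Set.univ ≤ M)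
    (h0 : Tendsto m₀ 𝒰 (𝓝 μ₀)) (h1 : Tendsto m₁ 𝒰 (𝓝 μ₁)) (hvol : (μ₀ : Measure E) ≪ volume)
    (hopt : ∀ i, IsOpt C (π i : Measure (E × E)) (m₀ i) (m₁ i))
    (hγ : ∀ i, (γ i : Measure (E × E)) = invPlan C (π i))
    (huniq : ∀ η : Measure (E × E), IsFiniteMeasure η → IsOpt C η μ₀ μ₁ → η = π')
    (hγ' : (γ' : Measure (E × E)) = invPlan C π') :
    Tendsto γ 𝒰 (𝓝 γ') := by
  have hcont := hC.continuous
  have hm := hcont.measurable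
  have hac : ∀ i, (γ i : Measure (E × E)) ≪ π i := fun i => hγ i ▸ invPlan_ac
  have hγK : ∀ i, ∀ᵐ p ∂(γ i : Measure (E × E)), p ∈ K ×ˢ K := fun i => (hac i).ae_le <| by
    filter_upwards [ae_of_ae_fst ((hopt i).ac₀.ae_le (hK0 i)),
      ae_of_ae_snd ((hopt i).ac₁.ae_le (hK1 i))] with p h2 h3 using ⟨h2, h3⟩
  have hMM : (M : ℝ≥0∞) ≤ (M + M : NNReal) := by simp
  have hγM : ∀ i, (γ i : Measure (E × E)) Set.univ ≤ (M + M : NNReal) := fun i => by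
    rw [hγ, ENNReal.coe_add]
    exact ((hopt i).invPlan_univ_le hm).trans (add_le_add (hM0 i) (hM1 i))
  have hmem : {m : FiniteMeasure (E × E) | m.mass ≤ M + M ∧ m (K ×ˢ K)ᶜ = 0} ∈ 𝒰.map γ := by
    refine Ultrafilter.mem_map.2 (Filter.univ_mem' fun i => ⟨?_, ?_⟩)
    · rw [← ENNReal.coe_le_coe, FiniteMeasure.ennreal_mass]
      exact hγM i
    · rw [FiniteMeasure.null_iff_toMeasure_null]
      exact hγK i
  obtain ⟨γ₁, -, hle⟩ := (isCompact_setOfPred_finiteMeasure_le_of_isCompact (M + M)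
    (hK.prod hK)).ultrafilter_le_nhds' (𝒰.map γ) hmem
  have hlim : Tendsto γ 𝒰 (𝓝 γ₁) := hle
  have hac0 := fst_ac_of_tendsto hm coe_ne_top hM1 hopt hγ hlim h0
  have hac1 := snd_ac_of_tendsto hm coe_ne_top hM0 hopt hγ hlim h1
  have : IsFiniteMeasure ((γ₁ : Measure (E × E)).withDensity fun p => ENNReal.ofReal (C p)) :=
    isFiniteMeasure_withDensity_le_one hC.le_one
  set π₁ : FiniteMeasure (E × E) :=
    ⟨(γ₁ : Measure (E × E)).withDensity fun p => ENNReal.ofReal (C p), this⟩ with hπ₁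
  have hπlim : Tendsto π 𝒰 (𝓝 π₁) := tendsto_of_invPlan hC (fun i => (hopt i).pos) hγ hlim rfl
  have hdist : ∀ᵐ p ∂(γ₁ : Measure (E × E)), dist p.1 p.2 ≤ R := by
    have := ae_nonneg_of_tendsto hlim hγK (G := fun _ p => R - dist p.1 p.2)
      (g := fun p => R - dist p.1 p.2) (by fun_prop)
      (fun ε hε => Filter.Eventually.of_forall fun i p _ => by simpa using hε.le)
      fun i => (hac i).ae_le <| (hopt i).pos.mono fun p hp => sub_nonneg.2 ((hCR p).1 hp).le
    exact this.mono fun p hp => sub_nonneg.1 hp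
  have hpos : ∀ᵐ p ∂(γ₁ : Measure (E × E)), 0 < C p :=
    ae_pos_of_mul_integral_le hR hcont hC.nonneg hC.le_one hCR hac0 hac1 hvol hdist
      (ae_mul_integral_le_of_tendsto hC (hK.prod hK) hγK h0 h1 hlim
        (fun i => real_univ_le ((hM0 i)|>.trans hMM))
        (fun i => real_univ_le ((hM1 i)|>.trans hMM)) (fun i => measureReal_nonneg)
        (fun i => real_univ_le ((univ_le_invPlan_univ hC.le_one (hopt i).pos).trans
          (hγ i ▸ hγM i))) (tendsto_real_univ hπlim)
        fun i => (hac i).ae_le ((hopt i).mul_integral_le hC))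
  have hπac : (π₁ : Measure (E × E)) ≪ γ₁ := withDensity_absolutelyContinuous _ _
  have hopt₁ := isOpt_of_tendsto hC hK hK0 hK1 h0 h1 hopt hπlim (hπac.ae_le hpos)
    ((hπac.map measurable_fst).trans hac0) ((hπac.map measurable_snd).trans hac1)
  have heq : γ' = γ₁ := by
    refine Subtype.ext ?_
    change (γ' : Measure (E × E)) = γ₁
    rw [hγ', ← huniq _ inferInstance hopt₁]
    exact invPlan_withDensity hm hpos
  rwa [heq]

end Convergence

section Cosine

variable {X : Type*} [MetricSpace X]

/-- The truncated cosine kernel. -/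
noncomputable def cosKernel (κ : ℝ) (p : X × X) : ℝ :=
  Real.cos (min (dist p.1 p.2 / κ) (Real.pi / 2))

variable {κ : ℝ}

lemma cosKernel_eq (hκ : 0 < κ) {p : X × X} (hp : dist p.1 p.2 < κ * Real.pi / 2) :
    cosKernel κ p = Real.cos (dist p.1 p.2 / κ) := by
  rw [cosKernel, min_eq_left]
  rw [div_le_iff₀ hκ]; linarith

lemma isKernel_cosKernel (hκ : 0 < κ) : IsKernel (cosKernel κ : X × X → ℝ) κ⁻¹ where
  nonneg p := Real.cos_nonneg_of_neg_pi_div_two_le_of_le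
    ((neg_nonpos.2 Real.pi_div_two_pos.le).trans
      (le_min (by positivity) Real.pi_div_two_pos.le)) (min_le_right _ _)
  le_one p := Real.cos_le_one _
  const_nonneg := (inv_pos.2 hκ).le
  lip x y x' y' := by
    refine (Real.abs_cos_sub_cos_le _ _).trans ((abs_min_sub_min_le_max _ _ _ _).trans ?_)
    simp only [sub_self, abs_zero, abs_nonneg, sup_of_le_left]
    rw [← sub_div, abs_div, abs_of_pos hκ, div_eq_inv_mul]
    gcongr
    exact dist_dist_dist_le x y x' y'

lemma cosKernel_pos_iff (hκ : 0 < κ) (p : X × X) :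
    0 < cosKernel κ p ↔ dist p.1 p.2 < κ * Real.pi / 2 := by
  have e : dist p.1 p.2 < κ * Real.pi / 2 ↔ dist p.1 p.2 / κ < Real.pi / 2 := by
    rw [div_lt_iff₀ hκ]; ring_nf
  rw [e]
  refine ⟨fun h => ?_, fun h => ?_⟩
  · by_contra hcon
    rw [cosKernel, min_eq_right (not_lt.1 hcon), Real.cos_pi_div_two] at h
    exact h.false
  · rw [cosKernel, min_eq_left h.le]
    refine Real.cos_pos_of_mem_Ioo ⟨?_, h⟩
    have : 0 ≤ dist p.1 p.2 / κ := by positivity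
    linarith [Real.pi_div_two_pos]

end Cosine

section Bridge

variable {n : ℕ} {κ : ℝ} {π : Measure (Eucl n × Eucl n)} {μ0 μ1 : Measure (Eucl n)}

lemma KLdiv_eq_klDiv {α : Type*} [MeasurableSpace α] (ρ μ : Measure α) [IsFiniteMeasure ρ]
    [IsFiniteMeasure μ] : KLdiv ρ μ = klDiv ρ μ := by
  rw [KLdiv, klDiv_eq_lintegral_klFun]
  simp only [klFun_apply, sub_add_eq_add_sub]

lemma cHK_eq (hκ : 0 < κ) {p : Eucl n × Eucl n} (hp : 0 < cosKernel κ p) :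
    cHK κ p.1 p.2 = ENNReal.ofReal (-2 * κ ^ 2 * Real.log (cosKernel κ p)) := by
  have h := (cosKernel_pos_iff hκ p).1 hp
  rw [cHK, if_pos h, cosKernel_eq hκ h]

lemma measurable_cHK : Measurable fun p : Eucl n × Eucl n => cHK κ p.1 p.2 := by
  unfold cHK
  refine Measurable.ite (measurableSet_lt (by fun_prop) measurable_const) ?_ measurable_const
  fun_prop

lemma cost_nonneg (hκ : 0 < κ) {p : Eucl n × Eucl n} (hp : 0 < cosKernel κ p) :
    0 ≤ -2 * κ ^ 2 * Real.log (cosKernel κ p) := by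
  have := Real.log_nonpos hp.le ((isKernel_cosKernel hκ).le_one p)
  nlinarith [sq_nonneg κ]

lemma lintegral_cHK (hκ : 0 < κ) (hpos : ∀ᵐ p ∂π, 0 < cosKernel κ p) :
    ∫⁻ p, cHK κ p.1 p.2 ∂π =
      ∫⁻ p, ENNReal.ofReal (-2 * κ ^ 2 * Real.log (cosKernel κ p)) ∂π :=
  lintegral_congr_ae (hpos.mono fun _ hp => cHK_eq hκ hp)

lemma measurable_cost (hκ : 0 < κ) :
    Measurable fun p : Eucl n × Eucl n => -2 * κ ^ 2 * Real.log (cosKernel κ p) :=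
  ((isKernel_cosKernel hκ).continuous.measurable.log).const_mul _

variable [IsFiniteMeasure π] [IsFiniteMeasure μ0] [IsFiniteMeasure μ1]

lemma HKfun_eq_klDiv : HKfun κ π μ0 μ1 = ∫⁻ p, cHK κ p.1 p.2 ∂π +
    ENNReal.ofReal (κ ^ 2) * klDiv π.fst μ0 + ENNReal.ofReal (κ ^ 2) * klDiv π.snd μ1 := by
  have : IsFiniteMeasure (π.map Prod.fst) := inferInstanceAs (IsFiniteMeasure π.fst)
  have : IsFiniteMeasure (π.map Prod.snd) := inferInstanceAs (IsFiniteMeasure π.snd)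
  rw [HKfun, KLdiv_eq_klDiv, KLdiv_eq_klDiv]
  rfl

lemma adm_of_HKfun_ne_top (hκ : 0 < κ) (h : HKfun κ π μ0 μ1 ≠ ⊤) :
    Adm (cosKernel κ) π μ0 μ1 := by
  have hk : ENNReal.ofReal (κ ^ 2) ≠ 0 := by simpa using hκ.ne'
  rw [HKfun_eq_klDiv, Ne, ENNReal.add_eq_top, ENNReal.add_eq_top] at h
  push Not at h
  obtain ⟨⟨h1, h2⟩, h3⟩ := h
  have hpos : ∀ᵐ p ∂π, 0 < cosKernel κ p := by
    filter_upwards [ae_lt_top measurable_cHK h1] with p hp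
    rw [cosKernel_pos_iff hκ]
    by_contra hcon
    rw [cHK, if_neg hcon] at hp
    exact hp.false
  refine ⟨hpos, ?_, fun h => h2 (by rw [h, mul_top hk]), fun h => h3 (by rw [h, mul_top hk])⟩
  rw [lintegral_cHK hκ hpos] at h1
  have := (lintegral_ofReal_ne_top_iff_integrable (measurable_cost hκ).aestronglyMeasurable
    (hpos.mono fun p hp => cost_nonneg hκ hp)).1 h1
  exact (integrable_const_mul_iff (by simpa using hκ.ne') _).1 this

lemma energy_nonneg (hκ : 0 < κ) (h : Adm (cosKernel κ) π μ0 μ1) :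
    0 ≤ energy (cosKernel κ) π μ0 μ1 := by
  have : ∫ p, Real.log (cosKernel κ p) ∂π ≤ 0 := integral_nonpos_of_ae
    (h.pos.mono fun p hp => Real.log_nonpos hp.le ((isKernel_cosKernel hκ).le_one p))
  have h0 := toReal_nonneg (a := klDiv π.fst μ0)
  have h1 := toReal_nonneg (a := klDiv π.snd μ1)
  rw [energy]
  linarith

lemma HKfun_eq_energy (hκ : 0 < κ) (h : Adm (cosKernel κ) π μ0 μ1) :
    HKfun κ π μ0 μ1 = ENNReal.ofReal (κ ^ 2 * energy (cosKernel κ) π μ0 μ1) := by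
  have hn : 0 ≤ ∫ p, -2 * κ ^ 2 * Real.log (cosKernel κ p) ∂π :=
    integral_nonneg_of_ae (h.pos.mono fun p hp => cost_nonneg hκ hp)
  rw [HKfun_eq_klDiv, lintegral_cHK hκ h.pos, ← ofReal_integral_eq_lintegral_ofReal
    (h.int.const_mul _) (h.pos.mono fun p hp => cost_nonneg hκ hp), ← ofReal_toReal h.kl₀,
    ← ofReal_toReal h.kl₁, ← ofReal_mul (sq_nonneg κ), ← ofReal_mul (sq_nonneg κ),
    ← ofReal_add hn (by positivity), ← ofReal_add (by positivity) (by positivity),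
    integral_const_mul, energy]
  ring_nf

lemma HK2_le : HK2 κ μ0 μ1 ≤ HKfun κ π μ0 μ1 :=
  iInf₂_le (f := fun (η : Measure (Eucl n × Eucl n)) (_ : IsFiniteMeasure η) => HKfun κ η μ0 μ1)
    π inferInstance

lemma HK2_ne_top : HK2 κ μ0 μ1 ≠ ⊤ := by
  refine ((HK2_le (π := 0)).trans_lt ?_).ne
  rw [HKfun_eq_klDiv, Measure.fst_zero, Measure.snd_zero, klDiv_zero_left, klDiv_zero_left,
    lintegral_zero_measure]
  finiteness

lemma HKfun_eq_HK2_iff (hκ : 0 < κ) :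
    HKfun κ π μ0 μ1 = HK2 κ μ0 μ1 ↔ IsOpt (cosKernel κ) π μ0 μ1 := by
  have hk : 0 < κ ^ 2 := by positivity
  refine ⟨fun h => ?_, fun h => le_antisymm ?_ HK2_le⟩
  · have hadm := adm_of_HKfun_ne_top hκ (h ▸ HK2_ne_top)
    refine ⟨hadm, fun η _ hη => ?_⟩
    have hle : HKfun κ π μ0 μ1 ≤ HKfun κ η μ0 μ1 := h ▸ HK2_le
    rw [HKfun_eq_energy hκ hadm, HKfun_eq_energy hκ hη,
      ofReal_le_ofReal_iff (mul_nonneg hk.le (energy_nonneg hκ hη))] at hle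
    exact le_of_mul_le_mul_left hle hk
  · refine le_iInf₂ fun η _ => ?_
    by_cases htop : HKfun κ η μ0 μ1 = ⊤
    · rw [htop]; exact le_top
    have hη := adm_of_HKfun_ne_top hκ htop
    rw [HKfun_eq_energy hκ h.toAdm, HKfun_eq_energy hκ hη]
    exact ofReal_le_ofReal (mul_le_mul_of_nonneg_left (h.minimal η inferInstance hη) hk.le)

lemma withDensity_inv_cos (hκ : 0 < κ) (h : ∀ᵐ p ∂π, 0 < cosKernel κ p) :
    (π.withDensity fun p => ENNReal.ofReal (Real.cos (dist p.1 p.2 / κ))⁻¹) =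
      invPlan (cosKernel κ) π :=
  withDensity_congr_ae (h.mono fun p hp => by
    simp only [cosKernel_eq hκ ((cosKernel_pos_iff hκ p).1 hp)])

end Bridge

end HKNarrow

open HKNarrow

/-- if the `π^N` are optimal plans then `(1/cos(d/κ))·π^N` converges narrowly
to `(1/cos(d/κ))·π`. -/
theorem hk_invcos_plans_narrow_convergence
    {n : ℕ} (hn : 1 ≤ n) (κ : ℝ) (hκ : 0 < κ) (K : Set (Eucl n)) (hK : IsCompact K)
    (μ0N μ1N : ℕ → Measure (Eucl n))
    [∀ N, IsFiniteMeasure (μ0N N)] [∀ N, IsFiniteMeasure (μ1N N)]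
    (hμ0NK : ∀ N, μ0N N Kᶜ = 0) (hμ1NK : ∀ N, μ1N N Kᶜ = 0)
    (μ0 μ1 : Measure (Eucl n)) [IsFiniteMeasure μ0] [IsFiniteMeasure μ1]
    (hμ0conv : NarrowTendsto μ0N μ0) (hμ1conv : NarrowTendsto μ1N μ1)
    (hμ0ac : μ0 ≪ (volume : Measure (Eucl n)))
    -- for each `N`, `π^N` is a minimizer of `E_κ(·|μ0^N,μ1^N)`
    (π : ℕ → Measure (Eucl n × Eucl n)) [∀ N, IsFiniteMeasure (π N)]
    (hπNopt : ∀ N, HKfun κ (π N) (μ0N N) (μ1N N) = HK2 κ (μ0N N) (μ1N N))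
    -- `π` is the unique minimizer of `E_κ(·|μ0,μ1)`
    (πlim : Measure (Eucl n × Eucl n)) [IsFiniteMeasure πlim]
    (hπopt : HKfun κ πlim μ0 μ1 = HK2 κ μ0 μ1)
    (hπuniq : ∀ π' : Measure (Eucl n × Eucl n), IsFiniteMeasure π' →
      HKfun κ π' μ0 μ1 = HK2 κ μ0 μ1 → π' = πlim) :
    (∀ N, IsFiniteMeasure
      ((π N).withDensity fun p => ENNReal.ofReal (Real.cos (dist p.1 p.2 / κ))⁻¹)) ∧
    IsFiniteMeasure
      (πlim.withDensity fun p => ENNReal.ofReal (Real.cos (dist p.1 p.2 / κ))⁻¹) ∧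
    NarrowTendsto
      (fun N => (π N).withDensity fun p => ENNReal.ofReal (Real.cos (dist p.1 p.2 / κ))⁻¹)
      (πlim.withDensity fun p => ENNReal.ofReal (Real.cos (dist p.1 p.2 / κ))⁻¹) := by
  have hC := isKernel_cosKernel (X := Eucl n) hκ
  have hm := hC.continuous.measurable
  have hR : 0 < κ * Real.pi / 2 := by positivity
  have hopt := fun N => (HKfun_eq_HK2_iff hκ).1 (hπNopt N)
  have hoptlim := (HKfun_eq_HK2_iff hκ).1 hπopt
  have fin : ∀ N, IsFiniteMeasure (invPlan (cosKernel κ) (π N)) := fun N =>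
    (hopt N).isFiniteMeasure_invPlan hm
  have finlim := hoptlim.isFiniteMeasure_invPlan hm
  simp only [withDensity_inv_cos hκ (hopt _).pos, withDensity_inv_cos hκ hoptlim.pos]
  refine ⟨fin, finlim, ?_⟩
  set m₀ : ℕ → FiniteMeasure (Eucl n) := fun N => ⟨μ0N N, inferInstance⟩
  set m₁ : ℕ → FiniteMeasure (Eucl n) := fun N => ⟨μ1N N, inferInstance⟩
  have h0 : Tendsto m₀ atTop (𝓝 ⟨μ0, inferInstance⟩) :=
    FiniteMeasure.tendsto_iff_forall_integral_tendsto.2 hμ0conv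
  have h1 : Tendsto m₁ atTop (𝓝 ⟨μ1, inferInstance⟩) :=
    FiniteMeasure.tendsto_iff_forall_integral_tendsto.2 hμ1conv
  obtain ⟨M₀, hM₀⟩ := ((FiniteMeasure.continuous_mass.tendsto _).comp h0).bddAbove_range
  obtain ⟨M₁, hM₁⟩ := ((FiniteMeasure.continuous_mass.tendsto _).comp h1).bddAbove_range
  have mass_le : ∀ {m : FiniteMeasure (Eucl n)} {M : NNReal}, m.mass ≤ M →
      (m : Measure (Eucl n)) Set.univ ≤ M := fun {m M} h => by
    rw [← FiniteMeasure.ennreal_mass]; exact_mod_cast h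
  set γ : ℕ → FiniteMeasure (Eucl n × Eucl n) :=
    fun N => ⟨invPlan (cosKernel κ) (π N), fin N⟩ with hγ
  set γ' : FiniteMeasure (Eucl n × Eucl n) := ⟨invPlan (cosKernel κ) πlim, finlim⟩ with hγ'
  suffices h : Tendsto γ atTop (𝓝 γ') from FiniteMeasure.tendsto_iff_forall_integral_tendsto.1 h
  refine (tendsto_iff_ultrafilter γ atTop (𝓝 γ')).2 fun 𝒰 h𝒰 => ?_
  exact tendsto_invPlan_of_unique (π := fun N => ⟨π N, inferInstance⟩) (m₀ := m₀) (m₁ := m₁)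
    (M := max M₀ M₁) hC hR
    (cosKernel_pos_iff hκ) hK hμ0NK hμ1NK
    (fun N => mass_le ((hM₀ ⟨N, rfl⟩).trans (le_max_left _ _)))
    (fun N => mass_le ((hM₁ ⟨N, rfl⟩).trans (le_max_right _ _)))
    (h0.mono_left h𝒰) (h1.mono_left h𝒰) hμ0ac hopt (fun _ => rfl)
    (fun η hη hη' => hπuniq η hη ((HKfun_eq_HK2_iff hκ).2 hη')) rfl
end
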